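/- Fix A > 1. Then ∑_{p ≤ x} K*(p) = (2/3)·C₂·J·π(x) + O_A(x/(log x)^A) for x ≥ 2, where C₂ = ∏_{p>2}(1 − 1/(p−1)²) and J = ∏_{p>2}(1 + 1/((p−2)(p−1)(p+1))). The same asymptotic holds with K* replaced by K. -/

import Mathlib

/-- The Euler factor at `p` of the function `K(N)` from Definition 1. Here
`((N-1)/p)² = 1` if `p ∤ N - 1` and `0` if `p ∣ N - 1`. -/
noncomputable def Kfactor (N : ℕ) (p : ℕ) : ℝ :=
  if p ∣ N then
    1 - 1/((p:ℝ)^(N.factorization p) * ((p:ℝ) - 1))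
  else
    1 - ((if (p:ℤ) ∣ ((N:ℤ) - 1) then (0:ℝ) else 1) * (p:ℝ) + 1)
          / (((p:ℝ) - 1)^2 * ((p:ℝ) + 1))

/-- The function `K(N)` of Definition 1, as a product over all primes. -/
noncomputable def K (N : ℕ) : ℝ := ∏' p : Nat.Primes, Kfactor N (p : ℕ)

/-- The function `K*(N) = K(N)·N/φ(N)`. -/
noncomputable def Kstar (N : ℕ) : ℝ := K N * (N:ℝ) / (Nat.totient N : ℝ)

/-- The twin prime constant `C₂ = ∏_{p > 2} (1 - 1/(p-1)²)`. -/
noncomputable def C₂ : ℝ :=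
  ∏' p : Nat.Primes, if (p : ℕ) = 2 then 1 else (1 - 1/(((p:ℕ):ℝ) - 1)^2)

/-- The constant `J = ∏_{p > 2} (1 + 1/((p-2)(p-1)(p+1)))`. -/
noncomputable def J : ℝ :=
  ∏' p : Nat.Primes, if (p : ℕ) = 2 then 1 else
    (1 + 1/((((p:ℕ):ℝ) - 2) * (((p:ℕ):ℝ) - 1) * (((p:ℕ):ℝ) + 1)))

section

namespace SW
open Complex Finset

theorem logpow_le (j : ℕ) {δ : ℝ} (hδ : 0 < δ) :
    ∃ C : ℝ, 0 < C ∧ ∀ u : ℝ, 1 ≤ u → Real.log u ^ j ≤ C * u ^ δ := by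
  set d := δ / (j + 1) with hd
  have hd0 : 0 < d := by positivity
  refine ⟨(1 / d) ^ j, by positivity, fun u hu => ?_⟩
  have h1 := Real.log_le_rpow_div (by linarith : 0 ≤ u) hd0
  calc Real.log u ^ j ≤ (u ^ d / d) ^ j := by
        gcongr; exact Real.log_nonneg hu
    _ = (1 / d) ^ j * u ^ (d * j) := by
        rw [Real.rpow_mul (by linarith), Real.rpow_natCast, ← mul_pow]; ring
    _ ≤ _ := by
        gcongr
        rw [hd, div_mul_eq_mul_div, div_le_iff₀ (by positivity)]
        nlinarith

theorem sum_by_parts (b g : ℕ → ℂ) (M : ℕ) :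
    ∑ i ∈ range M, b i * g i = (∑ i ∈ range M, b i) * g M
      + ∑ i ∈ range M, (∑ k ∈ range (i + 1), b k) * (g i - g (i + 1)) := by
  induction M with
  | zero => simp
  | succ M ih => rw [sum_range_succ, ih, sum_range_succ (fun i => _ * (g i - _)), sum_range_succ b]; ring

theorem norm_sum_by_parts (b g : ℕ → ℂ) {B : ℝ} (hB : ∀ M, ‖∑ i ∈ range M, b i‖ ≤ B) (M : ℕ) :
    ‖∑ i ∈ range M, b i * g i‖ ≤ B * (‖g M‖ + ∑ i ∈ range M, ‖g i - g (i + 1)‖) := by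
  rw [sum_by_parts, mul_add, mul_sum]
  refine (norm_add_le _ _).trans (add_le_add ?_ ((norm_sum_le _ _).trans (sum_le_sum fun i _ => ?_)))
  · rw [norm_mul]; gcongr; exact hB _
  · rw [norm_mul]; gcongr; exact hB _

/-- smooth factor -/
noncomputable def Fz (j : ℕ) (s : ℂ) (u : ℝ) : ℂ := (Real.log u : ℂ) ^ j * (u : ℂ) ^ (-s)

theorem norm_Fz (j : ℕ) (s : ℂ) {u : ℝ} (hu : 1 ≤ u) :
    ‖Fz j s u‖ = Real.log u ^ j * u ^ (-s.re) := by
  rw [Fz, norm_mul, norm_pow, norm_real, Complex.norm_cpow_eq_rpow_re_of_pos (by linarith),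
    Real.norm_of_nonneg (Real.log_nonneg hu)]; simp

theorem hasDerivAt_Fz (j : ℕ) (s : ℂ) {u : ℝ} (hu : 0 < u) :
    HasDerivAt (Fz j s) ((j * (Real.log u : ℂ) ^ (j - 1) * (u⁻¹ : ℝ)) * (u : ℂ) ^ (-s)
      + (Real.log u : ℂ) ^ j * ((-s) * (u : ℂ) ^ (-s - 1))) u := by
  have h1 : HasDerivAt (fun x : ℝ => (Real.log x : ℂ)) ((u⁻¹ : ℝ) : ℂ) u :=
    (Real.hasDerivAt_log hu.ne').ofReal_comp
  have h2 : HasDerivAt (fun x : ℝ => (x : ℂ) ^ (-s)) ((-s) * (u : ℂ) ^ (-s - 1)) u := by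
    have := (hasDerivAt_id (u : ℂ)).cpow_const (c := -s) (by simp [slitPlane, hu])
    simpa using this.comp_ofReal
  exact (h1.pow j).mul h2

theorem deriv_Fz_le (j : ℕ) {δ : ℝ} (hδ : 0 < δ) : ∃ C : ℝ, 0 < C ∧ ∀ (s : ℂ), 1 ≤ s.re → ∀ u : ℝ, 1 ≤ u →
    ‖deriv (Fz j s) u‖ ≤ C * (‖s‖ + j) * u ^ (-2 + δ) := by
  obtain ⟨C1, hC1, h1⟩ := logpow_le j hδ
  obtain ⟨C2, hC2, h2⟩ := logpow_le (j - 1) hδ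
  refine ⟨C1 + C2, by positivity, fun s hs u hu => ?_⟩
  have hu0 : 0 < u := by linarith
  have hlog := Real.log_nonneg hu
  rw [(hasDerivAt_Fz j s hu0).deriv]
  refine (norm_add_le _ _).trans ?_
  simp only [norm_mul, norm_pow, norm_real, Real.norm_of_nonneg hlog, Complex.norm_cpow_eq_rpow_re_of_pos hu0,
    norm_neg, Complex.norm_natCast, neg_re, sub_re, one_re, norm_inv, Real.norm_of_nonneg hu0.le]
  have e1 : u ^ (-s.re) ≤ u ^ (-1 : ℝ) := Real.rpow_le_rpow_of_exponent_le hu (by linarith)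
  have e2 : u ^ (-s.re - 1) ≤ u ^ (-2 : ℝ) := Real.rpow_le_rpow_of_exponent_le hu (by linarith)
  have e3 : u⁻¹ * u ^ (-1 : ℝ) = u ^ (-2 : ℝ) := by
    rw [← Real.rpow_neg_one u, ← Real.rpow_add hu0]; norm_num
  have e4 : u ^ (-2 + δ) = u ^ δ * u ^ (-2 : ℝ) := by rw [← Real.rpow_add hu0]; ring_nf
  have p2 := Real.rpow_pos_of_pos hu0 (-2)
  have pd := Real.rpow_pos_of_pos hu0 δ
  calc j * Real.log u ^ (j - 1) * u⁻¹ * u ^ (-s.re) + Real.log u ^ j * (‖s‖ * u ^ (-s.re - 1))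
      ≤ j * (C2 * u ^ δ) * u⁻¹ * u ^ (-1 : ℝ) + (C1 * u ^ δ) * (‖s‖ * u ^ (-2 : ℝ)) := by
        gcongr
        · exact h2 u hu
        · exact h1 u hu
    _ = (C2 * j + C1 * ‖s‖) * (u ^ δ * u ^ (-2 : ℝ)) := by rw [mul_assoc _ u⁻¹, e3]; ring
    _ ≤ (C1 + C2) * (‖s‖ + j) * (u ^ δ * u ^ (-2 : ℝ)) := by
        gcongr
        have := norm_nonneg s
        have : (0:ℝ) ≤ j := by positivity
        nlinarith [mul_nonneg hC2.le (norm_nonneg s), mul_nonneg hC1.le this]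
    _ = _ := by rw [e4]

theorem diff_Fz_le (j : ℕ) {δ : ℝ} (hδ : 0 < δ) (hδ2 : δ < 2) : ∃ C : ℝ, 0 < C ∧ ∀ (s : ℂ), 1 ≤ s.re → ∀ u v : ℝ, 1 ≤ u →
    u ≤ v → ‖Fz j s v - Fz j s u‖ ≤ C * (‖s‖ + j) * u ^ (-2 + δ) * (v - u) := by
  obtain ⟨C, hC, h⟩ := deriv_Fz_le j hδ
  refine ⟨C, hC, fun s hs u v hu hv => ?_⟩
  have := (convex_Icc u v).norm_image_sub_le_of_norm_deriv_le (f := Fz j s)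
    (C := C * (‖s‖ + j) * u ^ (-2 + δ)) (x := u) (y := v) ?_ ?_ ?_ ?_
  · rwa [Real.norm_of_nonneg (by linarith : 0 ≤ v - u)] at this
  · intro x hx
    exact (hasDerivAt_Fz j s (by linarith [hx.1])).differentiableAt
  · intro x hx
    refine (h s hs x (by linarith [hx.1])).trans ?_
    have : x ^ (-2 + δ) ≤ u ^ (-2 + δ) := Real.rpow_le_rpow_of_nonpos (by linarith) hx.1 (by linarith)
    gcongr
  · simp [hv]
  · simp [hv]

theorem logMul_iter (a : ℕ → ℂ) (j n : ℕ) :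
    (LSeries.logMul^[j] a) n = (Real.log n : ℂ) ^ j * a n := by
  induction j with
  | zero => simp
  | succ j ih =>
    rw [Function.iterate_succ_apply', LSeries.logMul, ih, Complex.natCast_log]; ring

theorem term_eq (a : ℕ → ℂ) (j n : ℕ) {s : ℂ} (hs : s ≠ 0) :
    LSeries.term (LSeries.logMul^[j] a) s n = a n * Fz j s n := by
  rw [LSeries.term_def]
  split_ifs with h
  · subst h; simp [Fz, hs]
  · rw [logMul_iter, Fz, Complex.cpow_neg]; push_cast; ring

theorem abscissa_le_one {a : ℕ → ℂ} (ha : ∀ n, ‖a n‖ ≤ 1) : LSeries.abscissaOfAbsConv a ≤ 1 :=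
  LSeries.abscissaOfAbsConv_le_of_le_const ⟨1, fun n _ => ha n⟩

theorem summable_log {a : ℕ → ℂ} (ha : ∀ n, ‖a n‖ ≤ 1) (j : ℕ) {s : ℂ} (hs : 1 < s.re) :
    LSeriesSummable (LSeries.logMul^[j] a) s := by
  apply LSeriesSummable_of_abscissaOfAbsConv_lt_re
  rw [LSeries.absicssaOfAbsConv_logPowMul]
  exact (abscissa_le_one ha).trans_lt (by exact_mod_cast hs)

theorem upper (j : ℕ) {ε : ℝ} (hε : 0 < ε) : ∃ C : ℝ, 0 < C ∧ ∀ (a : ℕ → ℂ) (q : ℝ), 1 ≤ q →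
    (∀ n, ‖a n‖ ≤ 1) → (∀ M, ‖∑ n ∈ range M, a n‖ ≤ q) → ∀ s : ℂ, 1 < s.re → s.re ≤ 2 →
    ‖LSeries (LSeries.logMul^[j] a) s‖ ≤ C * (q * (|s.im| + 2)) ^ ε := by
  set δ := ε / 5 with hδ
  have hδ0 : 0 < δ := by positivity
  obtain ⟨C1, hC1, h1⟩ := logpow_le j (by positivity : 0 < δ / 2)
  obtain ⟨C2, hC2, h2⟩ := diff_Fz_le j (by norm_num : (0:ℝ) < 1 / 4) (by norm_num)
  obtain ⟨C3, hC3, h3⟩ := logpow_le j (by norm_num : (0:ℝ) < 1 / 4)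
  set Z1 := ∑' n : ℕ, (1 : ℝ) / (n : ℝ) ^ (1 + δ / 2)
  have hZ1s : Summable (fun n : ℕ => (1 : ℝ) / (n : ℝ) ^ (1 + δ / 2)) :=
    Real.summable_one_div_nat_rpow.2 (by linarith)
  have hZ1 : 0 ≤ Z1 := tsum_nonneg fun n => by positivity
  set Z2 := ∑' n : ℕ, (1 : ℝ) / (n : ℝ) ^ (3 / 2 : ℝ)
  have hZ2s : Summable (fun n : ℕ => (1 : ℝ) / (n : ℝ) ^ (3 / 2 : ℝ)) :=
    Real.summable_one_div_nat_rpow.2 (by norm_num)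
  have hZ2 : 0 ≤ Z2 := tsum_nonneg fun n => by positivity
  refine ⟨C1 * Z1 + (2 * C3 + 2 * C2 * (1 + j) * Z2), by positivity, fun a q hq ha hS s hs hs2 => ?_⟩
  have hs0 : s ≠ 0 := by rintro rfl; norm_num at hs
  set X := q * (|s.im| + 2) with hX
  have hX2 : 2 ≤ X := by nlinarith [abs_nonneg s.im]
  set N := ⌈X ^ 4⌉₊ with hN
  have hNge : X ^ 4 ≤ N := Nat.le_ceil _
  have hX4 : 16 ≤ X ^ 4 := by
    calc (16:ℝ) = 2 ^ 4 := by norm_num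
      _ ≤ _ := by gcongr
  have hNle : (N : ℝ) ≤ X ^ 5 := by
    have := (Nat.ceil_lt_add_one (by positivity : 0 ≤ X ^ 4)).le
    calc (N : ℝ) ≤ X ^ 4 + 1 := this
      _ ≤ X ^ 4 * 2 := by linarith
      _ ≤ X ^ 4 * X := by gcongr
      _ = X ^ 5 := by ring
  have hN1 : (1:ℝ) ≤ N := by linarith
  have hsum : Summable (LSeries.term (LSeries.logMul^[j] a) s) := summable_log ha j hs
  have hXε : 1 ≤ X ^ ε := Real.one_le_rpow (by linarith) hε.le
  rw [LSeries, ← hsum.sum_add_tsum_nat_add N]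
  have head : ‖∑ n ∈ range N, LSeries.term (LSeries.logMul^[j] a) s n‖ ≤ C1 * Z1 * X ^ ε := by
    have hNδ : (N : ℝ) ^ δ ≤ X ^ ε := by
      calc (N : ℝ) ^ δ ≤ (X ^ 5) ^ δ := by gcongr
        _ = X ^ ε := by
          rw [← Real.rpow_natCast, ← Real.rpow_mul (by linarith)]; congr 1; rw [hδ]; push_cast; ring
    have : ∀ n ∈ range N, ‖LSeries.term (LSeries.logMul^[j] a) s n‖ ≤
        C1 * (N : ℝ) ^ δ * (1 / (n : ℝ) ^ (1 + δ / 2)) := by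
      intro n hn
      rcases Nat.eq_zero_or_pos n with rfl | hn0
      · simp; positivity
      have hn1 : (1:ℝ) ≤ n := by exact_mod_cast hn0
      have hn0' : (0:ℝ) < n := by linarith
      have hnN : (n:ℝ) ≤ N := by exact_mod_cast (mem_range.1 hn).le
      rw [term_eq _ _ _ hs0, norm_mul, norm_Fz _ _ hn1]
      calc ‖a n‖ * (Real.log n ^ j * (n:ℝ) ^ (-s.re)) ≤ 1 * ((C1 * (n:ℝ) ^ (δ/2)) * (n:ℝ) ^ (-1 : ℝ)) := by
            have := ha n
            have := h1 n hn1
            gcongr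
        _ = C1 * (n:ℝ) ^ δ * (1 / (n : ℝ) ^ (1 + δ / 2)) := by
            rw [one_mul, one_div, ← Real.rpow_neg hn0'.le, mul_assoc, mul_assoc, ← Real.rpow_add hn0',
              ← Real.rpow_add hn0']
            ring_nf
        _ ≤ _ := by gcongr
    calc _ ≤ ∑ n ∈ range N, C1 * (N : ℝ) ^ δ * (1 / (n : ℝ) ^ (1 + δ / 2)) := norm_sum_le_of_le _ this
      _ = C1 * (N : ℝ) ^ δ * ∑ n ∈ range N, (1 / (n : ℝ) ^ (1 + δ / 2)) := by rw [mul_sum]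
      _ ≤ C1 * X ^ ε * Z1 := by
          gcongr
          exact hZ1s.sum_le_tsum _ fun n _ => by positivity
      _ = _ := by ring
  have hqN : q * (‖s‖ + j) * (N:ℝ) ^ (-(1/4) : ℝ) ≤ 1 + j := by
    have e : (N:ℝ) ^ (-(1/4) : ℝ) ≤ X⁻¹ := by
      calc (N:ℝ) ^ (-(1/4) : ℝ) ≤ (X ^ 4) ^ (-(1/4) : ℝ) :=
            Real.rpow_le_rpow_of_nonpos (by positivity) hNge (by norm_num)
        _ = X⁻¹ := by
            rw [← Real.rpow_natCast, ← Real.rpow_mul (by linarith), ← Real.rpow_neg_one]; norm_num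
    have e2 : ‖s‖ ≤ |s.im| + 2 := by
      refine (Complex.norm_le_abs_re_add_abs_im s).trans ?_
      rw [abs_of_pos (by linarith)]; linarith
    calc q * (‖s‖ + j) * (N:ℝ) ^ (-(1/4) : ℝ) ≤ q * ((|s.im| + 2) + j) * X⁻¹ := by gcongr
      _ ≤ q * ((|s.im| + 2) * (1 + j)) * X⁻¹ := by
          gcongr
          have : (0:ℝ) ≤ j := by positivity
          nlinarith [abs_nonneg s.im]
      _ = 1 + j := by rw [hX]; field_simp
  have tail : ‖∑' i, LSeries.term (LSeries.logMul^[j] a) s (i + N)‖ ≤ 2 * C3 + 2 * C2 * (1 + j) * Z2 := by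
    have hsumt : Summable fun i => LSeries.term (LSeries.logMul^[j] a) s (i + N) :=
      (summable_nat_add_iff N).2 hsum
    refine le_of_tendsto hsumt.hasSum.tendsto_sum_nat.norm (Filter.Eventually.of_forall fun M => ?_)
    have hB : ∀ M, ‖∑ i ∈ range M, a (i + N)‖ ≤ 2 * q := by
      intro M
      have : ∑ i ∈ range M, a (i + N) = ∑ i ∈ range (N + M), a i - ∑ i ∈ range N, a i := by
        rw [sum_range_add]; simp [add_comm]
      rw [this]
      refine (norm_sub_le _ _).trans ?_
      linarith [hS (N + M), hS N]
    simp_rw [term_eq _ _ _ hs0]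
    refine (norm_sum_by_parts (fun i => a (i + N)) (fun i => Fz j s ((i + N : ℕ) : ℝ)) hB M).trans ?_
    have hpt : ∀ i : ℕ, (1:ℝ) ≤ ((i + N : ℕ) : ℝ) := fun i => by push_cast; linarith [(Nat.cast_nonneg i : (0:ℝ) ≤ i)]
    have hptN : ∀ i : ℕ, (N:ℝ) ≤ ((i + N : ℕ) : ℝ) := fun i => by push_cast; linarith [(Nat.cast_nonneg i : (0:ℝ) ≤ i)]
    have b1 : ‖Fz j s ((M + N : ℕ) : ℝ)‖ ≤ C3 * (N:ℝ) ^ (-(1/4) : ℝ) := by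
      rw [norm_Fz _ _ (hpt M)]
      set m := ((M + N : ℕ) : ℝ)
      have hm : 1 ≤ m := hpt M
      calc Real.log m ^ j * m ^ (-s.re) ≤ (C3 * m ^ (1/4 : ℝ)) * m ^ (-1 : ℝ) := by
            gcongr
            exact h3 m hm
        _ = C3 * m ^ (-(3/4) : ℝ) := by rw [mul_assoc, ← Real.rpow_add (by linarith)]; norm_num
        _ ≤ C3 * m ^ (-(1/4) : ℝ) := by
            gcongr
            norm_num
        _ ≤ _ := by
            gcongr ?_ * ?_
            exact Real.rpow_le_rpow_of_nonpos (by linarith) (hptN M) (by norm_num)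
    have b2 : ∑ i ∈ range M, ‖Fz j s ((i + N : ℕ) : ℝ) - Fz j s ((i + 1 + N : ℕ) : ℝ)‖ ≤
        C2 * (‖s‖ + j) * (N:ℝ) ^ (-(1/4) : ℝ) * Z2 := by
      have hh : ∀ i ∈ range M, ‖Fz j s ((i + N : ℕ) : ℝ) - Fz j s ((i + 1 + N : ℕ) : ℝ)‖ ≤
          C2 * (‖s‖ + j) * (N:ℝ) ^ (-(1/4) : ℝ) * (1 / ((i + N : ℕ) : ℝ) ^ (3/2 : ℝ)) := by
        intro i _
        rw [norm_sub_rev]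
        refine (h2 s hs.le _ _ (hpt i) (by push_cast; linarith)).trans ?_
        set m := ((i + N : ℕ) : ℝ) with hm'
        have hm : 1 ≤ m := hpt i
        have : ((i + 1 + N : ℕ) : ℝ) - m = 1 := by rw [hm']; push_cast; ring
        rw [this, mul_one, mul_assoc _ ((N:ℝ) ^ _)]
        refine mul_le_mul_of_nonneg_left ?_ (by positivity)
        rw [one_div (m ^ _), ← Real.rpow_neg (by linarith)]
        calc m ^ (-2 + 1/4 : ℝ) = m ^ (-(1/4) : ℝ) * m ^ (-(3/2) : ℝ) := by
              rw [← Real.rpow_add (by linarith)]; norm_num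
          _ ≤ _ := by
            gcongr ?_ * ?_
            exact Real.rpow_le_rpow_of_nonpos (by linarith) (hptN i) (by norm_num)
      refine (sum_le_sum hh).trans ?_
      rw [← mul_sum]
      gcongr
      have := (hZ2s.comp_injective (add_left_injective N)).sum_le_tsum (range M) (fun n _ => by simp; positivity)
      refine le_trans this ?_
      exact tsum_comp_le_tsum_of_inj hZ2s (fun n => by positivity) (add_left_injective N)
    have hq1 : q * (N:ℝ) ^ (-(1/4) : ℝ) ≤ 1 := by
      have e : (N:ℝ) ^ (-(1/4) : ℝ) ≤ X⁻¹ := by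
        calc (N:ℝ) ^ (-(1/4) : ℝ) ≤ (X ^ 4) ^ (-(1/4) : ℝ) :=
              Real.rpow_le_rpow_of_nonpos (by positivity) hNge (by norm_num)
          _ = X⁻¹ := by
              rw [← Real.rpow_natCast, ← Real.rpow_mul (by linarith), ← Real.rpow_neg_one]; norm_num
      calc _ ≤ q * X⁻¹ := by gcongr
        _ ≤ X * X⁻¹ := by gcongr; nlinarith [abs_nonneg s.im]
        _ = 1 := mul_inv_cancel₀ (by linarith)
    calc _ ≤ 2 * q * (C3 * (N:ℝ) ^ (-(1/4) : ℝ) + C2 * (‖s‖ + j) * (N:ℝ) ^ (-(1/4) : ℝ) * Z2) := by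
          gcongr
      _ = 2 * C3 * (q * (N:ℝ) ^ (-(1/4) : ℝ)) + 2 * C2 * (q * (‖s‖ + j) * (N:ℝ) ^ (-(1/4) : ℝ)) * Z2 := by ring
      _ ≤ 2 * C3 * 1 + 2 * C2 * (1 + j) * Z2 := by gcongr
      _ = _ := by ring
  calc _ ≤ C1 * Z1 * X ^ ε + (2 * C3 + 2 * C2 * (1 + j) * Z2) * 1 := by
        rw [mul_one]; exact (norm_add_le _ _).trans (add_le_add head tail)
    _ ≤ C1 * Z1 * X ^ ε + (2 * C3 + 2 * C2 * (1 + j) * Z2) * X ^ ε := by gcongr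
    _ = _ := by ring

end SW

end

section

namespace SW
open Complex Finset

theorem sum_range_zmod {q : ℕ} [NeZero q] (f : ZMod q → ℂ) :
    ∑ n ∈ range q, f (n : ZMod q) = ∑ x : ZMod q, f x := by
  refine sum_bij (fun n _ => (n : ZMod q)) (fun _ _ => mem_univ _) ?_ ?_ (fun _ _ => rfl)
  · intro a ha b hb h
    have := (ZMod.natCast_eq_natCast_iff' a b q).1 h
    rwa [Nat.mod_eq_of_lt (mem_range.1 ha), Nat.mod_eq_of_lt (mem_range.1 hb)] at this
  · intro x _
    exact ⟨x.val, mem_range.2 (ZMod.val_lt x), by simp⟩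

theorem char_partial {q : ℕ} [NeZero q] {χ : DirichletCharacter ℂ q} (hχ : χ ≠ 1) (M : ℕ) :
    ‖∑ n ∈ range M, χ (n : ZMod q)‖ ≤ q := by
  induction M using Nat.strong_induction_on with
  | _ M ih =>
    rcases lt_or_ge M q with h | h
    · calc _ ≤ ∑ n ∈ range M, (1:ℝ) := norm_sum_le_of_le _ fun n _ => DirichletCharacter.norm_le_one χ _
        _ = M := by simp
        _ ≤ q := by exact_mod_cast h.le
    · obtain ⟨m, rfl⟩ := Nat.exists_eq_add_of_le h
      have hq := NeZero.pos q
      rw [sum_range_add, sum_range_zmod, MulChar.sum_eq_zero_of_ne_one hχ, zero_add]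
      simpa using ih m (by omega)

theorem upper_char (j : ℕ) {ε : ℝ} (hε : 0 < ε) : ∃ C : ℝ, 0 < C ∧ ∀ (q : ℕ) [NeZero q]
    (χ : DirichletCharacter ℂ q), χ ≠ 1 → ∀ s : ℂ, 1 < s.re → s.re ≤ 2 →
    ‖LSeries (LSeries.logMul^[j] (fun n => χ n)) s‖ ≤ C * (q * (|s.im| + 2)) ^ ε := by
  obtain ⟨C, hC, h⟩ := upper j hε
  refine ⟨C, hC, fun q _ χ hχ s hs hs2 => ?_⟩
  exact h _ q (by exact_mod_cast NeZero.pos q) (fun n => DirichletCharacter.norm_le_one χ _)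
    (char_partial hχ) s hs hs2

set_option maxHeartbeats 1000000 in
theorem upper_zeta {ε : ℝ} (hε : 0 < ε) : ∃ C : ℝ, 0 < C ∧ ∀ s : ℂ, 1 < s.re → s.re ≤ 2 → s.im ≠ 0 →
    ‖riemannZeta s‖ ≤ C * (|s.im| + 2) ^ ε * (1 + 1 / |s.im|) := by
  obtain ⟨C1, hC1, h1⟩ := upper 0 (by positivity : 0 < ε / 6)
  obtain ⟨C2, hC2, h2⟩ := diff_Fz_le 0 (by norm_num : (0:ℝ) < 1 / 4) (by norm_num)
  set Z2 := ∑' n : ℕ, (1 : ℝ) / (n : ℝ) ^ (3 / 2 : ℝ)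
  have hZ2s : Summable (fun n : ℕ => (1 : ℝ) / (n : ℝ) ^ (3 / 2 : ℝ)) :=
    Real.summable_one_div_nat_rpow.2 (by norm_num)
  have hZ2 : 0 ≤ Z2 := tsum_nonneg fun n => by positivity
  refine ⟨C1 + C2 * Z2 + 2, by positivity, fun s hs hs2 him => ?_⟩
  have hs0 : s ≠ 0 := by rintro rfl; norm_num at hs
  have hs1 : s - 1 ≠ 0 := by intro h; rw [sub_eq_zero] at h; rw [h] at hs; norm_num at hs
  have ht : 0 < |s.im| := abs_pos.2 him
  set X := |s.im| + 2 with hX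
  have hX2 : 2 ≤ X := by linarith
  set N := ⌈X ^ 4⌉₊ with hN
  have hNge : X ^ 4 ≤ N := Nat.le_ceil _
  have hX4 : 16 ≤ X ^ 4 := by
    calc (16:ℝ) = 2 ^ 4 := by norm_num
      _ ≤ _ := by gcongr
  have hNle : (N : ℝ) ≤ X ^ 5 := by
    have := (Nat.ceil_lt_add_one (by positivity : 0 ≤ X ^ 4)).le
    calc (N : ℝ) ≤ X ^ 4 + 1 := this
      _ ≤ X ^ 4 * 2 := by linarith
      _ ≤ X ^ 4 * X := by gcongr
      _ = X ^ 5 := by ring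
  have hN1 : (1:ℝ) ≤ N := by linarith
  have hXε : 1 ≤ X ^ ε := Real.one_le_rpow (by linarith) hε.le
  have ha1 : ∀ n : ℕ, ‖(1 : ℕ → ℂ) n‖ ≤ 1 := fun n => by simp
  have hsum : Summable (LSeries.term (LSeries.logMul^[0] 1) s) := summable_log ha1 0 hs
  have hz : riemannZeta s = LSeries (LSeries.logMul^[0] 1) s := by
    simp [LSeries_one_eq_riemannZeta hs]
  -- head
  have head : ‖∑ n ∈ range N, LSeries.term (LSeries.logMul^[0] 1) s n‖ ≤ C1 * X ^ ε := by
    set a : ℕ → ℂ := fun n => if n < N then 1 else 0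
    have hE : LSeries (LSeries.logMul^[0] a) s = ∑ n ∈ range N, LSeries.term (LSeries.logMul^[0] 1) s n := by
      rw [LSeries, tsum_eq_sum (s := range N)]
      · refine sum_congr rfl fun n hn => ?_
        rw [term_eq _ _ _ hs0, term_eq _ _ _ hs0]; simp [a, mem_range.1 hn]
      · intro n hn
        rw [term_eq _ _ _ hs0]; simp at hn; simp [a, hn]
    rw [← hE]
    refine (h1 a N hN1 (fun n => by simp only [a]; split_ifs <;> simp) (fun M => ?_) s hs hs2).trans ?_
    · simp only [a, ← sum_filter]
      have : (∑ x ∈ range M with x < N, (1:ℂ)) = ((#{x ∈ range M | x < N} : ℕ) : ℂ) := by simp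
      rw [this, Complex.norm_natCast]
      norm_cast
      calc _ ≤ #(range N) := card_le_card fun x hx => by simp at hx ⊢; exact hx.2
        _ = N := card_range N
    · gcongr
      calc (N * X) ^ (ε/6) ≤ (X ^ 5 * X) ^ (ε/6) := by gcongr
        _ = (X ^ 6) ^ (ε/6) := by ring_nf
        _ = X ^ ε := by
          rw [← Real.rpow_natCast, ← Real.rpow_mul (by linarith)]; congr 1; push_cast; ring
  have tail : ‖∑' i, LSeries.term (LSeries.logMul^[0] 1) s (i + N)‖ ≤ 2 / |s.im| + C2 * Z2 := by
    have hsumt : Summable fun i => LSeries.term (LSeries.logMul^[0] 1) s (i + N) :=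
      (summable_nat_add_iff N).2 hsum
    refine le_of_tendsto hsumt.hasSum.tendsto_sum_nat.norm (Filter.Eventually.of_forall fun M => ?_)
    simp_rw [term_eq _ _ _ hs0, Pi.one_apply, one_mul]
    set g : ℝ → ℂ := fun u => (u : ℂ) ^ (1 - s) / (1 - s) with hg
    have hgn : ∀ u : ℝ, 1 ≤ u → ‖g u‖ ≤ 1 / |s.im| := by
      intro u hu
      rw [hg]; simp only [norm_div]
      rw [Complex.norm_cpow_eq_rpow_re_of_pos (by linarith)]
      have e1 : u ^ (1 - s).re ≤ 1 := Real.rpow_le_one_of_one_le_of_nonpos hu (by simp; linarith)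
      have e2 : |s.im| ≤ ‖1 - s‖ := by
        have := Complex.abs_im_le_norm (1 - s); simpa using this
      gcongr
    have hpt : ∀ i : ℕ, (1:ℝ) ≤ ((i + N : ℕ) : ℝ) := fun i => by push_cast; linarith [(Nat.cast_nonneg i : (0:ℝ) ≤ i)]
    have hptN : ∀ i : ℕ, (N:ℝ) ≤ ((i + N : ℕ) : ℝ) := fun i => by push_cast; linarith [(Nat.cast_nonneg i : (0:ℝ) ≤ i)]
    have hstep : ∀ i ∈ range M, ‖Fz 0 s ((i + N : ℕ) : ℝ) - (g ((i + 1 + N : ℕ) : ℝ) - g ((i + N : ℕ) : ℝ))‖ ≤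
        C2 * ‖s‖ * (N:ℝ) ^ (-(1/4) : ℝ) * (1 / ((i + N : ℕ) : ℝ) ^ (3/2 : ℝ)) := by
      intro i _
      set m := ((i + N : ℕ) : ℝ) with hm'
      have hm : 1 ≤ m := hpt i
      have hm1 : ((i + 1 + N : ℕ) : ℝ) = m + 1 := by rw [hm']; push_cast; ring
      rw [hm1]
      have key := (convex_Icc m (m+1)).norm_image_sub_le_of_norm_hasDerivWithin_le
        (f := fun u : ℝ => g u - Fz 0 s m * u) (f' := fun u : ℝ => Fz 0 s u - Fz 0 s m)
        (C := C2 * ‖s‖ * m ^ (-2 + 1/4 : ℝ)) (x := m) (y := m + 1) ?_ ?_ (by simp) (by simp)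
      · rw [norm_sub_rev]
        have e : g (m+1) - g m - Fz 0 s m = (g (m+1) - Fz 0 s m * ((m+1 : ℝ):ℂ)) - (g m - Fz 0 s m * (m:ℂ)) := by
          push_cast; ring
        rw [e]
        refine key.trans ?_
        simp only [add_sub_cancel_left, norm_one, mul_one]
        rw [mul_assoc _ ((N:ℝ) ^ _)]
        refine mul_le_mul_of_nonneg_left ?_ (by positivity)
        rw [one_div (m ^ _), ← Real.rpow_neg (by linarith)]
        calc m ^ (-2 + 1/4 : ℝ) = m ^ (-(1/4) : ℝ) * m ^ (-(3/2) : ℝ) := by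
              rw [← Real.rpow_add (by linarith)]; norm_num
          _ ≤ _ := by
            gcongr ?_ * ?_
            exact Real.rpow_le_rpow_of_nonpos (by linarith) (hptN i) (by norm_num)
      · intro u hu
        have hu0 : 0 < u := by linarith [hu.1]
        have d1 : HasDerivAt g (Fz 0 s u) u := by
          have := ((hasDerivAt_id (u : ℂ)).cpow_const (c := 1 - s) (by simp [slitPlane, hu0])).comp_ofReal.div_const (1 - s)
          convert! this using 1
          have hne : 1 - s ≠ 0 := by rw [← neg_sub]; exact neg_ne_zero.2 hs1
          simp [Fz]
          field_simp
        have d2 : HasDerivAt (fun u : ℝ => Fz 0 s m * (u : ℂ)) (Fz 0 s m * 1) u :=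
          ((hasDerivAt_id u).ofReal_comp).const_mul _
        have d3 := (d1.sub d2).hasDerivWithinAt (s := Set.Icc m (m + 1))
        rw [mul_one] at d3
        exact d3
      · intro u hu
        refine (h2 s hs.le m u hm hu.1).trans ?_
        simp only [Nat.cast_zero, add_zero]
        calc _ ≤ C2 * ‖s‖ * m ^ (-2 + 1/4 : ℝ) * 1 := by gcongr; linarith [hu.2]
          _ = _ := mul_one _
    have htel : ∑ i ∈ range M, (g ((i + 1 + N : ℕ) : ℝ) - g ((i + N : ℕ) : ℝ)) = g ((M + N : ℕ) : ℝ) - g ((0 + N : ℕ) : ℝ) :=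
      sum_range_sub (fun i => g ((i + N : ℕ) : ℝ)) M
    have hdec : ∑ i ∈ range M, Fz 0 s ((i + N : ℕ) : ℝ) = (g ((M + N : ℕ) : ℝ) - g ((0 + N : ℕ) : ℝ)) +
        ∑ i ∈ range M, (Fz 0 s ((i + N : ℕ) : ℝ) - (g ((i + 1 + N : ℕ) : ℝ) - g ((i + N : ℕ) : ℝ))) := by
      rw [← htel, ← sum_add_distrib]; exact sum_congr rfl fun _ _ => by ring
    rw [hdec]
    refine (norm_add_le _ _).trans (add_le_add ?_ ?_)
    · refine (norm_sub_le _ _).trans ?_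
      have := hgn _ (hpt M); have := hgn _ (hpt 0)
      calc _ ≤ 1 / |s.im| + 1 / |s.im| := by gcongr
        _ = _ := by ring
    · refine (norm_sum_le_of_le _ hstep).trans ?_
      rw [← mul_sum]
      have e : (N:ℝ) ^ (-(1/4) : ℝ) ≤ X⁻¹ := by
        calc (N:ℝ) ^ (-(1/4) : ℝ) ≤ (X ^ 4) ^ (-(1/4) : ℝ) :=
              Real.rpow_le_rpow_of_nonpos (by positivity) hNge (by norm_num)
          _ = X⁻¹ := by
              rw [← Real.rpow_natCast, ← Real.rpow_mul (by linarith), ← Real.rpow_neg_one]; norm_num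
      have e2 : ‖s‖ ≤ X := by
        refine (Complex.norm_le_abs_re_add_abs_im s).trans ?_
        rw [abs_of_pos (by linarith)]; linarith
      have e3 : ∑ i ∈ range M, (1 / ((i + N : ℕ) : ℝ) ^ (3/2 : ℝ)) ≤ Z2 := by
        have := (hZ2s.comp_injective (add_left_injective N)).sum_le_tsum (range M) (fun n _ => by simp; positivity)
        refine le_trans this ?_
        exact tsum_comp_le_tsum_of_inj hZ2s (fun n => by positivity) (add_left_injective N)
      calc _ ≤ C2 * X * X⁻¹ * Z2 := by gcongr
        _ = C2 * Z2 := by field_simp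
  rw [hz, LSeries, ← hsum.sum_add_tsum_nat_add N]
  refine (norm_add_le _ _).trans ((add_le_add head tail).trans ?_)
  set r := 1 / |s.im| with hr
  have hr0 : 0 ≤ r := by positivity
  have : 2 / |s.im| = 2 * r := by rw [hr]; ring
  rw [this]
  have hP : 0 ≤ C2 * Z2 := by positivity
  nlinarith [mul_nonneg hr0 (by linarith : 0 ≤ X ^ ε - 1), mul_nonneg (mul_nonneg hr0 (by linarith : 0 ≤ X ^ ε)) (by positivity : 0 ≤ C1 + C2 * Z2), mul_nonneg hP (by linarith : 0 ≤ X ^ ε - 1)]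

theorem prod_bounds (S : Finset ℕ) (hS : ∀ p ∈ S, 2 ≤ p) :
    ∏ p ∈ S, (1 + 1 / (p:ℝ)) ≤ #S + 1 ∧ 1 / ((#S : ℝ) + 1) ≤ ∏ p ∈ S, (1 - 1 / (p:ℝ)) := by
  induction S using Finset.induction_on_max with
  | empty => simp
  | insert a S hlt ih =>
    have haS : a ∉ S := fun h => (hlt a h).false
    obtain ⟨i1, i2⟩ := ih fun p hp => hS p (mem_insert_of_mem hp)
    have hcard : #S + 2 ≤ a := by
      have : S ⊆ Ico 2 a := fun p hp => mem_Ico.2 ⟨hS p (mem_insert_of_mem hp), hlt p hp⟩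
      have := card_le_card this
      have h2 := hS a (mem_insert_self _ _)
      simp at this; omega
    have hc : (#S : ℝ) + 2 ≤ a := by exact_mod_cast hcard
    have hc0 : (0:ℝ) ≤ #S := by positivity
    rw [prod_insert haS, prod_insert haS, card_insert_of_notMem haS]
    push_cast
    have ha : 1 / (a:ℝ) ≤ 1 / ((#S:ℝ) + 2) := by gcongr
    constructor
    · calc _ ≤ (1 + 1 / ((#S:ℝ) + 2)) * ((#S : ℝ) + 1) := by gcongr
        _ ≤ _ := by
          rw [one_add_div (by positivity), div_mul_eq_mul_div, div_le_iff₀ (by positivity)]; nlinarith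
    · calc _ = (1 - 1 / ((#S:ℝ) + 2)) * (1 / ((#S : ℝ) + 1)) := by field_simp; ring
        _ ≤ _ := by
          have : (0:ℝ) ≤ 1 - 1 / (a:ℝ) := by
            have : 1 / (a:ℝ) ≤ 1 := by rw [div_le_one (by linarith)]; linarith
            linarith
          gcongr

theorem omega_le {ε : ℝ} (hε : 0 < ε) : ∃ C : ℝ, 0 < C ∧ ∀ q : ℕ, 0 < q →
    (#q.primeFactors : ℝ) + 1 ≤ C * (q:ℝ) ^ ε := by
  obtain ⟨C, hC, h⟩ := logpow_le 1 hε
  refine ⟨C / Real.log 2 + 1, by positivity, fun q hq => ?_⟩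
  have h1 : 2 ^ #q.primeFactors ≤ q := by
    calc 2 ^ #q.primeFactors ≤ ∏ p ∈ q.primeFactors, p :=
          pow_card_le_prod _ _ _ fun p hp => (Nat.prime_of_mem_primeFactors hp).two_le
      _ ≤ q := Nat.le_of_dvd hq (Nat.prod_primeFactors_dvd q)
  have h2 : (2:ℝ) ^ #q.primeFactors ≤ q := by exact_mod_cast h1
  have hq1 : (1:ℝ) ≤ q := by exact_mod_cast hq
  have h3 := Real.log_le_log (by positivity) h2
  rw [Real.log_pow] at h3
  have h4 := h q hq1
  rw [pow_one] at h4
  have hl : 0 < Real.log 2 := Real.log_pos (by norm_num)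
  have h5 : (#q.primeFactors : ℝ) ≤ C * (q:ℝ) ^ ε / Real.log 2 := by
    rw [le_div_iff₀ hl]; linarith
  have h6 : 1 ≤ (q:ℝ) ^ ε := Real.one_le_rpow hq1 hε.le
  calc _ ≤ C * (q:ℝ) ^ ε / Real.log 2 + (q:ℝ) ^ ε := by gcongr
    _ = _ := by ring

theorem upper_triv {ε : ℝ} (hε : 0 < ε) : ∃ C : ℝ, 0 < C ∧ ∀ (q : ℕ) [NeZero q], ∀ s : ℂ, 1 < s.re → s.re ≤ 2 → s.im ≠ 0 →
    ‖LSeries (fun n => (1 : DirichletCharacter ℂ q) n) s‖ ≤ C * (q * (|s.im| + 2)) ^ ε * (1 + 1 / |s.im|) := by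
  obtain ⟨C1, hC1, h1⟩ := upper_zeta hε
  obtain ⟨C2, hC2, h2⟩ := omega_le hε
  refine ⟨C2 * C1, by positivity, fun q _ s hs hs2 him => ?_⟩
  have hs1 : s ≠ 1 := by rintro rfl; simp at hs
  rw [← DirichletCharacter.LFunction_eq_LSeries _ hs]
  have := DirichletCharacter.LFunctionTrivChar_eq_mul_riemannZeta (N := q) hs1
  rw [DirichletCharacter.LFunctionTrivChar] at this
  rw [this, norm_mul, norm_prod]
  have e1 : ∏ p ∈ q.primeFactors, ‖1 - (p:ℂ) ^ (-s)‖ ≤ ∏ p ∈ q.primeFactors, (1 + 1 / (p:ℝ)) := by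
    refine prod_le_prod (fun _ _ => norm_nonneg _) fun p hp => (norm_sub_le _ _).trans ?_
    have hp0 := (Nat.prime_of_mem_primeFactors hp).pos
    have hp1 : (1:ℝ) ≤ p := by exact_mod_cast hp0
    rw [norm_one, Complex.norm_natCast_cpow_of_pos hp0, neg_re, one_div, ← Real.rpow_neg_one]
    gcongr
  have e2 := (prod_bounds q.primeFactors fun p hp => (Nat.prime_of_mem_primeFactors hp).two_le).1
  have e3 := h2 q (NeZero.pos q)
  rw [Real.mul_rpow (by positivity) (by positivity)]
  calc _ ≤ (C2 * (q:ℝ) ^ ε) * (C1 * (|s.im| + 2) ^ ε * (1 + 1 / |s.im|)) := by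
        gcongr
        · exact e1.trans (e2.trans e3)
        · exact h1 s hs hs2 him
    _ = _ := by ring
end SW

end

section

open Complex Finset
namespace SW

lemma char_zero {q : ℕ} [NeZero q] {χ : DirichletCharacter ℂ q} (hχ : χ ≠ 1) : χ (0 : ZMod q) = 0 := by
  apply MulChar.map_nonunit
  intro h
  have h0 : (0 : ZMod q) = 1 := by
    obtain ⟨u, hu⟩ := h
    have := u.mul_inv
    rw [hu, zero_mul] at this
    exact this
  apply hχ
  ext u
  have : ((u : ZMod q)) = 1 := by
    rw [← mul_one (u : ZMod q), ← h0, mul_zero]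
  rw [this, map_one, map_one]

noncomputable def Sch {q : ℕ} (χ : DirichletCharacter ℂ q) (t : ℝ) : ℂ :=
  ∑ k ∈ Icc 1 ⌊t⌋₊, χ (k : ZMod q)

lemma Icc_sum_bound {q : ℕ} [NeZero q] {χ : DirichletCharacter ℂ q} (hχ : χ ≠ 1) (n : ℕ) :
    ‖∑ k ∈ Icc 1 n, χ (k : ZMod q)‖ ≤ q := by
  have h := char_partial hχ (n+1)
  have e : ∑ k ∈ range (n+1), χ (k : ZMod q) = ∑ k ∈ Icc 1 n, χ (k : ZMod q) := by
    rw [Finset.range_eq_Ico, Finset.sum_eq_sum_Ico_succ_bot (by omega)]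
    simp only [Nat.cast_zero, char_zero hχ, zero_add]
    rfl
  rwa [e] at h

lemma Sch_bound {q : ℕ} [NeZero q] {χ : DirichletCharacter ℂ q} (hχ : χ ≠ 1) (t : ℝ) :
    ‖Sch χ t‖ ≤ q := Icc_sum_bound hχ _

lemma Sch_meas {q : ℕ} (χ : DirichletCharacter ℂ q) : Measurable (Sch χ) := by
  have : Sch χ = (fun n : ℕ => ∑ k ∈ Icc 1 n, χ (k : ZMod q)) ∘ (fun t : ℝ => ⌊t⌋₊) := rfl
  rw [this]
  exact (measurable_from_top).comp Nat.measurable_floor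

open MeasureTheory in
lemma LF_integral {q : ℕ} [NeZero q] {χ : DirichletCharacter ℂ q} (hχ : χ ≠ 1) {s : ℂ} (hs : 0 < s.re) :
    DirichletCharacter.LFunction χ s
      = s * ∫ t in Set.Ioi (1 : ℝ), Sch χ t * (t:ℂ) ^ (-(s + 1)) := by
  set f : ℝ → ℂ := Set.indicator (Set.Ioi 1) (Sch χ) with hf
  have hfm : Measurable f := (Sch_meas χ).indicator measurableSet_Ioi
  have hfb : ∀ t, ‖f t‖ ≤ q := fun t => by
    rw [hf]
    exact (norm_indicator_le_norm_self _ _).trans (Sch_bound hχ t)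
  have hmel : ∀ s : ℂ, mellin f (-s) = ∫ t in Set.Ioi (1 : ℝ), Sch χ t * (t:ℂ) ^ (-(s + 1)) := by
    intro s
    rw [mellin]
    have : ∀ t : ℝ, (t:ℂ)^(-s-1) • f t = Set.indicator (Set.Ioi 1) (fun t : ℝ => Sch χ t * (t:ℂ) ^ (-(s + 1))) t := by
      intro t
      simp only [hf, Set.indicator_apply]
      split_ifs
      · rw [smul_eq_mul, mul_comm]; congr 2; ring
      · simp
    simp_rw [this]
    rw [setIntegral_indicator measurableSet_Ioi, Set.Ioi_inter_Ioi]
    simp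
  have hdiff : ∀ s : ℂ, 0 < s.re → DifferentiableAt ℂ (mellin f) (-s) := by
    intro s hs
    apply mellin_differentiableAt_of_isBigO_rpow (a := 0) (b := -s.re - 1)
    · apply LocallyIntegrable.locallyIntegrableOn
      apply MeasureTheory.LocallyIntegrable.mono (locallyIntegrable_const (q:ℝ)) hfm.aestronglyMeasurable
      filter_upwards with t
      simpa using hfb t
    · apply Asymptotics.IsBigO.of_bound q
      filter_upwards with t
      simpa using hfb t
    · simpa using hs
    · apply Asymptotics.IsBigO.of_bound 0
      have : Set.Ioo (0:ℝ) 1 ∈ nhdsWithin (0:ℝ) (Set.Ioi 0) := Ioo_mem_nhdsGT one_pos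
      filter_upwards [this] with t ht
      simp [hf, Set.indicator_apply, not_lt.mpr ht.2.le]
    · simp
  have hU : IsOpen {s : ℂ | 0 < s.re} := isOpen_lt continuous_const continuous_re
  have hpre : IsPreconnected {s : ℂ | 0 < s.re} := (convex_halfSpace_re_gt 0).isPreconnected
  have key := AnalyticOnNhd.eqOn_of_preconnected_of_eventuallyEq (f := DirichletCharacter.LFunction χ)
    (g := fun s => s * mellin f (-s)) (U := {s : ℂ | 0 < s.re}) (z₀ := 2)
    ((DirichletCharacter.differentiable_LFunction hχ).differentiableOn.analyticOnNhd hU)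
    (DifferentiableOn.analyticOnNhd (fun z hz => by
      apply DifferentiableAt.differentiableWithinAt
      exact differentiableAt_id.mul ((hdiff z hz).comp z differentiableAt_id.neg)) hU) hpre
    (by simp) (by
      have : {s : ℂ | 1 < s.re} ∈ nhds (2:ℂ) :=
        (isOpen_lt continuous_const continuous_re).mem_nhds (by simp)
      filter_upwards [this] with z hz
      rw [DirichletCharacter.LFunction_eq_LSeries χ hz]
      rw [LSeries_eq_mul_integral _ le_rfl (lt_trans one_pos hz)
        (DirichletCharacter.LSeriesSummable_of_one_lt_re χ hz) ?_, hmel]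
      · rfl
      · apply Asymptotics.IsBigO.of_bound q
        filter_upwards with n
        simpa using Icc_sum_bound hχ n)
  have := key hs
  simp only [hmel] at this
  exact this

open MeasureTheory in
lemma LF_bound {q : ℕ} [NeZero q] {χ : DirichletCharacter ℂ q} (hχ : χ ≠ 1) {s : ℂ} (hs : 0 < s.re) :
    ‖DirichletCharacter.LFunction χ s‖ ≤ ‖s‖ * (q / s.re) := by
  rw [LF_integral hχ hs, norm_mul]
  gcongr
  have hintg : IntegrableOn (fun t : ℝ => (q:ℝ) * t ^ (-(s.re+1))) (Set.Ioi 1) :=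
    (integrableOn_Ioi_rpow_of_lt (by linarith) one_pos).const_mul _
  refine (norm_integral_le_of_norm_le hintg ?_).trans ?_
  · filter_upwards [ae_restrict_mem measurableSet_Ioi] with t ht
    rw [norm_mul, norm_cpow_eq_rpow_re_of_pos (lt_trans one_pos ht)]
    simp only [neg_re, add_re, one_re]
    have := Sch_bound hχ t
    have h2 : (0:ℝ) ≤ t ^ (-(s.re+1)) := Real.rpow_nonneg (lt_trans one_pos ht).le _
    gcongr
  · rw [integral_const_mul, integral_Ioi_rpow_of_lt (by linarith) one_pos]
    simp
    rw [div_eq_mul_inv]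
    
lemma LF_bound_ball {q : ℕ} [NeZero q] {χ : DirichletCharacter ℂ q} (hχ : χ ≠ 1) {s : ℂ}
    (hs : s ∈ Metric.closedBall (2:ℂ) (3/2)) :
    ‖DirichletCharacter.LFunction χ s‖ ≤ 7 * q := by
  rw [mem_closedBall_iff_norm] at hs
  have h1 : 1/2 ≤ s.re := by
    have := (abs_re_le_norm (s-2)).trans hs
    simp at this
    linarith [(abs_le.1 this).1]
  have h2 : ‖s‖ ≤ 7/2 := by
    have := norm_add_le (s-2) 2
    simp at this
    linarith
  refine (LF_bound hχ (by linarith)).trans ?_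
  have : (q:ℝ)/s.re ≤ 2*q := by
    rw [div_le_iff₀ (by linarith)]
    nlinarith [Nat.cast_nonneg (α := ℝ) q]
  calc ‖s‖ * (q/s.re) ≤ 7/2 * (2*q) := by gcongr
    _ = 7 * q := by ring

lemma quad_conj {q : ℕ} [NeZero q] {χ : DirichletCharacter ℂ q} (h2 : χ ^ 2 = 1) (a : ZMod q) :
    (starRingEnd ℂ) (χ a) = χ a := by
  by_cases h : IsUnit a
  · have : χ a ^ 2 = 1 := by
      rw [← MulChar.pow_apply' χ two_ne_zero, h2, MulChar.one_apply h]
    rcases mul_self_eq_one_iff.1 ((sq (χ a)) ▸ this) with h | h <;> rw [h] <;> simp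
  · rw [MulChar.map_nonunit χ h, map_zero]

open MeasureTheory in
lemma LF_real {q : ℕ} [NeZero q] {χ : DirichletCharacter ℂ q} (hχ : χ ≠ 1) (h2 : χ ^ 2 = 1) {b : ℝ} (hb : 0 < b) :
    (DirichletCharacter.LFunction χ (b:ℂ)).im = 0 := by
  rw [← Complex.conj_eq_iff_im, LF_integral hχ (by simpa using hb), map_mul, conj_ofReal, ← integral_conj]
  congr 1
  apply setIntegral_congr_fun measurableSet_Ioi
  intro t ht
  have ht : (0:ℝ) < t := lt_trans one_pos ht
  simp only [map_mul]
  congr 1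
  · simp only [Sch, map_sum, quad_conj h2]
  · rw [show (-((b:ℂ)+1)) = ((-(b+1) : ℝ) : ℂ) by push_cast; ring, ← ofReal_cpow ht.le, conj_ofReal]

end SW

end

section

open Complex Finset
namespace SW

lemma est_real (a : ℕ → ℝ) (lam c0 T u g : ℝ) (hT : 0 < T) (ha : ∀ n, |a n| ≤ T * (2/3)^n)
    (hb : ∀ n, 0 ≤ a n + lam) (hb0 : c0 ≤ a 0 + lam) (hu1 : 1 < u) (hu : u ≤ 9/8)
    (hs : HasSum (fun n => a n * u^n) g) (hg : g - lam/(u-1) ≤ 0) (N : ℕ) (hN : 1 ≤ N)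
     : (u-1) * (c0 - 4*T*(3/4)^N) ≤ lam * u^N := by
  have hsum := hs.summable
  have h1 := hsum.sum_add_tsum_nat_add N
  have h2 : |∑' i, a (i+N) * u^(i+N)| ≤ 4*T*(3/4)^N := by
    have hgeo : HasSum (fun i : ℕ => T * (3/4:ℝ)^N * (3/4)^i) (T * (3/4:ℝ)^N * (1-3/4)⁻¹) :=
      (hasSum_geometric_of_lt_one (by norm_num) (by norm_num)).mul_left _
    have := tsum_of_norm_bounded (f := fun i => a (i+N) * u^(i+N)) hgeo (fun i => by
      rw [Real.norm_eq_abs, abs_mul, abs_of_nonneg (pow_nonneg (by linarith : (0:ℝ) ≤ u) _)]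
      calc |a (i+N)| * u^(i+N) ≤ (T * (2/3)^(i+N)) * (9/8)^(i+N) := by
            gcongr
            exact ha _
        _ = T * (3/4)^(i+N) := by rw [mul_assoc, ← mul_pow]; norm_num
        _ = _ := by rw [pow_add]; ring)
    rw [Real.norm_eq_abs] at this
    linarith
  have h3 : c0 - lam * ((u^N - 1)/(u-1)) ≤ ∑ i ∈ range N, a i * u^i := by
    have e : ∑ i ∈ range N, a i * u^i = ∑ i ∈ range N, (a i + lam) * u^i - lam * ∑ i ∈ range N, u^i := by
      rw [mul_sum, ← sum_sub_distrib]
      apply sum_congr rfl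
      intros; ring
    rw [e, geom_sum_eq (by linarith)]
    have : c0 ≤ ∑ i ∈ range N, (a i + lam) * u^i := by
      refine le_trans ?_ (single_le_sum (f := fun i => (a i + lam) * u^i) (fun i _ => mul_nonneg (hb i) (pow_nonneg (by linarith) _)) (mem_range.2 (by omega : 0 < N)))
      simpa using hb0
    linarith
  rw [hs.tsum_eq] at h1
  have h4 := (abs_le.1 h2).1
  have hpos : 0 < u - 1 := by linarith
  have h5 : c0 - 4*T*(3/4)^N ≤ lam * u^N / (u-1) := by
    have : lam * u^N / (u-1) = lam * ((u^N - 1)/(u-1)) + lam/(u-1) := by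
      field_simp; ring
    linarith
  rw [le_div_iff₀ hpos] at h5
  linarith

noncomputable abbrev Z1 : ℂ → ℂ := DirichletCharacter.LFunctionTrivChar₁ 1

lemma Z1_diff : Differentiable ℂ Z1 := DirichletCharacter.differentiable_LFunctionTrivChar₁ 1
lemma Z1_one : Z1 1 = 1 := by simp [Z1]
lemma Z1_ne {s : ℂ} (hs : s ≠ 1) : Z1 s = (s-1) * riemannZeta s := by
  simp [Z1, Function.update_of_ne hs, DirichletCharacter.LFunctionTrivChar, DirichletCharacter.LFunction_modOne_eq]

lemma est_final {c0 T0 B lam b : ℝ} (hc0 : 0 < c0) (hT0 : c0 ≤ T0) (hB : 1 ≤ B) (hb : 7/8 ≤ b) (hb1 : b < 1)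
    (h : ∀ N : ℕ, 1 ≤ N → (1-b) * (c0 - 4*(T0*B)*(3/4)^N) ≤ lam * (2-b)^N) :
    c0^2/(16*Real.exp 1*T0) * (1-b) * B^(-4*(1-b)) ≤ lam := by
  have hX : 1 ≤ 8*(T0*B)/c0 := by
    rw [le_div_iff₀ hc0]; nlinarith
  set X := 8*(T0*B)/c0 with hXd
  have hlog : 0 ≤ Real.log X := Real.log_nonneg hX
  set N := ⌈4 * Real.log X⌉₊ + 1 with hN
  have hN1 : 4*Real.log X ≤ N := by
    rw [hN]; push_cast; linarith [Nat.le_ceil (4*Real.log X)]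
  have hN2 : (N:ℝ) ≤ 4 * Real.log X + 2 := by
    rw [hN]; push_cast; linarith [Nat.ceil_lt_add_one (a := 4*Real.log X) (by linarith)]
  have h1 := h N (by omega)
  have hX0 : 0 < X := by linarith
  have hpow : (3/4:ℝ)^N ≤ X⁻¹ := by
    have : (3/4:ℝ) ≤ Real.exp (-(1/4)) := by
      have := Real.add_one_le_exp (-(1/4):ℝ); linarith
    calc (3/4:ℝ)^N ≤ (Real.exp (-(1/4)))^N := by gcongr
      _ = Real.exp (-(N/4)) := by rw [← Real.exp_nat_mul]; ring_nf
      _ ≤ Real.exp (-Real.log X) := by apply Real.exp_le_exp.2; linarith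
      _ = X⁻¹ := by rw [Real.exp_neg, Real.exp_log hX0]
  have h2 : c0/2 ≤ c0 - 4*(T0*B)*(3/4)^N := by
    have : 4*(T0*B)*(3/4)^N ≤ 4*(T0*B)*X⁻¹ := by gcongr; nlinarith
    have e : 4*(T0*B)*X⁻¹ = c0/2 := by
      have hT : 0 < T0 := by linarith
      rw [hXd]; field_simp; norm_num
    linarith
  have hu : (2-b)^N ≤ Real.exp 1 * (8*T0/c0) * B^(4*(1-b)) := by
    have hx8 : 1 ≤ 8*T0/c0 := by rw [le_div_iff₀ hc0]; linarith
    calc (2-b)^N ≤ (Real.exp (1-b))^N := by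
          gcongr
          · linarith
          · have := Real.add_one_le_exp (1-b); linarith
      _ = Real.exp (N*(1-b)) := by rw [← Real.exp_nat_mul]
      _ ≤ Real.exp (1 + Real.log X * (4*(1-b))) := by
          apply Real.exp_le_exp.2
          nlinarith
      _ = Real.exp 1 * X^(4*(1-b)) := by rw [Real.exp_add, Real.rpow_def_of_pos hX0]
      _ = Real.exp 1 * ((8*T0/c0)^(4*(1-b)) * B^(4*(1-b))) := by
          rw [← Real.mul_rpow (by linarith) (by linarith)]
          congr 2
          rw [hXd]; ring
      _ ≤ Real.exp 1 * ((8*T0/c0) * B^(4*(1-b))) := by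
          gcongr
          calc (8*T0/c0)^(4*(1-b)) ≤ (8*T0/c0)^(1:ℝ) := Real.rpow_le_rpow_of_exponent_le hx8 (by linarith)
            _ = _ := Real.rpow_one _
      _ = _ := by ring
  have hpos : 0 < (2-b)^N := pow_pos (by linarith) _
  have h3 : (1-b) * (c0/2) ≤ lam * (2-b)^N := by
    refine le_trans ?_ h1
    gcongr
  have hlam : 0 < lam := by
    by_contra hh
    push Not at hh
    have : lam * (2-b)^N ≤ 0 := mul_nonpos_of_nonpos_of_nonneg hh hpos.le
    nlinarith
  have h4 : (1-b) * (c0/2) ≤ lam * (Real.exp 1 * (8*T0/c0) * B^(4*(1-b))) := h3.trans (by gcongr)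
  have hBp : 0 < B^(4*(1-b)) := Real.rpow_pos_of_pos (by linarith) _
  rw [show -4*(1-b) = -(4*(1-b)) by ring, Real.rpow_neg (by linarith)]
  have hE := Real.exp_pos 1
  have hT : 0 < T0 := by linarith
  rw [← div_eq_mul_inv, div_le_iff₀ hBp]
  have e : c0^2/(16*Real.exp 1*T0) * (1-b) = (1-b)*(c0/2) / (Real.exp 1 * (8*T0/c0)) := by
    field_simp; ring
  rw [e, div_le_iff₀ (by positivity)]
  linarith

lemma estermann {c0 : ℝ} (hc0 : 0 < c0) : ∃ c > 0, ∀ (H : ℂ → ℂ) (B b : ℝ), Differentiable ℂ H → 1 ≤ B →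
    (∀ s ∈ Metric.closedBall (2:ℂ) (3/2), ‖H s‖ ≤ B) →
    (∀ n, 0 ≤ ((-1)^n * iteratedDeriv n (fun s => riemannZeta s * H s) 2).re) →
    c0 ≤ (riemannZeta 2 * H 2).re → 7/8 ≤ b → b < 1 → (riemannZeta b * H b).re ≤ 0 →
    c * (1-b) * B^(-4*(1-b)) ≤ (H 1).re := by
  obtain ⟨M, hM⟩ := (isCompact_closedBall (2:ℂ) (3/2)).exists_bound_of_continuousOn Z1_diff.continuous.continuousOn
  have hM0 : 0 ≤ M := (norm_nonneg _).trans (hM 2 (by simp; norm_num))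
  refine ⟨c0^2/(16*Real.exp 1*(4*M+c0)), by positivity, fun H B b hH hB hHB hpos h2 hb hb1 hF => ?_⟩
  apply est_final hc0 (by linarith) hB hb hb1
  intro N hN
  set P : ℂ → ℂ := fun s => Z1 s * H s with hP
  have hPd : Differentiable ℂ P := Z1_diff.mul hH
  set G := dslope P 1 with hG
  have hGd : Differentiable ℂ G := by
    rw [← differentiableOn_univ, hG, Complex.differentiableOn_dslope Filter.univ_mem]
    exact hPd.differentiableOn
  have hGne : ∀ s, s ≠ 1 → G s = riemannZeta s * H s - H 1 * (1*s-1)⁻¹ := by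
    intro s hs
    have : s - 1 ≠ 0 := sub_ne_zero.2 hs
    rw [hG, dslope_of_ne _ hs, slope_def_field, hP]
    simp only [Z1_ne hs, Z1_one]
    field_simp
  have hPB : ∀ s ∈ Metric.closedBall (2:ℂ) (3/2), ‖P s‖ ≤ M * B := fun s hs => by
    rw [hP, norm_mul]
    exact mul_le_mul (hM s hs) (hHB s hs) (norm_nonneg _) hM0
  have hGB : ∀ s ∈ Metric.sphere (2:ℂ) (3/2), ‖G s‖ ≤ (4*M+c0) * B := fun s hs => by
    have hs1 : 1/2 ≤ ‖s - 1‖ := by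
      rw [mem_sphere_iff_norm] at hs
      have := norm_sub_le (s-1) 1
      rw [show s - 1 - 1 = s - 2 by ring, hs] at this
      simp at this; linarith
    have hne : s ≠ 1 := by
      rintro rfl; simp at hs1; linarith
    rw [hG, dslope_of_ne _ hne, slope_def_field, norm_div, div_le_iff₀ (by linarith)]
    have h1 := norm_sub_le (P s) (P 1)
    have h3 := hPB s (Metric.sphere_subset_closedBall hs)
    have h4 := hPB 1 (by rw [mem_closedBall_iff_norm]; norm_num)
    have : 0 ≤ (4*M+c0)*B := by positivity
    nlinarith [mul_pos hc0 (by linarith : (0:ℝ) < B)]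
  have hcauchy := fun n => Complex.norm_iteratedDeriv_le_of_forall_mem_sphere_norm_le n (by norm_num : (0:ℝ) < 3/2)
    hGd.diffContOnCl hGB
  have hder : ∀ n, iteratedDeriv n (fun s => riemannZeta s * H s) 2 = iteratedDeriv n G 2 + H 1 * ((-1)^n * n.factorial) := by
    intro n
    have hev : (fun s => riemannZeta s * H s) =ᶠ[nhds 2] (fun s => G s + H 1 * (1*s-1)⁻¹) := by
      have : {s : ℂ | s ≠ 1} ∈ nhds (2:ℂ) := isOpen_ne.mem_nhds (by norm_num)
      filter_upwards [this] with s hs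
      rw [hGne s hs]; ring
    rw [hev.iteratedDeriv_eq]
    rw [iteratedDeriv_fun_add hGd.contDiff.contDiffAt (by
      apply ContDiffAt.mul contDiffAt_const
      apply ContDiffAt.inv (by fun_prop) (by norm_num))]
    congr 1
    rw [iteratedDeriv_const_mul_field, iteratedDeriv_eq_iterate, iter_deriv_inv_linear_sub]
    norm_num
  set a : ℕ → ℝ := fun n => ((-1)^n * iteratedDeriv n G 2).re / n.factorial with ha
  have hab : ∀ n, a n + (H 1).re = ((-1)^n * iteratedDeriv n (fun s => riemannZeta s * H s) 2).re / n.factorial := by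
    intro n
    have hf : (n.factorial:ℝ) ≠ 0 := by positivity
    rw [hder, mul_add, add_re, ha]
    have : (-1:ℂ)^n * (H 1 * ((-1)^n * n.factorial)) = ((n.factorial:ℝ):ℂ) * H 1 := by
      have : (-1:ℂ)^n * (-1)^n = 1 := by rw [← mul_pow]; simp
      push_cast
      linear_combination (H 1 * n.factorial) * this
    rw [this, re_ofReal_mul]
    field_simp
  have hb1' : (b:ℂ) ≠ 1 := by
    intro h; rw [← ofReal_one, ofReal_inj] at h; linarith
  have := est_real a (H 1).re c0 ((4*M+c0)*B) (2-b) (G b).re (by positivity) (fun n => by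
      have hf : (0:ℝ) < n.factorial := by positivity
      rw [ha]
      simp only [abs_div, Nat.abs_cast]
      rw [div_le_iff₀ hf]
      refine (abs_re_le_norm _).trans ?_
      rw [norm_mul, norm_pow, norm_neg, norm_one, one_pow, one_mul]
      refine (hcauchy n).trans (le_of_eq ?_)
      rw [show (2/3:ℝ) = (3/2)⁻¹ by norm_num, inv_pow]
      field_simp) (fun n => by
      rw [hab]; exact div_nonneg (hpos n) (by positivity)) (by
      rw [hab]; simpa using h2) (by linarith) (by linarith) (by
      have := (Complex.hasSum_taylorSeries_of_entire hGd 2 b)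
      have := Complex.hasSum_re this
      convert this using 2 with n
      rw [ha]
      simp only [smul_eq_mul]
      rw [show ((n.factorial:ℂ))⁻¹ * (((b:ℂ)-2)^n * iteratedDeriv n G 2) = (((2-b)^n / n.factorial : ℝ):ℂ) * ((-1)^n * iteratedDeriv n G 2) by
        rw [show (b:ℂ) - 2 = (-1) * (2-b) by ring, mul_pow]; push_cast; ring]
      rw [re_ofReal_mul]; ring) (by
      rw [hGne _ hb1', sub_re]
      have : (H 1 * (1*(b:ℂ)-1)⁻¹).re = -((H 1).re / (2-b-1)) := by
        rw [show (1*(b:ℂ)-1)⁻¹ = (((b-1)⁻¹:ℝ):ℂ) by push_cast; ring, re_mul_ofReal]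
        rw [show 2-b-1 = -(b-1) by ring, div_neg, neg_neg, div_eq_mul_inv]
      rw [this]; linarith) N hN
  rw [show 2 - b - 1 = 1 - b by ring] at this
  exact this

end SW

end

section

open Complex Finset
namespace SW
open scoped ComplexOrder

open scoped ArithmeticFunction.vonMangoldt

/-- twisted von Mangoldt -/
noncomputable def tL {q : ℕ} (χ : DirichletCharacter ℂ q) : ℕ → ℂ :=
  (fun n : ℕ => χ (n : ZMod q)) * fun n : ℕ => ((ArithmeticFunction.vonMangoldt n : ℝ) : ℂ)

lemma LF_hasDeriv {q : ℕ} [NeZero q] (χ : DirichletCharacter ℂ q) {s : ℂ} (hs : 1 < s.re) :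
    HasDerivAt (DirichletCharacter.LFunction χ) (- (DirichletCharacter.LFunction χ s * LSeries (tL χ) s)) s := by
  have h1 : DifferentiableAt ℂ (DirichletCharacter.LFunction χ) s :=
    DirichletCharacter.differentiableAt_LFunction χ s (Or.inl (by rintro rfl; simp at hs))
  have h2 := DirichletCharacter.LSeries_twist_vonMangoldt_eq χ hs
  have h3 := DirichletCharacter.LSeries_ne_zero_of_one_lt_re χ hs
  have h4 : deriv (DirichletCharacter.LFunction χ) s = - (DirichletCharacter.LFunction χ s * LSeries (tL χ) s) := by
    rw [DirichletCharacter.deriv_LFunction_eq_deriv_LSeries χ hs, DirichletCharacter.LFunction_eq_LSeries χ hs, tL, h2]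
    field_simp
  rw [← h4]
  exact h1.hasDerivAt

lemma zeta_hasDeriv {s : ℂ} (hs : 1 < s.re) :
    HasDerivAt riemannZeta (- (riemannZeta s * LSeries (fun n => ((ArithmeticFunction.vonMangoldt n : ℝ):ℂ)) s)) s := by
  have h := LF_hasDeriv (1 : DirichletCharacter ℂ 1) hs
  rw [DirichletCharacter.LFunction_modOne_eq] at h
  convert h using 4
  ext n
  simp only [tL, Pi.mul_apply]
  rw [MulChar.one_apply (isUnit_of_subsingleton _), one_mul]

lemma posit (F : ℂ → ℂ) (c : ℕ → ℂ) (hc : 0 ≤ c) (hsum : ∀ s : ℂ, 1 < s.re → LSeriesSummable c s)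
    (hF : ∀ s : ℂ, 1 < s.re → HasDerivAt F (-(F s * LSeries c s)) s) (h2 : 0 ≤ F 2) (n : ℕ) :
    0 ≤ (-1)^n * iteratedDeriv n F 2 := by
  have habs : LSeries.abscissaOfAbsConv c ≤ 1 := by
    apply LSeries.abscissaOfAbsConv_le_of_forall_lt_LSeriesSummable'
    intro y hy
    apply hsum
    rw [ofReal_re]; exact_mod_cast hy
  have hO : IsOpen {s : ℂ | 1 < s.re} := isOpen_lt continuous_const continuous_re
  have h2m : (2:ℂ) ∈ {s : ℂ | 1 < s.re} := by simp
  have hFc : ∀ m : ℕ, ContDiffAt ℂ m F 2 := fun m =>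
    (DifferentiableOn.analyticAt (fun z hz => (hF z hz).differentiableAt.differentiableWithinAt) (hO.mem_nhds h2m)).contDiffAt
  have hDd : DifferentiableOn ℂ (LSeries c) {s : ℂ | 1 < s.re} := (LSeries_differentiableOn c).mono (fun z hz => by
      apply lt_of_le_of_lt habs
      exact_mod_cast hz)
  have hDc : ∀ m : ℕ, ContDiffAt ℂ m (LSeries c) 2 := fun m => (hDd.analyticAt (hO.mem_nhds h2m)).contDiffAt
  have hD : ∀ m, 0 ≤ (-1)^m * iteratedDeriv m (LSeries c) 2 := fun m => by
    have := LSeries.iteratedDeriv_alternating hc (x := 2) (lt_of_le_of_lt habs (by norm_cast)) m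
    simpa using this
  induction n using Nat.strong_induction_on with
  | _ n ih =>
    rcases n with _ | n
    · simpa using h2
    · rw [iteratedDeriv_succ']
      have hev : deriv F =ᶠ[nhds 2] (fun s => (-1) * (F * LSeries c) s) := by
        filter_upwards [hO.mem_nhds h2m] with s hs
        rw [(hF s hs).deriv]; simp
      rw [hev.iteratedDeriv_eq, iteratedDeriv_const_mul_field, iteratedDeriv_mul (hFc n) (hDc n),
        ← mul_assoc, pow_succ, mul_assoc ((-1:ℂ)^n)]
      norm_num
      rw [mul_sum]
      apply sum_nonneg
      intro i hi
      have hi' : i < n + 1 := mem_range.1 hi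
      have e : (-1:ℂ)^n = (-1)^i * (-1)^(n-i) := by rw [← pow_add]; congr 1; omega
      rw [e, show (-1:ℂ)^i * (-1)^(n-i) * ((n.choose i : ℂ) * iteratedDeriv i F 2 * iteratedDeriv (n-i) (LSeries c) 2)
        = (n.choose i : ℂ) * (((-1)^i * iteratedDeriv i F 2) * ((-1)^(n-i) * iteratedDeriv (n-i) (LSeries c) 2)) by ring]
      exact mul_nonneg (by exact_mod_cast Nat.zero_le _) (mul_nonneg (ih i hi') (hD _))

lemma LF_two {q : ℕ} [NeZero q] {χ : DirichletCharacter ℂ q} :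
    1/4 ≤ (DirichletCharacter.LFunction χ 2).re := by
  have h2 : 1 < (2:ℂ).re := by simp
  rw [DirichletCharacter.LFunction_eq_LSeries χ h2]
  have hs := (DirichletCharacter.LSeriesSummable_of_one_lt_re χ h2).hasSum
  have h1 : HasSum (fun n : ℕ => if n = 1 then (1:ℂ) else 0) 1 := hasSum_ite_eq 1 1
  have h1' : HasSum (fun n : ℕ => if n = 1 then (1:ℝ) else 0) 1 := hasSum_ite_eq 1 1
  have h3 := hs.sub h1
  have h4 := hasSum_zeta_two.sub h1'
  have h5 := tsum_of_norm_bounded h4 (f := fun n => LSeries.term (fun n : ℕ => χ (n : ZMod q)) 2 n - if n = 1 then (1:ℂ) else 0) (by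
    intro n
    by_cases hn : n = 1
    · subst hn; simp [LSeries.term]
    · simp only [hn, if_false, sub_zero]
      rcases Nat.eq_zero_or_pos n with rfl | hp
      · simp
      · rw [LSeries.term_of_ne_zero (by omega), norm_div]
        have : ‖(n:ℂ)^(2:ℂ)‖ = (n:ℝ)^2 := by
          rw [show (2:ℂ) = ((2:ℕ):ℂ) by norm_num, cpow_natCast, norm_pow, norm_natCast]
        rw [this]
        gcongr
        exact DirichletCharacter.norm_le_one χ _)
  rw [h3.tsum_eq] at h5
  have h6 := (abs_le.1 ((abs_re_le_norm _).trans h5)).1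
  simp only [sub_re, one_re] at h6
  have : LSeries (fun n : ℕ => χ (n : ZMod q)) 2 = ∑' n, LSeries.term (fun n : ℕ => χ (n : ZMod q)) 2 n := rfl
  rw [this]
  have hpi := Real.pi_lt_d2
  nlinarith [Real.pi_pos]

lemma LF_two_nonneg {q : ℕ} [NeZero q] {χ : DirichletCharacter ℂ q} (hχ : χ ≠ 1) (h2 : χ^2 = 1) :
    ∃ r : ℝ, 1/4 ≤ r ∧ DirichletCharacter.LFunction χ 2 = r := by
  refine ⟨_, LF_two (χ := χ), ?_⟩
  apply Complex.ext
  · simp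
  · have := LF_real hχ h2 (b := 2) (by norm_num)
    simpa using this

lemma zeta_two_ge : ∃ r : ℝ, 1 ≤ r ∧ riemannZeta 2 = r := by
  refine ⟨Real.pi^2/6, ?_, by rw [riemannZeta_two]; push_cast; rfl⟩
  nlinarith [Real.pi_gt_three]

lemma one_add_nonneg {q : ℕ} [NeZero q] {χ : DirichletCharacter ℂ q} (h2 : χ^2 = 1) (a : ZMod q) :
    0 ≤ 1 + χ a := by
  by_cases h : IsUnit a
  · have : χ a ^ 2 = 1 := by
      rw [← MulChar.pow_apply' χ two_ne_zero, h2, MulChar.one_apply h]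
    rcases mul_self_eq_one_iff.1 ((sq (χ a)) ▸ this) with h | h <;> rw [h]
    · norm_num
    · norm_num
  · rw [MulChar.map_nonunit χ h]; norm_num

lemma tL_summable {q : ℕ} (χ : DirichletCharacter ℂ q) {s : ℂ} (hs : 1 < s.re) : LSeriesSummable (tL χ) s :=
  DirichletCharacter.LSeriesSummable_twist_vonMangoldt χ hs

lemma posit1 {q : ℕ} [NeZero q] {χ : DirichletCharacter ℂ q} (hχ : χ ≠ 1) (h2 : χ^2 = 1) (n : ℕ) :
    0 ≤ ((-1)^n * iteratedDeriv n (fun s => riemannZeta s * DirichletCharacter.LFunction χ s) 2).re := by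
  have hv := fun {s : ℂ} (hs : 1 < s.re) => ArithmeticFunction.LSeriesSummable_vonMangoldt hs
  refine (Complex.le_def.1 (posit _ ((fun n => ((ArithmeticFunction.vonMangoldt n : ℝ):ℂ)) + tL χ) ?_ ?_ ?_ ?_ n)).1
  · intro m
    have := one_add_nonneg h2 (m : ZMod q)
    have h := mul_nonneg this (show (0:ℂ) ≤ ((ArithmeticFunction.vonMangoldt m : ℝ):ℂ) by
      exact_mod_cast ArithmeticFunction.vonMangoldt_nonneg)
    simp only [Pi.zero_apply, Pi.add_apply, tL, Pi.mul_apply]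
    convert h using 1; ring
  · intro s hs
    exact (hv hs).add (tL_summable χ hs)
  · intro s hs
    rw [LSeries_add (hv hs) (tL_summable χ hs)]
    refine HasDerivAt.congr_deriv ((zeta_hasDeriv hs).mul (LF_hasDeriv χ hs)) ?_
    ring
  · obtain ⟨r, hr, e⟩ := LF_two_nonneg hχ h2
    obtain ⟨r', hr', e'⟩ := zeta_two_ge
    simp only [e, e']
    have : 0 ≤ r' * r := by positivity
    exact_mod_cast this

lemma posit2 {q q1 q2 : ℕ} [NeZero q] [NeZero q1] [NeZero q2] {χ : DirichletCharacter ℂ q} {χ1 : DirichletCharacter ℂ q1}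
    {χ2 : DirichletCharacter ℂ q2} (hχ : χ ≠ 1) (h2 : χ^2 = 1) (hχ1 : χ1 ≠ 1) (h21 : χ1^2 = 1) (hχ2 : χ2 ≠ 1) (h22 : χ2^2 = 1)
    (hm : ∀ n : ℕ, χ2 n = χ1 n * χ n) (n : ℕ) :
    0 ≤ ((-1)^n * iteratedDeriv n (fun s => riemannZeta s * (DirichletCharacter.LFunction χ1 s *
      (DirichletCharacter.LFunction χ s * DirichletCharacter.LFunction χ2 s))) 2).re := by
  have hv := fun {s : ℂ} (hs : 1 < s.re) => ArithmeticFunction.LSeriesSummable_vonMangoldt hs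
  refine (Complex.le_def.1 (posit _ ((fun n => ((ArithmeticFunction.vonMangoldt n : ℝ):ℂ)) + (tL χ1 + (tL χ + tL χ2))) ?_ ?_ ?_ ?_ n)).1
  · intro m
    have := mul_nonneg (one_add_nonneg h2 (m : ZMod q)) (one_add_nonneg h21 (m : ZMod q1))
    have h := mul_nonneg this (show (0:ℂ) ≤ ((ArithmeticFunction.vonMangoldt m : ℝ):ℂ) by
      exact_mod_cast ArithmeticFunction.vonMangoldt_nonneg)
    simp only [Pi.zero_apply, Pi.add_apply, tL, Pi.mul_apply, hm]
    convert h using 1; ring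
  · intro s hs
    exact (hv hs).add ((tL_summable _ hs).add ((tL_summable _ hs).add (tL_summable _ hs)))
  · intro s hs
    rw [LSeries_add (hv hs) ((tL_summable _ hs).add ((tL_summable _ hs).add (tL_summable _ hs))),
      LSeries_add (tL_summable _ hs) ((tL_summable _ hs).add (tL_summable _ hs)),
      LSeries_add (tL_summable _ hs) (tL_summable _ hs)]
    refine HasDerivAt.congr_deriv ((zeta_hasDeriv hs).mul ((LF_hasDeriv χ1 hs).mul ((LF_hasDeriv χ hs).mul (LF_hasDeriv χ2 hs)))) ?_
    ring
  · obtain ⟨r, hr, e⟩ := LF_two_nonneg hχ h2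
    obtain ⟨r1, hr1, e1⟩ := LF_two_nonneg hχ1 h21
    obtain ⟨r2, hr2, e2⟩ := LF_two_nonneg hχ2 h22
    obtain ⟨r', hr', e'⟩ := zeta_two_ge
    simp only [e, e', e1, e2]
    have : 0 ≤ r' * (r1 * (r * r2)) := by positivity
    exact_mod_cast this

end SW

end

section

open Complex Finset
namespace SW

lemma LF_upper {ε : ℝ} (hε : 0 < ε) : ∃ C > 0, ∀ (q : ℕ) [NeZero q] (χ : DirichletCharacter ℂ q), χ ≠ 1 →
    ∀ s : ℂ, 1 ≤ s.re → s.re < 2 → ‖DirichletCharacter.LFunction χ s‖ ≤ C * (q * (|s.im| + 2))^ε := by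
  obtain ⟨C, hC, h⟩ := upper_char 0 hε
  refine ⟨C, hC, fun q _ χ hχ s hs1 hs2 => ?_⟩
  have hcont : Filter.Tendsto (fun d : ℝ => ‖DirichletCharacter.LFunction χ (s + d)‖) (nhdsWithin 0 (Set.Ioi 0))
      (nhds (‖DirichletCharacter.LFunction χ s‖)) := by
    have h1 : Continuous (fun d : ℝ => ‖DirichletCharacter.LFunction χ (s + d)‖) := by
      have := (DirichletCharacter.differentiable_LFunction hχ).continuous
      fun_prop
    have := h1.tendsto 0
    simp only [ofReal_zero, add_zero] at this
    exact this.mono_left nhdsWithin_le_nhds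
  apply le_of_tendsto hcont
  have : Set.Ioo (0:ℝ) (2 - s.re) ∈ nhdsWithin (0:ℝ) (Set.Ioi 0) := Ioo_mem_nhdsGT (by linarith)
  filter_upwards [this] with d hd
  have hre : 1 < (s + d).re := by simp; linarith [hd.1]
  have := h q χ hχ (s+d) hre (by simp; linarith [hd.2])
  rw [DirichletCharacter.LFunction_eq_LSeries χ hre]
  simpa using this

lemma zeta_neg : ∃ η > 0, ∀ b : ℝ, 1 - η < b → b < 1 → (riemannZeta b).re ≤ 0 := by
  have h := (Z1_diff.continuous.tendsto 1)
  rw [Z1_one] at h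
  obtain ⟨η, hη, H⟩ := Metric.tendsto_nhds_nhds.1 h 1 one_pos
  refine ⟨η, hη, fun b h1 h2 => ?_⟩
  have hb : (b:ℂ) ≠ 1 := by
    intro h; rw [← ofReal_one, ofReal_inj] at h; linarith
  have := @H b (by rw [dist_eq_norm, ← ofReal_one, ← ofReal_sub, norm_real, Real.norm_eq_abs, abs_sub_lt_iff]; constructor <;> linarith)
  rw [Z1_ne hb, dist_eq_norm] at this
  have h3 := (abs_lt.1 ((abs_re_le_norm _).trans_lt this)).1
  rw [← ofReal_one, ← ofReal_sub, sub_re, re_ofReal_mul] at h3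
  simp at h3
  by_contra hh
  push Not at hh
  nlinarith

lemma mul_re_real {z w : ℂ} (hw : w.im = 0) : (z*w).re = z.re * w.re := by
  rw [mul_re, hw]; ring

lemma char_ne_one_gt {q : ℕ} [NeZero q] : (1:ℝ) ≤ q := by
  exact_mod_cast Nat.one_le_iff_ne_zero.2 (NeZero.ne q)

lemma siegel_a {ε : ℝ} {η : ℝ} (hη : 0 < η) (hη1 : η ≤ 1/8) (hηε : 2*η ≤ ε)
    (hz : ∀ b : ℝ, 1 - η < b → b < 1 → (riemannZeta b).re ≤ 0)
    (hall : ∀ (q : ℕ) [NeZero q] (χ : DirichletCharacter ℂ q), χ ≠ 1 → χ^2 = 1 → ∀ b : ℝ, 1 - η < b → b < 1 →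
      0 ≤ (DirichletCharacter.LFunction χ b).re) :
    ∃ c > 0, ∀ (q : ℕ) [NeZero q] (χ : DirichletCharacter ℂ q), χ ≠ 1 → χ^2 = 1 →
      c * (q:ℝ)^(-ε) ≤ ‖DirichletCharacter.LFunction χ 1‖ := by
  obtain ⟨c, hc, h⟩ := estermann (c0 := 1/4) (by norm_num)
  refine ⟨c * (η/2) * 7^(-ε), by positivity, fun q _ χ hχ h2 => ?_⟩
  have hq := char_ne_one_gt (q := q)
  have hb : (0:ℝ) < 1 - η/2 := by linarith
  have hL := LF_real hχ h2 hb
  have := h (DirichletCharacter.LFunction χ) (7*q) (1-η/2) (DirichletCharacter.differentiable_LFunction hχ) (by linarith)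
    (fun s hs => LF_bound_ball hχ hs) (posit1 hχ h2) (by
      obtain ⟨r, hr, e⟩ := LF_two_nonneg hχ h2
      obtain ⟨r', hr', e'⟩ := zeta_two_ge
      rw [e, e', ← ofReal_mul, ofReal_re]; nlinarith) (by linarith) (by linarith) (by
      rw [mul_re_real hL]
      exact mul_nonpos_of_nonpos_of_nonneg (hz _ (by linarith) (by linarith)) (hall q χ hχ h2 _ (by linarith) (by linarith)))
  refine le_trans ?_ ((this.trans (re_le_norm _)))
  rw [show 1 - (1-η/2) = η/2 by ring, mul_assoc (c*(η/2)), ← Real.mul_rpow (by norm_num) (by linarith)]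
  gcongr
  · linarith
  · linarith

/-- product of characters of different moduli -/
noncomputable def prodChar {q1 q : ℕ} (χ1 : DirichletCharacter ℂ q1) (χ : DirichletCharacter ℂ q) : DirichletCharacter ℂ (q1*q) :=
  DirichletCharacter.changeLevel (Dvd.intro _ rfl) χ1 * DirichletCharacter.changeLevel (Dvd.intro_left _ rfl) χ

lemma prodChar_apply {q1 q : ℕ} [NeZero q1] [NeZero q] (χ1 : DirichletCharacter ℂ q1) (χ : DirichletCharacter ℂ q) (n : ℕ) :
    prodChar χ1 χ (n : ZMod (q1*q)) = χ1 n * χ n := by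
  by_cases h : IsUnit (n : ZMod (q1*q))
  · obtain ⟨u, hu⟩ := h
    rw [prodChar, MulChar.mul_apply, ← hu, DirichletCharacter.changeLevel_eq_cast_of_dvd, DirichletCharacter.changeLevel_eq_cast_of_dvd, hu]
    rw [ZMod.cast_natCast (Dvd.intro _ rfl), ZMod.cast_natCast (Dvd.intro_left _ rfl)]
  · rw [MulChar.map_nonunit _ h]
    rw [ZMod.isUnit_iff_coprime, Nat.coprime_mul_iff_right, not_and_or, ← ZMod.isUnit_iff_coprime, ← ZMod.isUnit_iff_coprime] at h
    rcases h with h | h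
    · rw [MulChar.map_nonunit _ h, zero_mul]
    · rw [MulChar.map_nonunit _ h, mul_zero]

lemma prodChar_sq {q1 q : ℕ} [NeZero q1] [NeZero q] {χ1 : DirichletCharacter ℂ q1} {χ : DirichletCharacter ℂ q}
    (h1 : χ1^2 = 1) (h : χ^2 = 1) : (prodChar χ1 χ)^2 = 1 := by
  rw [prodChar, mul_pow, ← map_pow, ← map_pow, h1, h, map_one, map_one, one_mul]

lemma siegel_b1 {ε : ℝ} (hε : 0 < ε) {q1 : ℕ} [NeZero q1] {χ1 : DirichletCharacter ℂ q1} (hχ1 : χ1 ≠ 1) (h21 : χ1^2=1)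
    {b : ℝ} (hb : 7/8 ≤ b) (hb1 : b < 1) (hbε : 16*(1-b) ≤ ε) (h0 : DirichletCharacter.LFunction χ1 b = 0) :
    ∃ c > 0, ∀ (q : ℕ) [NeZero q] (χ : DirichletCharacter ℂ q), χ ≠ 1 → χ^2 = 1 → prodChar χ1 χ ≠ 1 →
      c * (q:ℝ)^(-ε) ≤ ‖DirichletCharacter.LFunction χ 1‖ := by
  obtain ⟨c, hc, h⟩ := estermann (c0 := 1/64) (by norm_num)
  obtain ⟨C, hC, hU⟩ := LF_upper (half_pos hε)
  have hq1 := char_ne_one_gt (q := q1)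
  set D := 7 * q1 * (C * (2*(q1:ℝ))^(ε/2)) with hD
  have hDpos : 0 < D := by positivity
  refine ⟨c * (1-b) * (343*(q1:ℝ)^2)^(-(4*(1-b))) / D, by have : 0 < 1 - b := by linarith
                                                          positivity, fun q _ χ hχ h2 hne => ?_⟩
  have hq := char_ne_one_gt (q := q)
  have := h (fun s => DirichletCharacter.LFunction χ1 s * (DirichletCharacter.LFunction χ s * DirichletCharacter.LFunction (prodChar χ1 χ) s))
    ((7*q1)*((7*q)*(7*(q1*q)))) b (by
      have a1 := (DirichletCharacter.differentiable_LFunction hχ)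
      have a2 := (DirichletCharacter.differentiable_LFunction hχ1)
      have a3 := (DirichletCharacter.differentiable_LFunction hne)
      fun_prop) (by
      have : (1:ℝ) ≤ q1 * q := by nlinarith
      have h3 : (1:ℝ) ≤ (7*q)*(7*(q1*q)) := by nlinarith
      nlinarith)
    (fun s hs => by
      rw [norm_mul, norm_mul]
      have h3 := LF_bound_ball hne hs
      push_cast at h3
      gcongr
      · exact LF_bound_ball hχ1 hs
      · exact LF_bound_ball hχ hs) (posit2 hχ h2 hχ1 h21 hne (prodChar_sq h21 h2) (prodChar_apply χ1 χ)) (by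
      obtain ⟨r, hr, e⟩ := LF_two_nonneg hχ h2
      obtain ⟨r1, hr1, e1⟩ := LF_two_nonneg hχ1 h21
      obtain ⟨r2, hr2, e2⟩ := LF_two_nonneg hne (prodChar_sq h21 h2)
      obtain ⟨r', hr', e'⟩ := zeta_two_ge
      rw [e, e', e1, e2, ← ofReal_mul, ← ofReal_mul, ← ofReal_mul, ofReal_re]
      calc (1/64:ℝ) = 1 * (1/4 * (1/4 * (1/4))) := by norm_num
        _ ≤ r' * (r1 * (r * r2)) := by gcongr) hb hb1 (by simp [h0])
  have h3 := this.trans (re_le_norm _)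
  rw [norm_mul, norm_mul] at h3
  have hu := hU (q1*q) (prodChar χ1 χ) hne 1 (by simp) (by simp)
  have h1b := LF_bound_ball hχ1 (s := 1) (by rw [mem_closedBall_iff_norm]; norm_num)
  have hR : (C * (((q1*q:ℕ):ℝ) * (|(1:ℂ).im| + 2))^(ε/2)) = C * (2*(q1:ℝ))^(ε/2) * (q:ℝ)^(ε/2) := by
    rw [mul_assoc, ← Real.mul_rpow (by positivity) (by positivity)]
    congr 2; simp; ring
  rw [hR] at hu
  have h4 : c * (1-b) * ((7*q1)*((7*q)*(7*(q1*q))))^(-4*(1-b)) ≤ D * (q:ℝ)^(ε/2) * ‖DirichletCharacter.LFunction χ 1‖ := by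
    refine h3.trans ?_
    calc _ ≤ (7*q1) * (‖DirichletCharacter.LFunction χ 1‖ * (C * (2*(q1:ℝ))^(ε/2) * (q:ℝ)^(ε/2))) := by gcongr
      _ = _ := by rw [hD]; ring
  have h5 : c * (1-b) * (343*(q1:ℝ)^2)^(-(4*(1-b))) * (q:ℝ)^(-(ε/2)) ≤ c * (1-b) * ((7*q1)*((7*q)*(7*(q1*q))))^(-4*(1-b)) := by
    rw [show ((7*q1)*((7*q)*(7*(q1*q))) : ℝ) = (343*q1^2) * q^2 by ring, Real.mul_rpow (x := 343*(q1:ℝ)^2) (by positivity) (by positivity), mul_assoc (c*(1-b))]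
    rw [show -4*(1-b) = -(4*(1-b)) by ring, ← Real.rpow_natCast (q:ℝ) 2, ← Real.rpow_mul (by positivity)]
    have : 0 < 1 - b := by linarith
    gcongr
    push_cast; linarith
  have h6 := h5.trans h4
  have hqp : (0:ℝ) < (q:ℝ)^(ε/2) := by positivity
  rw [div_mul_eq_mul_div, div_le_iff₀ hDpos]
  have e1 : (q:ℝ)^(-ε) = (q:ℝ)^(-(ε/2)) / (q:ℝ)^(ε/2) := by
    rw [← Real.rpow_sub (by linarith)]; congr 1; ring
  rw [e1, ← mul_div_assoc, div_le_iff₀ hqp]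
  linarith

lemma siegel_b2 {ε : ℝ} (hε : 0 < ε) {q1 : ℕ} [NeZero q1] {χ1 : DirichletCharacter ℂ q1} (hχ1 : χ1 ≠ 1) (h21 : χ1^2=1) :
    ∃ c > 0, ∀ (q : ℕ) [NeZero q] (χ : DirichletCharacter ℂ q), χ ≠ 1 → χ^2 = 1 → prodChar χ1 χ = 1 →
      c * (q:ℝ)^(-ε) ≤ ‖DirichletCharacter.LFunction χ 1‖ := by
  obtain ⟨C, hC, hU⟩ := omega_le (half_pos hε)
  have hL0 : 0 < ‖DirichletCharacter.LFunction χ1 1‖ := norm_pos_iff.2 (DirichletCharacter.LFunction_apply_one_ne_zero hχ1)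
  have hq1 := char_ne_one_gt (q := q1)
  refine ⟨‖DirichletCharacter.LFunction χ1 1‖ / (C * (q1:ℝ)^(ε/2))^2, by positivity, fun q _ χ hχ h2 hp => ?_⟩
  have hq := char_ne_one_gt (q := q)
  have hlev : DirichletCharacter.changeLevel (Dvd.intro _ rfl : q1 ∣ q1*q) χ1 = DirichletCharacter.changeLevel (Dvd.intro_left _ rfl : q ∣ q1*q) χ := by
    have hs : (DirichletCharacter.changeLevel (Dvd.intro_left _ rfl : q ∣ q1*q) χ)^2 = 1 := by
      rw [← map_pow, h2, map_one]
    rw [prodChar] at hp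
    rw [eq_inv_of_mul_eq_one_left hp]
    exact inv_eq_of_mul_eq_one_left (by rw [← sq, hs])
  have e1 := DirichletCharacter.LFunction_changeLevel (Dvd.intro _ rfl : q1 ∣ q1*q) χ1 (s := 1) (Or.inl hχ1)
  have e2 := DirichletCharacter.LFunction_changeLevel (Dvd.intro_left _ rfl : q ∣ q1*q) χ (s := 1) (Or.inl hχ)
  rw [hlev, e2] at e1
  have e3 := congrArg norm e1
  rw [norm_mul, norm_mul, norm_prod, norm_prod] at e3
  have hpb := prod_bounds (q1*q).primeFactors (fun p hp => (Nat.prime_of_mem_primeFactors hp).two_le)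
  set W : ℝ := ((q1*q).primeFactors.card : ℝ) + 1 with hW
  have hW0 : 0 < W := by positivity
  have hup : ∏ p ∈ (q1*q).primeFactors, ‖1 - χ (p : ZMod q) * (p:ℂ)^(-1:ℂ)‖ ≤ W := by
    refine le_trans (prod_le_prod (fun _ _ => norm_nonneg _) (fun p hp => ?_)) hpb.1
    refine (norm_sub_le _ _).trans ?_
    rw [norm_one, norm_mul, cpow_neg_one, norm_inv, norm_natCast, one_div]
    have := DirichletCharacter.norm_le_one χ (p : ZMod q)
    have h0 : (0:ℝ) ≤ (p:ℝ)⁻¹ := by positivity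
    nlinarith
  have hlow : 1/W ≤ ∏ p ∈ (q1*q).primeFactors, ‖1 - χ1 (p : ZMod q1) * (p:ℂ)^(-1:ℂ)‖ := by
    refine le_trans hpb.2 (prod_le_prod (fun p hp => ?_) (fun p hp => ?_))
    · have := (Nat.prime_of_mem_primeFactors hp).one_le
      have : (1:ℝ) ≤ p := by exact_mod_cast this
      rw [sub_nonneg, div_le_one (by linarith)]; exact this
    · have h3 := norm_sub_norm_le (1:ℂ) (χ1 (p : ZMod q1) * (p:ℂ)^(-1:ℂ))
      refine le_trans ?_ h3
      rw [norm_one, norm_mul, cpow_neg_one, norm_inv, norm_natCast, one_div]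
      have := DirichletCharacter.norm_le_one χ1 (p : ZMod q1)
      have h0 : (0:ℝ) ≤ (p:ℝ)⁻¹ := by positivity
      nlinarith
  have hWle := hU (q1*q) (Nat.pos_of_ne_zero (NeZero.ne _))
  rw [← hW, Nat.cast_mul, Real.mul_rpow (by positivity) (by positivity), ← mul_assoc] at hWle
  have h7 : ‖DirichletCharacter.LFunction χ1 1‖ ≤ ‖DirichletCharacter.LFunction χ 1‖ * W^2 := by
    have a1 : ‖DirichletCharacter.LFunction χ1 1‖ * (1/W) ≤ ‖DirichletCharacter.LFunction χ 1‖ * W := by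
      calc _ ≤ _ := mul_le_mul_of_nonneg_left hlow (norm_nonneg _)
        _ = _ := e3.symm
        _ ≤ _ := mul_le_mul_of_nonneg_left hup (norm_nonneg _)
    rw [mul_one_div, div_le_iff₀ hW0] at a1
    linarith
  rw [div_mul_eq_mul_div, div_le_iff₀ (by positivity)]
  rw [Real.rpow_neg (by positivity), ← div_eq_mul_inv, div_le_iff₀ (by positivity)]
  refine h7.trans ?_
  rw [mul_assoc]
  gcongr
  calc W^2 ≤ (C * (q1:ℝ)^(ε/2) * (q:ℝ)^(ε/2))^2 := by gcongr
    _ = _ := by rw [mul_pow]; congr 1; rw [← Real.rpow_natCast, ← Real.rpow_mul (by positivity)]; congr 1; push_cast; ring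

theorem siegel {ε : ℝ} (hε : 0 < ε) : ∃ c > 0, ∀ (q : ℕ) [NeZero q] (χ : DirichletCharacter ℂ q), χ ≠ 1 → χ^2 = 1 →
      c * (q:ℝ)^(-ε) ≤ ‖DirichletCharacter.LFunction χ 1‖ := by
  obtain ⟨η0, hη0, hz⟩ := zeta_neg
  set η := min η0 (min (1/8) (ε/16)) with hη
  have hηpos : 0 < η := by positivity
  have b1 : η ≤ η0 := min_le_left _ _
  have b2 : η ≤ 1/8 := (min_le_right _ _).trans (min_le_left _ _)
  have b3 : η ≤ ε/16 := (min_le_right _ _).trans (min_le_right _ _)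
  by_cases hall : ∀ (q : ℕ) [NeZero q] (χ : DirichletCharacter ℂ q), χ ≠ 1 → χ^2 = 1 → ∀ b : ℝ, 1 - η < b → b < 1 →
      0 ≤ (DirichletCharacter.LFunction χ b).re
  · exact siegel_a hηpos b2 (by linarith) (fun b h1 h2 => hz b (by linarith) h2) hall
  · push Not at hall
    obtain ⟨q1, hq1, χ1, hχ1, h21, b0, hb0, hb01, hneg⟩ := hall
    have hcont : ContinuousOn (fun x : ℝ => (DirichletCharacter.LFunction χ1 x).re) (Set.Icc b0 2) := by
      have := (DirichletCharacter.differentiable_LFunction hχ1).continuous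
      exact (continuous_re.comp (this.comp continuous_ofReal)).continuousOn
    have hivt := intermediate_value_Icc (by linarith) hcont
    have hmem : (0:ℝ) ∈ Set.Icc ((DirichletCharacter.LFunction χ1 b0).re) ((DirichletCharacter.LFunction χ1 (2:ℝ)).re) := by
      refine ⟨hneg.le, ?_⟩
      have := LF_two (χ := χ1)
      simp only [ofReal_ofNat]
      linarith
    obtain ⟨b, hb, hb00⟩ := hivt hmem
    have hL : DirichletCharacter.LFunction χ1 b = 0 := by
      apply Complex.ext
      · exact hb00
      · exact LF_real hχ1 h21 (by linarith [hb.1])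
    have hb1 : b < 1 := by
      by_contra hh
      push Not at hh
      exact DirichletCharacter.LFunction_ne_zero_of_one_le_re χ1 (s := b) (Or.inl hχ1) (by simpa using hh) hL
    obtain ⟨c, hc, h⟩ := siegel_b1 hε hχ1 h21 (b := b) (by linarith [hb.1]) hb1 (by linarith [hb.1]) hL
    obtain ⟨c', hc', h'⟩ := siegel_b2 hε hχ1 h21
    refine ⟨min c c', by positivity, fun q _ χ hχ h2 => ?_⟩
    by_cases hp : prodChar χ1 χ = 1
    · refine le_trans ?_ (h' q χ hχ h2 hp)
      gcongr; exact min_le_right _ _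
    · refine le_trans ?_ (h q χ hχ h2 hp)
      gcongr; exact min_le_left _ _

end SW

end

section

open Complex Finset
namespace SW

lemma LF_deriv_upper {ε : ℝ} (hε : 0 < ε) : ∃ C > 0, ∀ (q : ℕ) [NeZero q] (χ : DirichletCharacter ℂ q), χ ≠ 1 →
    ∀ s : ℂ, 1 ≤ s.re → s.re < 2 → ‖deriv (DirichletCharacter.LFunction χ) s‖ ≤ C * (q * (|s.im| + 2))^ε := by
  obtain ⟨C, hC, h⟩ := upper_char 1 hε
  refine ⟨C, hC, fun q _ χ hχ s hs1 hs2 => ?_⟩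
  have hcont : Filter.Tendsto (fun d : ℝ => ‖deriv (DirichletCharacter.LFunction χ) (s + d)‖) (nhdsWithin 0 (Set.Ioi 0))
      (nhds (‖deriv (DirichletCharacter.LFunction χ) s‖)) := by
    have h1 : Continuous (fun d : ℝ => ‖deriv (DirichletCharacter.LFunction χ) (s + d)‖) := by
      have : Continuous (deriv (DirichletCharacter.LFunction χ)) :=
        ((DirichletCharacter.differentiable_LFunction hχ).contDiff (n := 1)).continuous_deriv le_rfl
      exact (this.comp (continuous_const.add continuous_ofReal)).norm
    have := h1.tendsto 0
    simp only [ofReal_zero, add_zero] at this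
    exact this.mono_left nhdsWithin_le_nhds
  apply le_of_tendsto hcont
  have : Set.Ioo (0:ℝ) (2 - s.re) ∈ nhdsWithin (0:ℝ) (Set.Ioi 0) := Ioo_mem_nhdsGT (by linarith)
  filter_upwards [this] with d hd
  have hre : 1 < (s + d).re := by simp; linarith [hd.1]
  have := h q χ hχ (s+d) hre (by simp; linarith [hd.2])
  rw [DirichletCharacter.deriv_LFunction_eq_deriv_LSeries χ hre, LSeries_deriv, norm_neg]
  · simpa using this
  · refine lt_of_le_of_lt (abscissa_le_one (fun n => DirichletCharacter.norm_le_one χ _)) ?_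
    exact_mod_cast hre

lemma LF_lip {ε : ℝ} (hε : 0 < ε) : ∃ C > 0, ∀ (q : ℕ) [NeZero q] (χ : DirichletCharacter ℂ q), χ ≠ 1 →
    ∀ (T : ℝ) (s w : ℂ), 1 ≤ s.re → s.re < 2 → |s.im| ≤ T → 1 ≤ w.re → w.re < 2 → |w.im| ≤ T →
    ‖DirichletCharacter.LFunction χ s - DirichletCharacter.LFunction χ w‖ ≤ C * (q * (T + 2))^ε * ‖s - w‖ := by
  obtain ⟨C, hC, h⟩ := LF_deriv_upper hε
  refine ⟨C, hC, fun q _ χ hχ T s w hs1 hs2 hs3 hw1 hw2 hw3 => ?_⟩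
  have hconv : Convex ℝ ({z : ℂ | 1 ≤ z.re} ∩ ({z : ℂ | z.re < 2} ∩ ({z : ℂ | -T ≤ z.im} ∩ {z : ℂ | z.im ≤ T}))) :=
    (convex_halfSpace_re_ge 1).inter ((convex_halfSpace_re_lt 2).inter ((convex_halfSpace_im_ge (-T)).inter (convex_halfSpace_im_le T)))
  refine hconv.norm_image_sub_le_of_norm_deriv_le (𝕜 := ℂ) (fun x _ => (DirichletCharacter.differentiable_LFunction hχ) x) (fun x hx => ?_)
    ⟨hw1, hw2, (abs_le.1 hw3).1, (abs_le.1 hw3).2⟩ ⟨hs1, hs2, (abs_le.1 hs3).1, (abs_le.1 hs3).2⟩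
  refine (h q χ hχ x hx.1 hx.2.1).trans ?_
  have : |x.im| ≤ T := abs_le.2 hx.2.2
  gcongr

lemma zeta_sum : ∃ C ≥ 1, ∀ x : ℝ, 0 < x → x ≤ 1 → ∀ a : ℕ → ℂ, (∀ n, ‖a n‖ ≤ 1) → ∀ s : ℂ, s.re = 1 + x →
    ‖LSeries a s‖ ≤ C / x := by
  obtain ⟨M, hM⟩ := (isCompact_closedBall (1:ℂ) 1).exists_bound_of_continuousOn Z1_diff.continuous.continuousOn
  refine ⟨max 1 M, le_max_left _ _, fun x hx hx1 a ha s hs => ?_⟩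
  have hsum : Summable (fun n : ℕ => 1 / (n:ℝ)^(1+x)) := Real.summable_one_div_nat_rpow.2 (by linarith)
  have hb : ‖LSeries a s‖ ≤ ∑' n : ℕ, 1 / (n:ℝ)^(1+x) := by
    refine tsum_of_norm_bounded hsum.hasSum (fun n => ?_)
    rw [LSeries.norm_term_eq, hs]
    split_ifs with h
    · positivity
    · gcongr; exact ha n
  refine hb.trans ?_
  have hz : (((∑' n : ℕ, 1 / (n:ℝ)^(1+x)):ℝ):ℂ) = riemannZeta ((1+x:ℝ):ℂ) := by
    rw [zeta_eq_tsum_one_div_nat_cpow (by rw [ofReal_re]; linarith)]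
    rw [ofReal_tsum]
    congr 1
    ext n
    rw [ofReal_div, ofReal_cpow (by positivity)]; simp
  have hne : ((1+x:ℝ):ℂ) ≠ 1 := by
    intro h; rw [← ofReal_one, ofReal_inj] at h; linarith
  have h1 := hM ((1+x:ℝ):ℂ) (by rw [mem_closedBall_iff_norm]; simp; rw [abs_of_pos hx]; exact hx1)
  rw [Z1_ne hne, norm_mul, ← hz, norm_real, Real.norm_eq_abs, abs_of_nonneg (tsum_nonneg (fun n => by positivity))] at h1
  rw [le_div_iff₀ hx]
  have : ‖((1+x:ℝ):ℂ) - 1‖ = x := by push_cast; simp [abs_of_pos hx]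
  rw [this] at h1
  linarith [le_max_right 1 M]

lemma LF_triv_lower : ∃ c > 0, ∀ (q : ℕ) [NeZero q] (χ : DirichletCharacter ℂ q) (s : ℂ), 1 < s.re → s.re ≤ 2 →
    c * (s.re - 1) ≤ ‖DirichletCharacter.LFunction χ s‖ := by
  obtain ⟨C, hC, h⟩ := zeta_sum
  refine ⟨1/C, by positivity, fun q _ χ s hs hs2 => ?_⟩
  have h1 := DirichletCharacter.LSeries.mul_mu_eq_one χ hs
  have h2 := h (s.re - 1) (by linarith) (by linarith) ((fun n : ℕ => χ (n : ZMod q)) * (fun n : ℕ => ((ArithmeticFunction.moebius n : ℤ):ℂ))) (fun n => by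
    simp only [Pi.mul_apply, norm_mul]
    have a1 := DirichletCharacter.norm_le_one χ (n : ZMod q)
    have a2 : ‖((ArithmeticFunction.moebius n : ℤ):ℂ)‖ ≤ 1 := by
      rw [norm_intCast]; exact_mod_cast ArithmeticFunction.abs_moebius_le_one
    exact mul_le_one₀ a1 (norm_nonneg _) a2) s (by ring)
  rw [DirichletCharacter.LFunction_eq_LSeries χ hs]
  have h3 := congrArg norm h1
  rw [norm_mul, norm_one] at h3
  have hx : 0 < s.re - 1 := by linarith
  rw [le_div_iff₀ hx] at h2
  rw [one_div_mul_eq_div, div_le_iff₀ (by linarith)]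
  nlinarith [norm_nonneg (LSeries (fun n : ℕ => χ (n : ZMod q)) s)]

/-- 3-4-1 consequence -/
lemma LF_341 {ε : ℝ} (hε : 0 < ε) : ∃ c > 0, ∀ (q : ℕ) [NeZero q] (χ : DirichletCharacter ℂ q), χ ≠ 1 →
    ∀ (τ : ℝ), 0 < τ → τ ≤ 1 → ∀ s : ℂ, 1 < s.re → s.re ≤ 2 → (χ^2 = 1 → τ ≤ |s.im|) →
    c * (s.re - 1)^3 * τ * (q * (|s.im| + 2))^(-ε) ≤ ‖DirichletCharacter.LFunction χ s‖^4 := by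
  obtain ⟨C0, hC0, h0⟩ := zeta_sum
  obtain ⟨C1, hC1, h1⟩ := upper_char 0 hε
  obtain ⟨C2, hC2, h2⟩ := upper_triv hε
  refine ⟨1/(C0^3 * ((C1 + 2*C2) * 2^ε)), by positivity, fun q _ χ hχ τ hτ hτ1 s hs hs2 ht => ?_⟩
  have hq := char_ne_one_gt (q := q)
  set x := s.re - 1 with hx
  have hxp : 0 < x := by linarith
  have key := DirichletCharacter.norm_LSeries_product_ge_one χ hxp s.im
  have es : 1 + (x:ℂ) + I * s.im = s := by
    apply Complex.ext <;> simp [hx]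
  rw [es, norm_mul, norm_mul, norm_pow, norm_pow] at key
  set w : ℂ := 1 + (x:ℂ) + 2*I*s.im with hw
  have wre : w.re = 1 + x := by simp [hw]
  have wim : w.im = 2*s.im := by simp [hw]
  set Q : ℝ := q * (|s.im| + 2) with hQ
  have hQ1 : 0 < Q := by positivity
  have hQw : (q * (|w.im| + 2) : ℝ)^ε ≤ 2^ε * Q^ε := by
    rw [← Real.mul_rpow (by norm_num) hQ1.le]
    apply Real.rpow_le_rpow (by positivity) _ hε.le
    rw [wim, abs_mul, hQ]; norm_num
    nlinarith [abs_nonneg s.im]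
  have hU : ‖LSeries (fun n : ℕ => (χ^2) (n : ZMod q)) w‖ ≤ (C1 + 2*C2) * 2^ε * Q^ε / τ := by
    rw [le_div_iff₀ hτ]
    by_cases hc : χ^2 = 1
    · have ht' := ht hc
      have hne : 0 < |w.im| := by rw [wim, abs_mul]; norm_num; exact abs_pos.1 (by linarith)
      have := h2 q w (by linarith) (by linarith) (abs_pos.1 hne)
      rw [hc]
      have hb : 1 + 1/|w.im| ≤ 2/τ := by
        have a1 : 1/|w.im| ≤ 1/τ := by
          apply one_div_le_one_div_of_le hτ
          rw [wim, abs_mul]; norm_num; linarith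
        have a2 : 1 ≤ 1/τ := by rw [le_div_iff₀ hτ]; linarith
        have : 2/τ = 1/τ + 1/τ := by ring
        linarith
      calc _ ≤ C2 * (q * (|w.im| + 2))^ε * (1 + 1/|w.im|) * τ := by gcongr
        _ ≤ C2 * (2^ε * Q^ε) * (2/τ) * τ := by gcongr
        _ = 2*C2 * 2^ε * Q^ε := by field_simp
        _ ≤ _ := by gcongr; linarith
    · have := h1 q (χ^2) hc w (by linarith) (by linarith)
      simp only [Function.iterate_zero, id_eq] at this
      calc _ ≤ C1 * (q * (|w.im| + 2))^ε * 1 := by gcongr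
        _ ≤ C1 * (2^ε * Q^ε) * 1 := by gcongr
        _ = C1 * 2^ε * Q^ε := by ring
        _ ≤ _ := by gcongr; linarith
  have h3 := h0 x hxp (by linarith) (fun n : ℕ => (1 : DirichletCharacter ℂ q) (n : ZMod q)) (fun n => DirichletCharacter.norm_le_one _ _) (1 + (x:ℂ)) (by simp)
  rw [DirichletCharacter.LFunction_eq_LSeries χ hs]
  set A := ‖LSeries (fun n : ℕ => χ (n : ZMod q)) s‖
  have h4 : 1 ≤ (C0/x)^3 * A^4 * ((C1 + 2*C2) * 2^ε * Q^ε / τ) := by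
    refine le_trans key ?_
    gcongr
  rw [Real.rpow_neg hQ1.le]
  have hQp : 0 < Q^ε := by positivity
  have e : (C0/x)^3 * A^4 * ((C1 + 2*C2) * 2^ε * Q^ε / τ) = A^4 / (1/(C0^3 * ((C1 + 2*C2) * 2^ε)) * x^3 * τ * (Q^ε)⁻¹) := by
    field_simp
  rw [e, le_div_iff₀ (by positivity)] at h4
  linarith

/-- lower bound away from the exceptional point -/
lemma LF_lower1 {ε : ℝ} (hε : 0 < ε) : ∃ c > 0, ∀ (q : ℕ) [NeZero q] (χ : DirichletCharacter ℂ q), χ ≠ 1 →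
    ∀ (τ : ℝ), 0 < τ → τ ≤ 1 → ∀ s : ℂ, 1 < s.re → s.re < 2 → (χ^2 = 1 → τ ≤ |s.im|) →
    c * τ * (q * (|s.im| + 2))^(-(4*ε)) ≤ ‖DirichletCharacter.LFunction χ s‖ := by
  obtain ⟨c0, hc0, h0⟩ := LF_341 hε
  obtain ⟨C, hC, hL⟩ := LF_lip hε
  set k := min (1/2) (c0/(16*C^4)) with hk
  have hk0 : 0 < k := by positivity
  refine ⟨C*k, by positivity, fun q _ χ hχ τ hτ hτ1 s hs hs2 ht => ?_⟩
  have hq := char_ne_one_gt (q := q)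
  set Q : ℝ := q * (|s.im| + 2) with hQ
  have hQ1 : 1 ≤ Q := by nlinarith [abs_nonneg s.im]
  have hQ0 : 0 < Q := by linarith
  set E := Q^ε with hE
  have hE1 : 1 ≤ E := Real.one_le_rpow hQ1 hε.le
  have hEn : ∀ n : ℕ, Q^(-(n*ε)) = (E^n)⁻¹ := fun n => by
    rw [Real.rpow_neg hQ0.le, mul_comm, Real.rpow_mul hQ0.le, Real.rpow_natCast]
  have e4 := hEn 4
  have e1 := hEn 1
  push_cast at e4 e1
  rw [one_mul] at e1
  rw [e4]
  set d := k * τ * (E^5)⁻¹ with hd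
  have hd0 : 0 < d := by positivity
  have hd1 : d ≤ 1/2 := by
    have : (E^5)⁻¹ ≤ 1 := inv_le_one_of_one_le₀ (one_le_pow₀ hE1)
    calc d ≤ (1/2) * 1 * 1 := by rw [hd]; gcongr; exact min_le_left _ _
      _ = 1/2 := by norm_num
  have hm : C * k * τ * (E^4)⁻¹ = C * E * d := by rw [hd]; field_simp
  rw [hm]
  have hbig : ∀ w : ℂ, 1 + d ≤ w.re → w.re ≤ 2 → w.im = s.im → 2 * (C*E*d) ≤ ‖DirichletCharacter.LFunction χ w‖ := by
    intro w hw1 hw2 hw3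
    have := h0 q χ hχ τ hτ hτ1 w (by linarith) hw2 (by rw [hw3]; exact ht)
    rw [hw3, ← hQ, e1] at this
    have h5 : (2*(C*E*d))^4 ≤ ‖DirichletCharacter.LFunction χ w‖^4 := by
      refine le_trans ?_ this
      have a1 : d^3 ≤ (w.re - 1)^3 := by gcongr; linarith
      have a2 : 16*C^4*k ≤ c0 := by
        have : k ≤ c0/(16*C^4) := min_le_right _ _
        rw [le_div_iff₀ (by positivity)] at this
        linarith
      calc (2*(C*E*d))^4 = (16*C^4*k) * d^3 * τ * (E^1)⁻¹ := by
            have : (2*(C*E*d))^4 = 16*C^4*E^4*d^3*d := by ring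
            rw [this]
            nth_rewrite 2 [hd]
            field_simp
        _ ≤ c0 * (w.re-1)^3 * τ * (E^1)⁻¹ := by gcongr
    exact le_of_pow_le_pow_left₀ (by norm_num) (norm_nonneg _) h5
  by_cases hc : 1 + d ≤ s.re
  · have := hbig s hc hs2.le rfl
    have : 0 < C*E*d := by positivity
    linarith
  · push Not at hc
    set w : ℂ := ⟨1+d, s.im⟩ with hw
    have b1 := hbig w le_rfl (by simp [hw]; linarith) rfl
    have b2 := hL q χ hχ |s.im| w s (by simp [hw]; linarith) (by simp [hw]; linarith) (by simp [hw]) hs.le hs2 le_rfl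
    have b3 : ‖w - s‖ ≤ d := by
      have : w - s = ((1 + d - s.re : ℝ) : ℂ) := by
        apply Complex.ext <;> simp [hw]
      rw [this, norm_real, Real.norm_eq_abs, abs_of_pos (by linarith)]
      linarith
    have b4 := norm_sub_norm_le (DirichletCharacter.LFunction χ w) (DirichletCharacter.LFunction χ s)
    have b5 : C * Q^ε * ‖w - s‖ ≤ C*E*d := by gcongr
    linarith

theorem LF_lower {ε : ℝ} (hε : 0 < ε) : ∃ c > 0, ∀ (q : ℕ) [NeZero q] (χ : DirichletCharacter ℂ q), χ ≠ 1 →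
    ∀ s : ℂ, 1 < s.re → s.re < 2 →
    c * (q * (|s.im| + 2))^(-ε) ≤ ‖DirichletCharacter.LFunction χ s‖ := by
  set e := ε/6 with he
  have he0 : 0 < e := by positivity
  obtain ⟨c1, hc1, h1⟩ := LF_lower1 he0
  obtain ⟨c2, hc2, h2⟩ := siegel he0
  obtain ⟨c3, hc3, h3⟩ := LF_triv_lower
  obtain ⟨C, hC, hL⟩ := LF_lip he0
  set k := min 1 (c2/(4*C*2^e)) with hk
  have hk0 : 0 < k := by positivity
  have hk1 : k ≤ 1 := min_le_left _ _
  refine ⟨min (c1*k) (min (c3*k) (c2/2)), by positivity, fun q _ χ hχ s hs hs2 => ?_⟩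
  have hq := char_ne_one_gt (q := q)
  set Q : ℝ := q * (|s.im| + 2) with hQ
  have hQ1 : 1 ≤ Q := by nlinarith [abs_nonneg s.im]
  have hQ0 : 0 < Q := by linarith
  have hqQ : (q:ℝ) ≤ Q := by nlinarith [abs_nonneg s.im]
  have hm : ∀ a b : ℝ, a ≤ b → Q^a ≤ Q^b := fun a b h => Real.rpow_le_rpow_of_exponent_le hQ1 h
  set τ := k * Q^(-(2*e)) with hτ
  have hτ0 : 0 < τ := by positivity
  have hτ1 : τ ≤ 1 := by
    have := hm (-(2*e)) 0 (by linarith)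
    rw [Real.rpow_zero] at this
    rw [hτ]; exact mul_le_one₀ hk1 (by positivity) this
  have hmin1 : min (c1*k) (min (c3*k) (c2/2)) ≤ c1*k := min_le_left _ _
  have hmin2 : min (c1*k) (min (c3*k) (c2/2)) ≤ c3*k := (min_le_right _ _).trans (min_le_left _ _)
  have hmin3 : min (c1*k) (min (c3*k) (c2/2)) ≤ c2/2 := (min_le_right _ _).trans (min_le_right _ _)
  by_cases hc : χ^2 = 1 → τ ≤ |s.im|
  · refine le_trans ?_ (h1 q χ hχ τ hτ0 hτ1 s hs hs2 hc)
    rw [← hQ, hτ]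
    calc _ ≤ c1*k * Q^(-ε) := by gcongr
      _ = c1 * (k * Q^(-(2*e))) * Q^(-(4*e)) := by
        rw [show -ε = -(2*e) + -(4*e) by rw [he]; ring, Real.rpow_add hQ0]; ring
  · push Not at hc
    obtain ⟨hχ2, him⟩ := hc
    by_cases hσ : s.re - 1 ≤ τ
    · have s1 := h2 q χ hχ hχ2
      have b2 := hL q χ hχ 1 1 s (by simp) (by simp) (by simp) hs.le hs2 (by linarith)
      have b3 : ‖(1:ℂ) - s‖ ≤ 2*τ := by
        rw [norm_sub_rev]
        refine (Complex.norm_le_abs_re_add_abs_im _).trans ?_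
        simp only [sub_re, one_re, sub_im, one_im, sub_zero]
        rw [abs_of_pos (by linarith)]; linarith
      have b4 := norm_sub_norm_le (DirichletCharacter.LFunction χ 1) (DirichletCharacter.LFunction χ s)
      have b5 : (q * (1+2) : ℝ)^e ≤ 2^e * Q^e := by
        rw [← Real.mul_rpow (by norm_num) hQ0.le]
        apply Real.rpow_le_rpow (by positivity) _ he0.le
        nlinarith [abs_nonneg s.im]
      have b6 : C * (q * (1+2))^e * ‖(1:ℂ) - s‖ ≤ c2/2 * Q^(-e) := by
        calc _ ≤ C * (2^e * Q^e) * (2*τ) := by gcongr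
          _ = 2 * C * 2^e * k * (Q^e * Q^(-(2*e))) := by rw [hτ]; ring
          _ = 2 * C * 2^e * k * Q^(-e) := by rw [← Real.rpow_add hQ0]; congr 2; ring
          _ ≤ c2/2 * Q^(-e) := by
            have : k ≤ c2/(4*C*2^e) := min_le_right _ _
            rw [le_div_iff₀ (by positivity)] at this
            gcongr; linarith
      have b7 : Q^(-e) ≤ (q:ℝ)^(-e) := Real.rpow_le_rpow_of_nonpos (by linarith) hqQ (by linarith)
      have b8 : c2 * Q^(-e) ≤ c2 * (q:ℝ)^(-e) := by gcongr
      calc _ ≤ c2/2 * Q^(-e) := by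
            have := hm (-ε) (-e) (by rw [he]; linarith)
            gcongr
        _ ≤ _ := by
            have t2 := b4.trans (b2.trans b6)
            have t3 := b8.trans s1
            have t4 : c2 / 2 * Q^(-e) = c2 * Q^(-e) - c2/2 * Q^(-e) := by ring
            linarith
    · push Not at hσ
      refine le_trans ?_ (h3 q χ s hs hs2.le)
      calc _ ≤ c3*k * Q^(-(2*e)) := by
            have := hm (-ε) (-(2*e)) (by rw [he]; linarith)
            gcongr
        _ = c3 * τ := by rw [hτ]; ring
        _ ≤ _ := by gcongr

end SW

end

section

open Complex Finset
namespace SW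
open scoped ArithmeticFunction.vonMangoldt

lemma tL_absc {q : ℕ} (χ : DirichletCharacter ℂ q) : LSeries.abscissaOfAbsConv (tL χ) ≤ ((1:ℝ):EReal) :=
  LSeries.abscissaOfAbsConv_le_of_forall_lt_LSeriesSummable fun y hy => tL_summable χ (by simpa using hy)

lemma tL_log_summable {q : ℕ} (χ : DirichletCharacter ℂ q) (k : ℕ) {s : ℂ} (hs : 1 < s.re) :
    LSeriesSummable (LSeries.logMul^[k] (tL χ)) s := by
  apply LSeriesSummable_of_abscissaOfAbsConv_lt_re
  rw [LSeries.absicssaOfAbsConv_logPowMul]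
  exact (tL_absc χ).trans_lt (by exact_mod_cast hs)

lemma leib {q : ℕ} [NeZero q] (χ : DirichletCharacter ℂ q) (m : ℕ) {s : ℂ} (hs : 1 < s.re) :
    LSeries (LSeries.logMul^[m+1] (fun n => χ n)) s = ∑ i ∈ range (m+1), (m.choose i : ℂ) *
      LSeries (LSeries.logMul^[i] (tL χ)) s * LSeries (LSeries.logMul^[m-i] (fun n => χ n)) s := by
  have hab : ∀ z : ℂ, 1 < z.re → LSeries.abscissaOfAbsConv (fun n : ℕ => χ n) < z.re := fun z hz =>
    (abscissa_le_one (fun n => DirichletCharacter.norm_le_one χ _)).trans_lt (by exact_mod_cast hz)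
  have hat : ∀ z : ℂ, 1 < z.re → LSeries.abscissaOfAbsConv (tL χ) < z.re := fun z hz =>
    (tL_absc χ).trans_lt (by exact_mod_cast hz)
  have hopen : IsOpen {z : ℂ | 1 < z.re} := isOpen_lt continuous_const continuous_re
  have hmem : {z : ℂ | 1 < z.re} ∈ nhds s := hopen.mem_nhds hs
  have key : ∀ z : ℂ, 1 < z.re → LSeries (LSeries.logMul (fun n => χ n)) z =
      (LSeries (tL χ) * LSeries (fun n => χ n)) z := by
    intro z hz
    have h1 := LF_hasDeriv χ hz
    have h2 := LSeries_deriv (hab z hz)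
    have h3 : DirichletCharacter.LFunction χ =ᶠ[nhds z] LSeries (fun n => χ n) := by
      filter_upwards [hopen.mem_nhds hz] with w hw
      exact DirichletCharacter.LFunction_eq_LSeries χ hw
    have h4 := h3.deriv_eq
    rw [h1.deriv, h2, DirichletCharacter.LFunction_eq_LSeries χ hz] at h4
    simp only [Pi.mul_apply]
    linear_combination h4
  have key2 : LSeries (LSeries.logMul (fun n => χ n)) =ᶠ[nhds s] (LSeries (tL χ) * LSeries (fun n => χ n)) := by
    filter_upwards [hmem] with w hw using key w hw
  have h5 := key2.iteratedDeriv_eq m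
  have hab' : LSeries.abscissaOfAbsConv (LSeries.logMul (fun n : ℕ => χ n)) < s.re := by
    have := hab s hs
    rwa [← LSeries.abscissaOfAbsConv_logMul] at this
  rw [LSeries_iteratedDeriv m hab', iteratedDeriv_mul
    ((LSeries_analyticOnNhd _ s (hat s hs)).contDiffAt) ((LSeries_analyticOnNhd _ s (hab s hs)).contDiffAt)] at h5
  have h6 : ((-1:ℂ)^m) * (-1)^m = 1 := by rw [← mul_pow]; simp
  rw [Function.iterate_succ_apply]
  calc _ = (-1)^m * ((-1)^m * LSeries (LSeries.logMul^[m] (LSeries.logMul fun n => χ n)) s) := by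
        rw [← mul_assoc, h6, one_mul]
    _ = _ := by
        rw [h5, mul_sum]
        refine sum_congr rfl fun i hi => ?_
        rw [LSeries_iteratedDeriv i (hat s hs), LSeries_iteratedDeriv (m-i) (hab s hs)]
        have : ((-1:ℂ)^m) = (-1)^i * (-1)^(m-i) := by rw [← pow_add]; congr 1; simp at hi; omega
        have h7 : ((-1:ℂ)^i) * (-1)^i = 1 := by rw [← mul_pow]; simp
        have h8 : ((-1:ℂ)^(m-i)) * (-1)^(m-i) = 1 := by rw [← mul_pow]; simp
        rw [this]
        linear_combination ((m.choose i : ℂ) * LSeries (LSeries.logMul^[i] (tL χ)) s * LSeries (LSeries.logMul^[m-i] (fun n => χ n)) s) * (h7 + (-1:ℂ)^i * (-1)^i * (h8))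

theorem M_upper (k : ℕ) : ∀ {ε : ℝ}, 0 < ε → ∃ C : ℝ, 0 < C ∧ ∀ (q : ℕ) [NeZero q]
    (χ : DirichletCharacter ℂ q), χ ≠ 1 → ∀ s : ℂ, 1 < s.re → s.re < 2 →
    ‖LSeries (LSeries.logMul^[k] (tL χ)) s‖ ≤ C * (q * (|s.im| + 2)) ^ ε := by
  induction k using Nat.strong_induction_on with
  | _ k ih =>
  intro ε hε
  set e := ε/3 with he
  have he0 : 0 < e := by positivity
  obtain ⟨c, hc, hlow⟩ := LF_lower he0
  choose U hU0 hU using fun j : ℕ => upper_char j he0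
  have : ∀ i : ℕ, ∃ C : ℝ, 0 < C ∧ (i < k → ∀ (q : ℕ) [NeZero q]
    (χ : DirichletCharacter ℂ q), χ ≠ 1 → ∀ s : ℂ, 1 < s.re → s.re < 2 →
    ‖LSeries (LSeries.logMul^[i] (tL χ)) s‖ ≤ C * (q * (|s.im| + 2)) ^ e) := by
    intro i
    by_cases hi : i < k
    · obtain ⟨C, h1, h2⟩ := ih i hi he0
      exact ⟨C, h1, fun _ => h2⟩
    · exact ⟨1, one_pos, fun h => absurd h hi⟩
  choose V hV0 hV using this
  have hB0 : 0 < U (k+1) + ∑ i ∈ range k, (k.choose i : ℝ) * V i * U (k-i) := by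
    have := hU0 (k+1)
    have : 0 ≤ ∑ i ∈ range k, (k.choose i : ℝ) * V i * U (k-i) :=
      sum_nonneg fun i _ => mul_nonneg (mul_nonneg (Nat.cast_nonneg _) (hV0 i).le) (hU0 _).le
    linarith
  refine ⟨(U (k+1) + ∑ i ∈ range k, (k.choose i : ℝ) * V i * U (k-i)) / c, by positivity, fun q _ χ hχ s hs hs2 => ?_⟩
  have hq := char_ne_one_gt (q := q)
  have hl := leib χ k hs
  rw [sum_range_succ] at hl
  simp only [Nat.choose_self, Nat.cast_one, one_mul, Nat.sub_self, Function.iterate_zero, id_eq] at hl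
  rw [← DirichletCharacter.LFunction_eq_LSeries χ hs] at hl
  have hlow' := hlow q χ hχ s hs hs2
  set Q : ℝ := q * (|s.im| + 2) with hQ
  have hQ1 : 1 ≤ Q := by nlinarith [abs_nonneg s.im]
  have hQ0 : 0 < Q := by linarith
  have hQe : 1 ≤ Q^e := Real.one_le_rpow hQ1 he0.le
  set M := LSeries (LSeries.logMul^[k] (tL χ)) s with hM
  have e1 : M * DirichletCharacter.LFunction χ s = LSeries (LSeries.logMul^[k+1] (fun n => χ n)) s -
      ∑ i ∈ range k, (k.choose i : ℂ) *
      LSeries (LSeries.logMul^[i] (tL χ)) s * LSeries (LSeries.logMul^[k-i] (fun n => χ n)) s := by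
    rw [hl]; ring
  have e2 : ‖M‖ * ‖DirichletCharacter.LFunction χ s‖ ≤
      (U (k+1) + ∑ i ∈ range k, (k.choose i : ℝ) * V i * U (k-i)) * (Q^e * Q^e) := by
    rw [← norm_mul, e1]
    refine (norm_sub_le _ _).trans ?_
    rw [add_mul]
    refine add_le_add ?_ ?_
    · refine (hU (k+1) q χ hχ s hs hs2.le).trans ?_
      have := hU0 (k+1)
      rw [← hQ]
      gcongr
      nlinarith
    · rw [sum_mul]
      refine norm_sum_le_of_le _ fun i hi => ?_
      have h1 := hV i (mem_range.1 hi) q χ hχ s hs hs2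
      have h2 := hU (k-i) q χ hχ s hs hs2.le
      rw [← hQ] at h1 h2
      rw [norm_mul, norm_mul, Complex.norm_natCast]
      calc _ ≤ (k.choose i : ℝ) * (V i * Q^e) * (U (k-i) * Q^e) := by
            have := hV0 i
            gcongr
        _ = _ := by ring
  have e3 : ‖M‖ * (c * Q^(-e)) ≤ ‖M‖ * ‖DirichletCharacter.LFunction χ s‖ := by gcongr
  have e4 : Q^(-e) * Q^e = 1 := by rw [← Real.rpow_add hQ0]; simp
  have e5 : Q^ε = Q^e * Q^e * Q^e := by rw [← Real.rpow_add hQ0, ← Real.rpow_add hQ0]; congr 1; rw [he]; ring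
  rw [div_mul_eq_mul_div, le_div_iff₀ hc, e5]
  have e6 := mul_le_mul_of_nonneg_right (e3.trans e2) (by positivity : 0 ≤ Q^e)
  calc ‖M‖ * c = ‖M‖ * (c * Q^(-e)) * Q^e := by linear_combination (-‖M‖*c) * e4
    _ ≤ _ := e6
    _ = _ := by ring

end SW

end

section

open Complex Finset
namespace SW
open MeasureTheory

/-- kernel -/
noncomputable def Gk (s : ℂ) : ℂ := 1 / s - 1 / (s + 1)

lemma mellin_hat {s : ℂ} (hs : 0 < s.re) : HasMellin (fun u : ℝ => ((max (1-u) 0 : ℝ):ℂ)) s (Gk s) := by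
  have h1 := hasMellin_sub (hasMellin_one_Ioc hs).1 (hasMellin_cpow_Ioc 1 (s := s) (by simp; linarith)).1
  rw [(hasMellin_one_Ioc hs).2, (hasMellin_cpow_Ioc 1 (s := s) (by simp; linarith)).2] at h1
  have he : ∀ u ∈ Set.Ioi (0:ℝ), ((Set.Ioc (0:ℝ) 1).indicator (fun _ => (1:ℂ)) u - (Set.Ioc (0:ℝ) 1).indicator (fun t : ℝ => (t:ℂ)^(1:ℂ)) u)
     = ((max (1-u) 0 : ℝ):ℂ) := by
    intro u hu
    simp only [Set.mem_Ioi] at hu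
    by_cases h : u ≤ 1
    · rw [Set.indicator_of_mem (by exact ⟨hu, h⟩), Set.indicator_of_mem (by exact ⟨hu, h⟩), max_eq_left (by linarith)]
      simp
    · rw [Set.indicator_of_notMem (by simp; intro; linarith), Set.indicator_of_notMem (by simp; intro; linarith), max_eq_right (by linarith)]
      simp
  refine ⟨?_, ?_⟩
  · refine h1.1.congr_fun (fun u hu => ?_) measurableSet_Ioi
    simp only
    rw [he u hu]
  · rw [Gk, ← h1.2, mellin, mellin]
    refine setIntegral_congr_fun measurableSet_Ioi fun u hu => ?_
    rw [← he u hu]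

lemma Gk_norm {σ : ℝ} (hσ : 1 ≤ σ) (t : ℝ) : ‖Gk (σ + t * I)‖ ≤ 2 * (1 + t^2)⁻¹ := by
  set s : ℂ := σ + t * I with hs
  have hre : s.re = σ := by simp [hs]
  have him : s.im = t := by simp [hs]
  have h0 : s ≠ 0 := by intro h; rw [h] at hre; simp at hre; linarith
  have h1 : s + 1 ≠ 0 := by
    intro h; have := congrArg re h; simp [hre] at this; linarith
  have : Gk s = (s * (s+1))⁻¹ := by rw [Gk]; field_simp; ring
  rw [this, norm_inv, norm_mul, ← div_eq_mul_inv, inv_eq_one_div, div_le_div_iff₀ (by positivity) (by positivity)]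
  have a1 : 1 ≤ ‖s‖ := by have := Complex.re_le_norm s; linarith
  have a2 : 1 ≤ ‖s+1‖ := by have := Complex.re_le_norm (s+1); simp [hre] at this; linarith
  have a3 : |t| ≤ ‖s‖ := by have := Complex.abs_im_le_norm s; rwa [him] at this
  have a4 : |t| ≤ ‖s+1‖ := by have := Complex.abs_im_le_norm (s+1); simpa [him] using this
  have : t^2 = |t| * |t| := by rw [← sq, sq_abs]
  have b1 : |t| * |t| ≤ ‖s‖*‖s+1‖ := by gcongr
  nlinarith

lemma Gk_int {σ : ℝ} (hσ : 1 ≤ σ) : Integrable (fun t : ℝ => Gk (σ + t * I)) := by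
  refine (integrable_inv_one_add_sq.const_mul 2).mono' ?_ (Filter.Eventually.of_forall fun t => Gk_norm hσ t)
  apply Measurable.aestronglyMeasurable
  unfold Gk
  fun_prop

lemma hat_inv {σ : ℝ} (hσ : 1 ≤ σ) {u : ℝ} (hu : 0 < u) :
    ((max (1-u) 0 : ℝ):ℂ) = (1/(2*Real.pi) : ℝ) • ∫ t : ℝ, (u:ℂ)^(-(σ + t * I)) * Gk (σ + t*I) := by
  have hm : ∀ t : ℝ, mellin (fun u : ℝ => ((max (1-u) 0 : ℝ):ℂ)) (σ + t * I) = Gk (σ + t*I) := fun t =>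
    (mellin_hat (by simp; linarith)).2
  have h := mellinInv_mellin_eq σ (fun u : ℝ => ((max (1-u) 0 : ℝ):ℂ)) hu (mellin_hat (by simp; linarith)).1 ?_ ?_
  · rw [← h, mellinInv]
    simp only [hm, smul_eq_mul]
  · rw [VerticalIntegrable]; simp only [hm]; exact Gk_int hσ
  · fun_prop

lemma majo : Integrable (fun t : ℝ => 6 * (1 + t^2)^(-(3/2:ℝ)/2)) := by
  have := integrable_rpow_neg_one_add_norm_sq (E := ℝ) (μ := volume) (r := 3/2) (by simp; norm_num)
  simp only [Real.norm_eq_abs, sq_abs] at this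
  exact this.const_mul 6

lemma majo_le (t : ℝ) : (|t|+2)^(1/2:ℝ) * (2 * (1+t^2)⁻¹) ≤ 6 * (1 + t^2)^(-(3/2:ℝ)/2) := by
  have hp : 0 < 1 + t^2 := by positivity
  have h1 : (|t|+2)^(1/2:ℝ) ≤ 3 * (1+t^2)^(1/4:ℝ) := by
    have : |t|+2 ≤ 9 * (1+t^2)^(1/2:ℝ) := by
      have a : |t| ≤ (1+t^2)^(1/2:ℝ) := by
        rw [← Real.sqrt_eq_rpow]; apply Real.abs_le_sqrt; linarith
      have b : 1 ≤ (1+t^2)^(1/2:ℝ) := Real.one_le_rpow (by nlinarith) (by norm_num)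
      linarith
    calc _ ≤ (9 * (1+t^2)^(1/2:ℝ))^(1/2:ℝ) := by gcongr
      _ = _ := by
        rw [Real.mul_rpow (by norm_num) (by positivity), ← Real.rpow_mul hp.le]
        congr 1
        · rw [← Real.sqrt_eq_rpow, show (9:ℝ) = 3^2 by norm_num, Real.sqrt_sq (by norm_num)]
        · norm_num
  have h2 : (1 + t^2)^(-(3/2:ℝ)/2) = (1+t^2)^(1/4:ℝ) * (1+t^2)⁻¹ := by
    rw [← Real.rpow_neg_one, ← Real.rpow_add hp]; norm_num
  rw [h2]
  calc _ ≤ 3 * (1+t^2)^(1/4:ℝ) * (2 * (1+t^2)⁻¹) := by gcongr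
    _ = _ := by ring

/-- smoothed Perron bound -/
theorem perron : ∃ C : ℝ, 0 < C ∧ ∀ (a : ℕ → ℂ) (σ Y B : ℝ) (R : ℕ), 1 ≤ σ → 0 < Y → Y ≤ R → a 0 = 0 →
    LSeriesSummable a σ → (∀ t : ℝ, ‖LSeries a (σ + t * I)‖ ≤ B * (|t|+2)^(1/2:ℝ)) →
    ‖∑ n ∈ range R, a n * ((max (1 - n/Y) 0 : ℝ):ℂ)‖ ≤ C * B * Y^σ := by
  refine ⟨(∫ t : ℝ, 6 * (1 + t^2)^(-(3/2:ℝ)/2)) + 1, ?_, ?_⟩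
  · have : 0 ≤ ∫ t : ℝ, 6 * (1 + t^2)^(-(3/2:ℝ)/2) := integral_nonneg fun t => by positivity
    linarith
  intro a σ Y B R hσ hY hR ha0 hsum hB
  set F : ℕ → ℝ → ℂ := fun n t => LSeries.term a (σ + t*I) n * ((Y:ℂ)^((σ:ℂ) + t*I) * Gk (σ+t*I)) with hF
  have hB0 : 0 ≤ B := by
    have := (norm_nonneg _).trans (hB 0)
    have h2 : 0 < (|(0:ℝ)|+2)^(1/2:ℝ) := by positivity
    by_contra h; push Not at h
    nlinarith
  have hYn : ∀ t : ℝ, ‖(Y:ℂ)^((σ:ℂ) + t*I)‖ = Y^σ := by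
    intro t; rw [Complex.norm_cpow_eq_rpow_re_of_pos hY]; simp
  have hFn : ∀ n t, ‖F n t‖ = ‖LSeries.term a σ n‖ * (Y^σ * ‖Gk (σ+t*I)‖) := by
    intro n t
    simp only [hF, norm_mul, hYn]
    congr 1
    rw [LSeries.norm_term_eq, LSeries.norm_term_eq]; simp
  have hFeq : ∀ n t, n ≠ 0 → F n t = a n * (((n/Y : ℝ):ℂ)^(-((σ:ℂ)+t*I)) * Gk (σ+t*I)) := by
    intro n t hn
    have hn' : (0:ℝ) < n := by exact_mod_cast Nat.pos_of_ne_zero hn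
    simp only [hF, LSeries.term_of_ne_zero hn]
    have : ((n/Y : ℝ):ℂ)^(-((σ:ℂ)+t*I)) = (Y:ℂ)^((σ:ℂ)+t*I) / (n:ℂ)^((σ:ℂ)+t*I) := by
      rw [show ((n/Y : ℝ):ℂ) = ((n:ℝ):ℂ) * ((Y⁻¹:ℝ):ℂ) by push_cast; rfl,
        Complex.mul_cpow_ofReal_nonneg hn'.le (by positivity), Complex.cpow_neg, Complex.ofReal_inv, 
        Complex.cpow_neg, Complex.inv_cpow, inv_inv]
      · push_cast; field_simp
      · rw [Complex.arg_ofReal_of_nonneg hY.le]; exact Real.pi_pos.ne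
    rw [this]; ring
  have hmeas : ∀ n, AEStronglyMeasurable (F n) volume := by
    intro n
    apply Measurable.aestronglyMeasurable
    by_cases hn : n = 0
    · simp [hF, hn]
    · have : F n = fun t : ℝ => a n * (((n/Y : ℝ):ℂ)^(-((σ:ℂ)+t*I)) * Gk (σ+t*I)) := funext fun t => hFeq n t hn
      rw [this]; unfold Gk; fun_prop
  have hG := Gk_int hσ
  have hFint : ∀ n, Integrable (F n) := by
    intro n
    refine ((hG.norm.const_mul (Y^σ)).const_mul ‖LSeries.term a σ n‖).mono' (hmeas n) (Filter.Eventually.of_forall fun t => ?_)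
    rw [hFn]
  have hS : Summable fun n => ∫ t, ‖F n t‖ := by
    simp only [hFn]
    simp only [integral_const_mul]
    exact (hsum.norm).mul_right _
  have hs := hasSum_integral_of_summable_integral_norm hFint hS
  have hval : ∀ n, ∫ t, F n t = (2*Real.pi:ℝ) • (a n * ((max (1 - n/Y) 0 : ℝ):ℂ)) := by
    intro n
    by_cases hn : n = 0
    · simp [hF, hn, ha0]
    · have hn' : (0:ℝ) < n := by exact_mod_cast Nat.pos_of_ne_zero hn
      rw [hat_inv hσ (u := n/Y) (by positivity)]
      simp_rw [hFeq n _ hn]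
      rw [integral_const_mul, mul_smul_comm, smul_smul]
      have := Real.pi_pos
      rw [show 2*Real.pi * (1/(2*Real.pi)) = 1 by field_simp, one_smul]
  simp only [hval] at hs
  have hfin : ∀ n, n ∉ range R → (2*Real.pi:ℝ) • (a n * ((max (1 - n/Y) 0 : ℝ):ℂ)) = 0 := by
    intro n hn
    simp only [mem_range, not_lt] at hn
    have : Y ≤ n := hR.trans (by exact_mod_cast hn)
    rw [max_eq_right]
    · simp
    · have := (one_le_div hY).2 this; linarith
  have h1 := hs.unique (hasSum_sum_of_ne_finset_zero hfin)
  rw [← smul_sum] at h1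
  have h2 : ‖∫ t, ∑' n, F n t‖ ≤ ∫ t, (B * Y^σ) * (6 * (1 + t^2)^(-(3/2:ℝ)/2)) := by
    refine norm_integral_le_of_norm_le (majo.const_mul _) (Filter.Eventually.of_forall fun t => ?_)
    simp only [hF]
    rw [tsum_mul_right]
    change ‖LSeries a (σ+t*I) * _‖ ≤ _
    rw [norm_mul, norm_mul, hYn]
    calc _ ≤ (B * (|t|+2)^(1/2:ℝ)) * (Y^σ * (2 * (1 + t^2)⁻¹)) := by
          gcongr
          · exact hB t
          · exact Gk_norm hσ t
      _ = (B*Y^σ) * ((|t|+2)^(1/2:ℝ) * (2 * (1+t^2)⁻¹)) := by ring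
      _ ≤ _ := mul_le_mul_of_nonneg_left (majo_le t) (by positivity)
  rw [h1, integral_const_mul, norm_smul, Real.norm_of_nonneg (by positivity)] at h2
  set X := ‖∑ n ∈ range R, a n * ((max (1 - n/Y) 0 : ℝ):ℂ)‖
  have hX : 0 ≤ X := norm_nonneg _
  have hpi := Real.pi_gt_three
  have h3 : X ≤ 2*Real.pi * X := by nlinarith
  have h4 : 0 ≤ B * Y^σ := by positivity
  nlinarith

end SW

end

section

open Complex Finset
namespace SW
open scoped ArithmeticFunction.vonMangoldt

lemma unsmooth (a : ℕ → ℂ) (N : ℕ) (hN : 1 ≤ N) (h D E : ℝ) (h0 : 0 < h) (hh : h ≤ N) (hE : 0 ≤ E) (hD : 0 ≤ D)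
    (h1 : ‖∑ n ∈ range (2*N+1), a n * ((max (1 - n/(N:ℝ)) 0 : ℝ):ℂ)‖ ≤ D * N)
    (h2 : ‖∑ n ∈ range (2*N+1), a n * ((max (1 - n/((N:ℝ)+h)) 0 : ℝ):ℂ)‖ ≤ D * (N+h))
    (h3 : ∀ n, n ≤ 2*N → ‖a n‖ ≤ E) :
    h * ‖∑ n ∈ range (N+1), a n‖ ≤ 5 * D * N^2 + h^2 * E := by
  have hN0 : (0:ℝ) < N := by exact_mod_cast hN
  have key : ∀ Y : ℝ, 0 < Y → (∑ n ∈ range (2*N+1), a n * ((max (Y - n) 0 : ℝ):ℂ)) =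
      Y * ∑ n ∈ range (2*N+1), a n * ((max (1 - n/Y) 0 : ℝ):ℂ) := by
    intro Y hY
    rw [mul_sum]
    refine sum_congr rfl fun n _ => ?_
    have : max (Y - n) 0 = Y * max (1 - n/Y) 0 := by
      rw [mul_max_of_nonneg _ _ hY.le]; congr 1
      · field_simp
      · simp
    rw [this]; push_cast; ring
  have hS : (h:ℂ) * ∑ n ∈ range (N+1), a n = ∑ n ∈ range (2*N+1), a n * (if n ≤ N then (h:ℂ) else 0) := by
    have : range (N+1) = (range (2*N+1)).filter (fun n => n ≤ N) := by
      ext n; simp; omega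
    rw [this, sum_filter, mul_sum]
    refine sum_congr rfl fun n _ => ?_
    split_ifs <;> ring
  have hid : (h:ℂ) * ∑ n ∈ range (N+1), a n =
      (∑ n ∈ range (2*N+1), a n * ((max ((N:ℝ)+h - n) 0 : ℝ):ℂ)) - (∑ n ∈ range (2*N+1), a n * ((max ((N:ℝ) - n) 0 : ℝ):ℂ))
      - ∑ n ∈ range (2*N+1), a n * ((max ((N:ℝ)+h - n) 0 - max ((N:ℝ) - n) 0 - (if n ≤ N then h else 0) : ℝ):ℂ) := by
    rw [hS, ← sum_sub_distrib, ← sum_sub_distrib]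
    refine sum_congr rfl fun n _ => ?_
    split_ifs <;> push_cast <;> ring
  have hrest : ‖∑ n ∈ range (2*N+1), a n * ((max ((N:ℝ)+h - n) 0 - max ((N:ℝ) - n) 0 - (if n ≤ N then h else 0) : ℝ):ℂ)‖ ≤ h^2 * E := by
    have hsub : Ioc N (N+⌊h⌋₊) ⊆ range (2*N+1) := by
      intro n hn
      have : ⌊h⌋₊ ≤ N := Nat.floor_le_of_le hh
      simp at hn ⊢; omega
    rw [← sum_subset hsub]
    · refine (norm_sum_le_of_le (Ioc N (N+⌊h⌋₊)) (f := fun n => a n * ((max ((N:ℝ)+h - n) 0 - max ((N:ℝ) - n) 0 - (if n ≤ N then h else 0) : ℝ):ℂ)) (n := fun _ => E * h) fun n hn => ?_).trans ?_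
      · have hn' := hsub hn
        simp only [mem_Ioc, mem_range] at hn hn'
        have : (N:ℝ) < n := by exact_mod_cast hn.1
        rw [norm_mul, Complex.norm_real, Real.norm_eq_abs, if_neg (by omega), max_eq_right (by linarith : (N:ℝ) - n ≤ 0)]
        gcongr
        · exact h3 n (by omega)
        · rw [sub_zero, sub_zero, abs_of_nonneg (le_max_right _ _)]
          exact max_le (by linarith) h0.le
      · rw [sum_const, Nat.card_Ioc, nsmul_eq_mul, Nat.add_sub_cancel_left]
        have := Nat.floor_le h0.le
        calc _ ≤ h * (E * h) := by gcongr
          _ = _ := by ring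
    · intro n hn hn2
      simp only [mem_Ioc, not_and_or, not_lt, not_le] at hn2
      have : max ((N:ℝ)+h - n) 0 - max ((N:ℝ) - n) 0 - (if n ≤ N then h else 0) = 0 := by
        rcases hn2 with h' | h'
        · have : (n:ℝ) ≤ N := by exact_mod_cast h'
          rw [if_pos h', max_eq_left (by linarith), max_eq_left (by linarith)]; ring
        · have h4 : ⌊h⌋₊ < n - N := by omega
          have h5 := (Nat.floor_lt h0.le).1 h4
          rw [Nat.cast_sub (by omega)] at h5
          rw [if_neg (by omega), max_eq_right (by linarith), max_eq_right (by linarith)]; ring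
      rw [this]; simp
  have hn1 : ‖(∑ n ∈ range (2*N+1), a n * ((max ((N:ℝ)+h - n) 0 : ℝ):ℂ))‖ ≤ (N+h) * (D * (N+h)) := by
    rw [key _ (by linarith), norm_mul, Complex.norm_real, Real.norm_of_nonneg (by linarith)]
    exact mul_le_mul_of_nonneg_left h2 (by linarith)
  have hn2 : ‖(∑ n ∈ range (2*N+1), a n * ((max ((N:ℝ) - n) 0 : ℝ):ℂ))‖ ≤ N * (D * N) := by
    rw [key _ (by linarith), norm_mul, Complex.norm_real, Real.norm_of_nonneg (by linarith)]
    exact mul_le_mul_of_nonneg_left h1 (by linarith)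
  have : h * ‖∑ n ∈ range (N+1), a n‖ = ‖(h:ℂ) * ∑ n ∈ range (N+1), a n‖ := by
    rw [norm_mul, Complex.norm_real, Real.norm_of_nonneg h0.le]
  rw [this, hid]
  refine (norm_sub_le _ _).trans ?_
  refine add_le_add ((norm_sub_le _ _).trans ?_) hrest
  have : ((N:ℝ)+h) * (D * (N+h)) ≤ D * (4*N^2) := by
    calc _ = D * (N+h)^2 := by ring
      _ ≤ D * (4*N^2) := by gcongr; nlinarith
  nlinarith

lemma tL_norm {q : ℕ} (χ : DirichletCharacter ℂ q) (n : ℕ) : ‖tL χ n‖ ≤ Real.log n := by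
  simp only [tL, Pi.mul_apply, norm_mul]
  rw [Complex.norm_real, Real.norm_of_nonneg ArithmeticFunction.vonMangoldt_nonneg]
  calc _ ≤ 1 * Real.log n := by
        gcongr
        · exact DirichletCharacter.norm_le_one χ _
        · exact ArithmeticFunction.vonMangoldt_le_log
    _ = _ := one_mul _

lemma log_three : 1 < Real.log 3 := by
  rw [Real.lt_log_iff_exp_lt (by norm_num)]; exact Real.exp_one_lt_three

lemma V_bound (k : ℕ) {ε : ℝ} (hε : 0 < ε) (hε2 : ε ≤ 1/2) : ∃ C : ℝ, 0 < C ∧ ∀ (q : ℕ) [NeZero q]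
    (χ : DirichletCharacter ℂ q), χ ≠ 1 → ∀ (Y : ℝ) (R : ℕ), 3 ≤ Y → Y ≤ R →
    ‖∑ n ∈ range R, LSeries.logMul^[k] (tL χ) n * ((max (1 - n/Y) 0 : ℝ):ℂ)‖ ≤ C * q^ε * Y := by
  obtain ⟨C1, h1, hM⟩ := M_upper k hε
  obtain ⟨C2, h2, hP⟩ := perron
  refine ⟨C2 * C1 * Real.exp 1, by positivity, fun q _ χ hχ Y R hY hR => ?_⟩
  have hl : 1 < Real.log Y := log_three.trans_le (Real.log_le_log (by norm_num) hY)
  have hY0 : 0 < Y := by linarith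
  have hil : (Real.log Y)⁻¹ < 1 := inv_lt_one_of_one_lt₀ hl
  have hil0 : 0 < (Real.log Y)⁻¹ := by positivity
  have := hP (LSeries.logMul^[k] (tL χ)) (1 + (Real.log Y)⁻¹) Y (C1 * q^ε) R (by linarith) hY0 hR ?_
    (tL_log_summable χ k (by rw [ofReal_re]; linarith)) ?_
  · refine this.trans (le_of_eq ?_)
    have : Y^(1 + (Real.log Y)⁻¹) = Y * Real.exp 1 := by
      rw [Real.rpow_add hY0, Real.rpow_one, Real.rpow_def_of_pos hY0, mul_inv_cancel₀ (by positivity)]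
    rw [this]; ring
  · rw [logMul_iter]; simp [tL]
  · intro t
    have := hM q χ hχ (((1 + (Real.log Y)⁻¹ : ℝ):ℂ) + t * I) (by simpa using hl.le.trans' zero_le_one |>.lt_of_ne (by rintro h; rw [← h] at hl; linarith)) (by simp; linarith)
    refine this.trans ?_
    have him : (((1 + (Real.log Y)⁻¹ : ℝ):ℂ) + t * I).im = t := by simp
    rw [him, Real.mul_rpow (by positivity) (by positivity), mul_assoc C1]
    gcongr
    linarith [abs_nonneg t]

theorem S_bound (m : ℕ) {ε : ℝ} (hε : 0 < ε) (hε2 : ε ≤ 1/2) : ∃ C : ℝ, 0 < C ∧ ∀ (q : ℕ) [NeZero q]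
    (χ : DirichletCharacter ℂ q), χ ≠ 1 → ∀ N : ℕ, 3 ≤ N →
    ‖∑ n ∈ range (N+1), LSeries.logMul^[2*m+1] (tL χ) n‖ ≤ C * q^ε * N * (Real.log N)^(m+1) := by
  obtain ⟨C, hC, hV⟩ := V_bound (2*m+1) hε hε2
  refine ⟨5*C + 2^(2*m+2), by positivity, fun q _ χ hχ N hN => ?_⟩
  have hN' : (3:ℝ) ≤ N := by exact_mod_cast hN
  have hl : 1 < Real.log N := log_three.trans_le (Real.log_le_log (by norm_num) hN')
  set l := Real.log N with hldef
  have hl0 : 0 < l := by linarith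
  have hN0 : (0:ℝ) < N := by linarith
  have hq := char_ne_one_gt (q := q)
  have hqe : 1 ≤ (q:ℝ)^ε := Real.one_le_rpow hq hε.le
  have hlp : 1 ≤ l^(m+1) := one_le_pow₀ hl.le
  set h := (N:ℝ) / l^(m+1) with hh
  have h0 : 0 < h := by positivity
  have hhN : h ≤ N := div_le_self hN0.le hlp
  have := unsmooth (LSeries.logMul^[2*m+1] (tL χ)) N (by omega) h (C * q^ε) ((2*l)^(2*m+2)) h0 hhN (by positivity) (by positivity)
    (hV q χ hχ N (2*N+1) hN' (by push_cast; linarith)) (hV q χ hχ (N+h) (2*N+1) (by linarith) (by push_cast; linarith)) ?_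
  · have e1 : h^2 * (2*l)^(2*m+2) = 2^(2*m+2) * N^2 := by
      rw [hh, mul_pow, div_pow, ← pow_mul, show (m+1)*2 = 2*m+2 by ring]; field_simp
    rw [e1] at this
    have e2 : h * ((5*C + 2^(2*m+2)) * q^ε * N * l^(m+1)) = (5*C + 2^(2*m+2)) * q^ε * N^2 := by
      rw [hh]; field_simp
    refine le_of_mul_le_mul_left ?_ h0
    rw [e2]
    refine this.trans ?_
    have : (2:ℝ)^(2*m+2) * N^2 * 1 ≤ 2^(2*m+2) * N^2 * q^ε := by gcongr
    linarith
  · intro n hn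
    rw [logMul_iter, norm_mul, norm_pow, Complex.norm_real, Real.norm_of_nonneg (Real.log_natCast_nonneg n)]
    have : Real.log n ≤ 2 * l := by
      rcases Nat.eq_zero_or_pos n with rfl | hpos
      · simp; positivity
      · calc Real.log n ≤ Real.log (2*N) := Real.log_le_log (by exact_mod_cast hpos) (by exact_mod_cast hn)
          _ = Real.log 2 + l := by rw [Real.log_mul (by norm_num) (by positivity)]
          _ ≤ _ := by have := Real.log_two_lt_d9; linarith
    calc _ ≤ Real.log n^(2*m+1) * Real.log n := by gcongr; exact tL_norm χ n
      _ = Real.log n^(2*m+2) := by ring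
      _ ≤ _ := by gcongr

end SW

end

section

open Complex Finset
namespace SW
open scoped ArithmeticFunction.vonMangoldt

lemma abel_mono (a : ℕ → ℂ) (w : ℕ → ℝ) (M N : ℕ) (hM : M ≤ N+1) (B : ℝ)
    (hB : ∀ j ≤ N+1, ‖∑ i ∈ range j, a i‖ ≤ B)
    (hw : ∀ n ≥ M, w (n+1) ≤ w n) (hw0 : ∀ n ≥ M, 0 ≤ w n) :
    ‖∑ n ∈ Ico M (N+1), a n * w n‖ ≤ 2 * B * w M := by
  rw [sum_Ico_eq_sum_range]
  set L := N+1-M with hL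
  have h1 : ∑ i ∈ range L, a (M+i) * (w (M+i):ℂ) = ∑ i ∈ range L, (if i < L then a (M+i) else 0) * (w (M+i):ℂ) :=
    sum_congr rfl fun i hi => by rw [if_pos (mem_range.1 hi)]
  rw [h1]
  have hB2 : ∀ j, ‖∑ i ∈ range j, (if i < L then a (M+i) else 0)‖ ≤ 2*B := by
    intro j
    rw [← sum_filter]
    have : (range j).filter (fun i => i < L) = range (min j L) := by ext; simp
    rw [this]
    have h2 : ∑ i ∈ range (min j L), a (M+i) = ∑ i ∈ range (M + min j L), a i - ∑ i ∈ range M, a i := by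
      rw [sum_range_add]; ring
    rw [h2]
    have := hB (M + min j L) (by omega)
    have := hB M hM
    refine (norm_sub_le _ _).trans (by linarith)
  refine (norm_sum_by_parts _ (fun i => (w (M+i):ℂ)) hB2 L).trans (le_of_eq ?_)
  have : ∀ j, ‖(w (M+j):ℂ)‖ + ∑ i ∈ range j, ‖(w (M+i):ℂ) - (w (M+(i+1)):ℂ)‖ = w M := by
    intro j
    have h3 : ∀ i, ‖(w (M+i):ℂ) - (w (M+(i+1)):ℂ)‖ = w (M+i) - w (M+(i+1)) := by
      intro i
      rw [← ofReal_sub, Complex.norm_real, Real.norm_of_nonneg]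
      have := hw (M+i) (by omega)
      rw [add_assoc] at this; linarith
    simp_rw [h3]
    rw [sum_range_sub' (fun i => w (M+i)), Complex.norm_real, Real.norm_of_nonneg (hw0 _ (by omega))]
    simp
  rw [this]

/-- prime sums of characters -/
theorem char_primes (m : ℕ) {ε : ℝ} (hε : 0 < ε) (hε2 : ε ≤ 1/2) : ∃ C : ℝ, 0 < C ∧ ∀ (q : ℕ) [NeZero q]
    (χ : DirichletCharacter ℂ q), χ ≠ 1 → ∀ N : ℕ, 3 ≤ N →
    ‖∑ p ∈ (Iic N).filter Nat.Prime, χ p‖ ≤ C * q^ε * N / (Real.log N)^m := by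
  obtain ⟨C1, hC1, hS⟩ := S_bound m hε hε2
  obtain ⟨C2, hC2, hlp⟩ := logpow_le (m+1) (δ := 1/2) (by norm_num)
  refine ⟨2*(C1+1)*2^(2*m+2) + 6*C2, by positivity, fun q _ χ hχ N hN => ?_⟩
  have hN' : (3:ℝ) ≤ N := by exact_mod_cast hN
  have hl : 1 < Real.log N := log_three.trans_le (Real.log_le_log (by norm_num) hN')
  set l := Real.log N with hldef
  have hl0 : 0 < l := by linarith
  have hN0 : (0:ℝ) < N := by linarith
  have hq := char_ne_one_gt (q := q)
  have hqe : 1 ≤ (q:ℝ)^ε := Real.one_le_rpow hq hε.le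
  have hlpw : ∀ j, 1 ≤ l^j := fun j => one_le_pow₀ hl.le
  set a := LSeries.logMul^[2*m+1] (tL χ) with ha
  have ha' : ∀ n, a n = (Real.log n:ℂ)^(2*m+1) * tL χ n := fun n => logMul_iter _ _ _
  set w : ℕ → ℝ := fun n => ((Real.log n)^(2*m+2))⁻¹ with hw
  set M := Nat.sqrt N + 1 with hM
  have hsq0 : 1 ≤ Nat.sqrt N := Nat.sqrt_pos.2 (by omega)
  have hM2 : 2 ≤ M := by omega
  have hMN : M ≤ N + 1 := by have := Nat.sqrt_le_self N; omega
  have hMsq : N < M * M := Nat.lt_succ_sqrt N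
  have hMr : (Nat.sqrt N : ℝ) ≤ Real.sqrt N := Real.nat_sqrt_le_real_sqrt
  have hlogM : l / 2 ≤ Real.log M := by
    have : l ≤ Real.log ((M:ℝ)*M) := Real.log_le_log hN0 (by exact_mod_cast hMsq.le)
    rw [Real.log_mul (by positivity) (by positivity)] at this
    linarith
  have hlogpos : ∀ n ≥ M, 0 < Real.log n := by
    intro n hn; apply Real.log_pos; exact_mod_cast (by omega : 1 < n)
  have hB : ∀ j ≤ N+1, ‖∑ i ∈ range j, a i‖ ≤ (C1+1) * q^ε * N * l^(m+1) := by
    intro j hj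
    by_cases hj3 : 4 ≤ j
    · obtain ⟨n, rfl⟩ : ∃ n, j = n+1 := ⟨j-1, by omega⟩
      refine (hS q χ hχ n (by omega)).trans ?_
      have : (n:ℝ) ≤ N := by exact_mod_cast (by omega : n ≤ N)
      have h2 : (0:ℝ) < n := by exact_mod_cast (by omega : 0 < n)
      have h3 : 0 ≤ Real.log n := Real.log_natCast_nonneg n
      have h4 : Real.log n ≤ l := Real.log_le_log h2 this
      gcongr
      linarith
    · have h1 : ‖∑ i ∈ range j, a i‖ ≤ ∑ i ∈ range j, (1:ℝ) := by
        refine norm_sum_le_of_le _ fun i hi => ?_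
        have hi' : i < 3 := by simp at hi; omega
        rw [ha', norm_mul, norm_pow, Complex.norm_real, Real.norm_of_nonneg (Real.log_natCast_nonneg i)]
        have hlog : Real.log i ≤ 1 := by
          interval_cases i
          · simp
          · simp
          · have := Real.log_two_lt_d9; push_cast; linarith
        have h0 := Real.log_natCast_nonneg i
        exact mul_le_one₀ (pow_le_one₀ h0 hlog) (norm_nonneg _) ((tL_norm χ i).trans hlog)
      refine h1.trans ?_
      rw [sum_const, card_range, nsmul_eq_mul, mul_one]
      have : (j:ℝ) ≤ 3 := by exact_mod_cast (by omega : j ≤ 3)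
      have h5 : (1:ℝ) * 1 * N * 1 ≤ (C1+1) * q^ε * N * l^(m+1) := by
        gcongr
        · linarith
        · exact hlpw _
      linarith
  have hA := abel_mono a w M N hMN _ hB ?_ ?_
  rotate_left
  · intro n hn
    have h1 := hlogpos n hn
    have h2 : Real.log n ≤ Real.log (n+1:ℕ) := Real.log_le_log (by exact_mod_cast (by omega : 0 < n)) (by exact_mod_cast (by omega))
    simp only [hw]
    gcongr
  · intro n hn
    have h1 := hlogpos n hn
    simp only [hw]; positivity
  -- rewrite main sum
  have hterm : ∀ n ≥ M, a n * (w n:ℂ) = χ n * ((Λ n / Real.log n : ℝ):ℂ) := by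
    intro n hn
    have h1 := (hlogpos n hn).ne'
    have h2 : (Real.log n:ℂ) ≠ 0 := by exact_mod_cast h1
    rw [ha']
    simp only [hw, tL, Pi.mul_apply]
    rw [Complex.ofReal_inv, Complex.ofReal_pow, Complex.ofReal_div]
    generalize (Real.log n:ℂ) = L at h2
    field_simp
    ring
  have hsplit : ∑ n ∈ Ico M (N+1), a n * (w n:ℂ) = ∑ p ∈ (Ico M (N+1)).filter Nat.Prime, χ p
      + ∑ n ∈ (Ico M (N+1)).filter (fun n => ¬ n.Prime), χ n * ((Λ n / Real.log n : ℝ):ℂ) := by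
    rw [← sum_filter_add_sum_filter_not (Ico M (N+1)) Nat.Prime]
    congr 1
    · refine sum_congr rfl fun p hp => ?_
      simp only [mem_filter, mem_Ico] at hp
      rw [hterm p hp.1.1, ArithmeticFunction.vonMangoldt_apply_prime hp.2, div_self (hlogpos p hp.1.1).ne']; simp
    · refine sum_congr rfl fun p hp => ?_
      simp only [mem_filter, mem_Ico] at hp
      rw [hterm p hp.1.1]
  have hnp : ‖∑ n ∈ (Ico M (N+1)).filter (fun n => ¬ n.Prime), χ n * ((Λ n / Real.log n : ℝ):ℂ)‖ ≤ 4 * Real.sqrt N * l := by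
    have h1 := Chebyshev.psi_sub_theta_le (x := N) (by linarith)
    rw [Chebyshev.psi_sub_theta_eq_sum_not_prime, Nat.floor_natCast] at h1
    have h2 : ‖∑ n ∈ (Ico M (N+1)).filter (fun n => ¬ n.Prime), χ n * ((Λ n / Real.log n : ℝ):ℂ)‖ ≤
        ∑ n ∈ (Ico M (N+1)).filter (fun n => ¬ n.Prime), 2 * Λ n := by
      refine norm_sum_le_of_le _ fun n hn => ?_
      simp only [mem_filter, mem_Ico] at hn
      have hlg : 1/2 ≤ Real.log n := by
        have : Real.log 2 ≤ Real.log n := Real.log_le_log (by norm_num) (by exact_mod_cast (by omega : 2 ≤ n))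
        have := Real.log_two_gt_d9; linarith
      have hv : 0 ≤ Λ n := ArithmeticFunction.vonMangoldt_nonneg
      rw [norm_mul, Complex.norm_real, Real.norm_of_nonneg (by positivity)]
      calc _ ≤ 1 * (Λ n / (1/2)) := by
            gcongr
            exact DirichletCharacter.norm_le_one χ _
        _ = _ := by ring
    have h3 : ∑ n ∈ (Ico M (N+1)).filter (fun n => ¬ n.Prime), 2 * Λ n ≤ ∑ n ∈ (Ioc 0 N).filter (fun n => ¬ n.Prime), 2 * Λ n := by
      apply sum_le_sum_of_subset_of_nonneg
      · intro n hn; simp at hn ⊢; exact ⟨by omega, hn.2⟩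
      · intro n _ _; have : 0 ≤ Λ n := ArithmeticFunction.vonMangoldt_nonneg
        positivity
    rw [← mul_sum (a := (2:ℝ)) (s := (Ioc 0 N).filter _)] at h3
    refine h2.trans (h3.trans ?_)
    linarith
  have hfirst : ∑ p ∈ (Iic N).filter Nat.Prime, χ p = ∑ p ∈ (range M).filter Nat.Prime, χ p + ∑ p ∈ (Ico M (N+1)).filter Nat.Prime, χ p := by
    rw [← sum_union]
    · congr 1; rw [← filter_union]; congr 1; ext n; simp; omega
    · apply disjoint_filter_filter; rw [Finset.disjoint_left]; intro n; simp; omega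
  have hsmall : ‖∑ p ∈ (range M).filter Nat.Prime, χ p‖ ≤ 2 * Real.sqrt N := by
    have : ‖∑ p ∈ (range M).filter Nat.Prime, χ p‖ ≤ ∑ p ∈ (range M).filter Nat.Prime, (1:ℝ) :=
      norm_sum_le_of_le _ fun p _ => DirichletCharacter.norm_le_one χ _
    refine this.trans ?_
    rw [sum_const, nsmul_eq_mul, mul_one]
    have h1 : (((range M).filter Nat.Prime).card : ℝ) ≤ M := by
      exact_mod_cast (card_filter_le _ _).trans (by simp)
    have h2 : (M:ℝ) ≤ 2 * Nat.sqrt N := by exact_mod_cast (by omega)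
    linarith
  have hsqrt : Real.sqrt N * l ≤ C2 * (N / l^m) := by
    have h1 := hlp N (by linarith)
    rw [← Real.sqrt_eq_rpow] at h1
    have h2 : Real.sqrt N * Real.sqrt N = N := Real.mul_self_sqrt hN0.le
    rw [← mul_div_assoc, le_div_iff₀ (by positivity)]
    calc Real.sqrt N * l * l^m = Real.sqrt N * l^(m+1) := by ring
      _ ≤ Real.sqrt N * (C2 * Real.sqrt N) := by gcongr
      _ = C2 * N := by linear_combination C2 * h2
  have hwM : w M ≤ 2^(2*m+2) / l^(2*m+2) := by
    have h1 : (l/2)^(2*m+2) ≤ Real.log M^(2*m+2) := by gcongr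
    calc w M ≤ ((l/2)^(2*m+2))⁻¹ := by simp only [hw]; gcongr
      _ = _ := by rw [div_pow, inv_div]
  have hmain : 2 * ((C1+1) * q^ε * N * l^(m+1)) * w M ≤ 2*(C1+1)*2^(2*m+2) * q^ε * (N / l^m) := by
    calc _ ≤ 2 * ((C1+1) * q^ε * N * l^(m+1)) * (2^(2*m+2) / l^(2*m+2)) := by gcongr
      _ = 2*(C1+1)*2^(2*m+2) * q^ε * (N / l^(m+1)) := by
        rw [show l^(2*m+2) = l^(m+1) * l^(m+1) by ring]; field_simp
      _ ≤ _ := by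
        gcongr
        · exact hl.le
        · omega
  have hfin : ‖∑ p ∈ (Iic N).filter Nat.Prime, χ p‖ ≤ 2*(C1+1)*2^(2*m+2) * q^ε * (N / l^m) + 6 * (C2 * (N / l^m)) := by
    have e1 : ∑ p ∈ (Iic N).filter Nat.Prime, χ p = ∑ p ∈ (range M).filter Nat.Prime, χ p + (∑ n ∈ Ico M (N+1), a n * (w n:ℂ)
      - ∑ n ∈ (Ico M (N+1)).filter (fun n => ¬ n.Prime), χ n * ((Λ n / Real.log n : ℝ):ℂ)) := by
      rw [hfirst, hsplit]; ring
    rw [e1]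
    refine (norm_add_le _ _).trans ?_
    have e2 := norm_sub_le (∑ n ∈ Ico M (N+1), a n * (w n:ℂ)) (∑ n ∈ (Ico M (N+1)).filter (fun n => ¬ n.Prime), χ n * ((Λ n / Real.log n : ℝ):ℂ))
    have e3 : Real.sqrt N ≤ Real.sqrt N * l := le_mul_of_one_le_right (Real.sqrt_nonneg _) hl.le
    linarith
  refine hfin.trans ?_
  have : 6 * (C2 * (N / l^m)) * 1 ≤ 6 * (C2 * (N / l^m)) * q^ε := by gcongr
  calc _ ≤ 2*(C1+1)*2^(2*m+2) * q^ε * (N / l^m) + 6 * (C2 * (N / l^m)) * q^ε := by linarith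
    _ = _ := by ring

end SW

end

section

open Complex Finset
namespace SW

/-- primes up to N -/
def PN (N : ℕ) : Finset ℕ := (Iic N).filter Nat.Prime

/-- primes up to N congruent to 1 mod d -/
def PAP (N d : ℕ) : Finset ℕ := (PN N).filter (fun p => d ∣ p - 1)

lemma card_PN (N : ℕ) : #(PN N) = Nat.primeCounting N := by
  rw [← Nat.primesLE_card_eq_primeCounting]
  congr 1
  ext p
  simp [PN, Nat.primesLE, Nat.primesBelow, Nat.lt_succ_iff]

lemma zmod_one_iff {d p : ℕ} (hp : 1 ≤ p) : ((p : ZMod d) = 1) ↔ d ∣ p - 1 := by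
  have := (ZMod.natCast_eq_natCast_iff 1 p d)
  rw [Nat.modEq_iff_dvd' hp] at this
  rw [← this]; push_cast; exact eq_comm

theorem siegel_walfisz (m : ℕ) {ε : ℝ} (hε : 0 < ε) (hε2 : ε ≤ 1/2) : ∃ C : ℝ, 0 < C ∧ ∀ d : ℕ, 0 < d → ∀ N : ℕ, 3 ≤ N →
    |(#(PAP N d) : ℝ) - #(PN N) / Nat.totient d| ≤ C * d^ε * N / (Real.log N)^m := by
  obtain ⟨C1, hC1, h1⟩ := char_primes m hε hε2
  obtain ⟨C2, hC2, h2⟩ := omega_le hε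
  obtain ⟨C3, hC3, h3⟩ := logpow_le m (δ := 1) one_pos
  refine ⟨C1 + C2 * C3, by positivity, fun d hd N hN => ?_⟩
  haveI : NeZero d := ⟨hd.ne'⟩
  have hN' : (3:ℝ) ≤ N := by exact_mod_cast hN
  have hl : 1 < Real.log N := log_three.trans_le (Real.log_le_log (by norm_num) hN')
  have hl0 : 0 < Real.log N := by linarith
  have hφ : (1:ℝ) ≤ Nat.totient d := by exact_mod_cast Nat.totient_pos.2 hd
  have hφ0 : (0:ℝ) < Nat.totient d := by linarith
  set X : ℝ := N / Real.log N^m with hX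
  have hX0 : 0 < X := by positivity
  have hdbl : ∑ χ : DirichletCharacter ℂ d, ∑ p ∈ PN N, χ p = Nat.totient d * #(PAP N d) := by
    rw [sum_comm]
    simp_rw [DirichletCharacter.sum_characters_eq]
    rw [PAP, card_filter, Nat.cast_sum, mul_sum]
    refine sum_congr rfl fun p hp => ?_
    have hp1 : 1 ≤ p := by simp [PN] at hp; exact hp.2.one_lt.le
    by_cases hh : d ∣ p - 1
    · rw [if_pos ((zmod_one_iff hp1).2 hh), if_pos hh]; simp
    · rw [if_neg (fun h => hh ((zmod_one_iff hp1).1 h)), if_neg hh]; simp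
  have htriv : ‖(∑ p ∈ PN N, (1 : DirichletCharacter ℂ d) p) - #(PN N)‖ ≤ #d.primeFactors := by
    have : ∑ p ∈ PN N, (1 : DirichletCharacter ℂ d) p - #(PN N) = ∑ p ∈ PN N, ((1 : DirichletCharacter ℂ d) p - 1) := by
      rw [sum_sub_distrib]; simp
    rw [this]
    calc _ ≤ ∑ p ∈ PN N, (if p ∣ d then (1:ℝ) else 0) := by
          refine norm_sum_le_of_le _ fun p hp => ?_
          have hpp : p.Prime := by simp [PN] at hp; exact hp.2
          split_ifs with hdv
          · have : ¬ IsUnit (p : ZMod d) := by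
              rw [ZMod.isUnit_iff_coprime]; intro hc
              exact hpp.one_lt.ne' (Nat.Coprime.eq_one_of_dvd hc hdv)
            rw [MulChar.map_nonunit _ this]; simp
          · have : IsUnit (p : ZMod d) := by
              rw [ZMod.isUnit_iff_coprime]; exact (Nat.Prime.coprime_iff_not_dvd hpp).2 hdv
            rw [MulChar.one_apply this]; simp
      _ = #((PN N).filter (· ∣ d)) := by rw [card_filter]; push_cast; rfl
      _ ≤ _ := by
          exact_mod_cast card_le_card (by
            intro p hp; simp [PN] at hp ⊢; exact ⟨hp.1.2, hp.2, hd.ne'⟩)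
  have hne : ‖∑ χ ∈ (univ : Finset (DirichletCharacter ℂ d)).erase 1, ∑ p ∈ PN N, χ p‖ ≤ Nat.totient d * (C1 * d^ε * X) := by
    refine (norm_sum_le_of_le (n := fun _ => C1 * d^ε * X) _ fun χ hχ => ?_).trans ?_
    · have := h1 d χ (ne_of_mem_erase hχ) N hN
      rwa [hX, ← mul_div_assoc]
    · rw [sum_const, nsmul_eq_mul]
      gcongr
      refine (card_le_card (erase_subset _ _)).trans ?_
      rw [card_univ, ← Nat.card_eq_fintype_card, DirichletCharacter.card_eq_totient_of_hasEnoughRootsOfUnity]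
  rw [← add_sum_erase _ _ (mem_univ (1 : DirichletCharacter ℂ d))] at hdbl
  have hone : 1 ≤ C3 * X := by
    have := h3 N (by linarith)
    rw [Real.rpow_one] at this
    rw [hX, ← mul_div_assoc, le_div_iff₀ (by positivity)]; linarith
  have hom : (#d.primeFactors : ℝ) ≤ C2 * d^ε * (C3 * X) := by
    have a := h2 d hd
    have b : (#d.primeFactors : ℝ) ≤ C2 * d^ε := by linarith
    calc _ ≤ C2 * d^ε * 1 := by linarith
      _ ≤ _ := by gcongr
  have key : ‖((Nat.totient d * #(PAP N d) : ℝ):ℂ) - (#(PN N):ℝ)‖ ≤ C2 * d^ε * (C3*X) + Nat.totient d * (C1 * d^ε * X) := by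
    push_cast
    rw [← hdbl]
    calc _ = ‖((∑ p ∈ PN N, (1 : DirichletCharacter ℂ d) p) - #(PN N)) + ∑ χ ∈ (univ : Finset (DirichletCharacter ℂ d)).erase 1, ∑ p ∈ PN N, χ p‖ := by
          congr 1; ring
      _ ≤ _ := (norm_add_le _ _).trans (add_le_add (htriv.trans hom) hne)
  rw [← ofReal_sub, Complex.norm_real, Real.norm_eq_abs] at key
  have e : (Nat.totient d * #(PAP N d) : ℝ) - #(PN N) = Nat.totient d * ((#(PAP N d) : ℝ) - #(PN N) / Nat.totient d) := by
    field_simp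
  rw [e, abs_mul, abs_of_pos hφ0] at key
  refine le_of_mul_le_mul_left (key.trans ?_) hφ0
  have : 1 * (C2 * d^ε * (C3*X)) ≤ Nat.totient d * (C2 * d^ε * (C3*X)) := by gcongr
  have e2 : (C1 + C2*C3) * d^ε * N / Real.log N^m = (C1 + C2*C3) * d^ε * X := by rw [hX]; ring
  rw [e2]
  nlinarith

end SW

end

section

open Complex Finset
namespace SW

/-- local factor -/
noncomputable def hh (l : ℕ) : ℝ := 1 / (((l:ℝ)+1) * ((l:ℝ)-2))

/-- multiplicative function -/
noncomputable def HH (d : ℕ) : ℝ := if Squarefree d then ∏ l ∈ d.primeFactors, hh l else 0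

/-- R(p) -/
noncomputable def RR (n : ℕ) : ℝ := ∏ l ∈ n.primeFactors, (1 + hh l)

lemma hh_two : hh 2 = 0 := by simp [hh]

lemma hh_bd {l : ℕ} (hl : l.Prime) : 0 ≤ hh l ∧ hh l ≤ (l:ℝ)⁻¹ := by
  rcases hl.eq_two_or_odd with rfl | h
  · rw [hh_two]; simp
  · have h3 : 3 ≤ l := by have := hl.two_le; omega
    have h3' : (3:ℝ) ≤ l := by exact_mod_cast h3
    have h0 : (0:ℝ) < l - 2 := by linarith
    refine ⟨by unfold hh; positivity, ?_⟩
    rw [hh, inv_eq_one_div, div_le_div_iff₀ (by positivity) (by positivity)]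
    nlinarith

lemma HH_nonneg (d : ℕ) : 0 ≤ HH d := by
  unfold HH; split_ifs
  · exact prod_nonneg fun l hl => (hh_bd (Nat.prime_of_mem_primeFactors hl)).1
  · exact le_rfl

lemma HH_zero : HH 0 = 0 := by simp [HH]
lemma HH_one : HH 1 = 1 := by simp [HH]

lemma HH_le (d : ℕ) : HH d ≤ (d:ℝ)⁻¹ := by
  unfold HH; split_ifs with h
  · calc _ ≤ ∏ l ∈ d.primeFactors, (l:ℝ)⁻¹ :=
          prod_le_prod (fun l hl => (hh_bd (Nat.prime_of_mem_primeFactors hl)).1) fun l hl => (hh_bd (Nat.prime_of_mem_primeFactors hl)).2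
      _ = _ := by
        rw [prod_inv_distrib]
        rw [← Nat.cast_prod, Nat.prod_primeFactors_of_squarefree h]
  · positivity

lemma tot_sq {d : ℕ} (hd : Squarefree d) : Nat.totient d = ∏ l ∈ d.primeFactors, (l-1) := by
  have h0 : d ≠ 0 := hd.ne_zero
  have := Nat.totient_mul_prod_primeFactors d
  rw [Nat.prod_primeFactors_of_squarefree hd, mul_comm] at this
  exact Nat.eq_of_mul_eq_mul_left (Nat.pos_of_ne_zero h0) this

lemma HH_phi_eq {d : ℕ} (hd : Squarefree d) : HH d / Nat.totient d = ∏ l ∈ d.primeFactors, (hh l / ((l:ℝ)-1)) := by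
  rw [HH, if_pos hd, prod_div_distrib, tot_sq hd, Nat.cast_prod]
  congr 1
  refine prod_congr rfl fun l hl => ?_
  rw [Nat.cast_sub (Nat.prime_of_mem_primeFactors hl).one_lt.le]; simp

lemma HH_phi_le (d : ℕ) : HH d / Nat.totient d ≤ (d:ℝ)^(-(3/2):ℝ) := by
  by_cases h : Squarefree d
  · rw [HH_phi_eq h]
    calc _ ≤ ∏ l ∈ d.primeFactors, (l:ℝ)^(-(3/2):ℝ) := by
          refine prod_le_prod (fun l hl => ?_) fun l hl => ?_
          · have hp := Nat.prime_of_mem_primeFactors hl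
            have : (2:ℝ) ≤ l := by exact_mod_cast hp.two_le
            exact div_nonneg (hh_bd hp).1 (by linarith)
          · have hp := Nat.prime_of_mem_primeFactors hl
            rcases hp.eq_two_or_odd with rfl | h
            · rw [hh_two]; simp; positivity
            · have h3 : 3 ≤ l := by have := hp.two_le; omega
              have h3' : (3:ℝ) ≤ l := by exact_mod_cast h3
              have hl0 : (0:ℝ) < l := by linarith
              have e : (l:ℝ)^(-(3/2):ℝ) = (l:ℝ)⁻¹ / Real.sqrt l := by
                rw [Real.sqrt_eq_rpow, ← Real.rpow_neg_one, ← Real.rpow_sub hl0]; norm_num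
              rw [e]
              have : Real.sqrt l ≤ l - 1 := by
                rw [Real.sqrt_le_left (by linarith)]; nlinarith
              have h1 := hh_bd hp
              have : 0 < Real.sqrt l := Real.sqrt_pos.2 hl0
              gcongr
              exact h1.2
      _ = _ := by
        rw [Real.finsetProd_rpow _ _ (fun l _ => by positivity)]
        rw [← Nat.cast_prod, Nat.prod_primeFactors_of_squarefree h]
  · rw [HH, if_neg h, zero_div]; positivity

lemma HH_mul {m n : ℕ} (h : m.Coprime n) : HH (m*n) = HH m * HH n := by
  unfold HH
  simp only [Nat.squarefree_mul h]
  by_cases h1 : Squarefree m <;> by_cases h2 : Squarefree n <;> simp [h1, h2]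
  rw [Nat.Coprime.primeFactors_mul h, prod_union h.disjoint_primeFactors]

lemma RR_eq {n : ℕ} (hn : n ≠ 0) : RR n = ∑ d ∈ n.divisors, HH d := by
  rw [RR, prod_one_add]
  have : ∑ d ∈ n.divisors, HH d = ∑ d ∈ n.divisors.filter Squarefree, HH d := by
    rw [sum_filter]; refine sum_congr rfl fun d _ => ?_
    split_ifs with h
    · rfl
    · rw [HH, if_neg h]
  rw [this]
  refine sum_nbij' (fun t => ∏ l ∈ t, l) (fun d => d.primeFactors) ?_ ?_ ?_ ?_ ?_
  · intro t ht
    rw [mem_powerset] at ht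
    have hp : ∀ p ∈ t, p.Prime := fun p hp => Nat.prime_of_mem_primeFactors (ht hp)
    rw [mem_filter, Nat.mem_divisors]
    refine ⟨⟨?_, hn⟩, ?_⟩
    · exact (prod_dvd_prod_of_subset _ _ _ ht).trans (Nat.prod_primeFactors_dvd n)
    · refine Finset.squarefree_prod_of_pairwise_isCoprime ?_ fun i hi => (hp i hi).squarefree
      intro a ha b hb hab
      exact Nat.coprime_iff_isRelPrime.1 ((Nat.coprime_primes (hp a ha) (hp b hb)).2 hab)
  · intro d hd
    rw [mem_filter, Nat.mem_divisors] at hd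
    rw [mem_powerset]
    exact Nat.primeFactors_mono hd.1.1 hn
  · intro t ht
    rw [mem_powerset] at ht
    exact Nat.primeFactors_prod fun p hp => Nat.prime_of_mem_primeFactors (ht hp)
  · intro d hd
    rw [mem_filter] at hd
    exact Nat.prod_primeFactors_of_squarefree hd.2
  · intro t ht
    rw [mem_powerset] at ht
    have hp : ∀ p ∈ t, p.Prime := fun p hp => Nat.prime_of_mem_primeFactors (ht hp)
    rw [HH, if_pos, Nat.primeFactors_prod hp]
    refine Finset.squarefree_prod_of_pairwise_isCoprime ?_ fun i hi => (hp i hi).squarefree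
    intro a ha b hb hab
    exact Nat.coprime_iff_isRelPrime.1 ((Nat.coprime_primes (hp a ha) (hp b hb)).2 hab)

lemma HH_phi_nonneg (d : ℕ) : 0 ≤ HH d / Nat.totient d := div_nonneg (HH_nonneg d) (by positivity)

lemma HH_phi_summable : Summable fun d : ℕ => HH d / Nat.totient d := by
  refine Summable.of_nonneg_of_le HH_phi_nonneg HH_phi_le ?_
  exact Real.summable_nat_rpow.2 (by norm_num)

lemma J_eq : J = ∑' d : ℕ, HH d / Nat.totient d := by
  have h := EulerProduct.eulerProduct_hasProd (f := fun d : ℕ => HH d / Nat.totient d) (by simp [HH_one])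
    (fun {m n} h => by rw [HH_mul h, Nat.totient_mul h]; push_cast; rw [mul_div_mul_comm])
    (by simpa only [Real.norm_of_nonneg (HH_phi_nonneg _)] using HH_phi_summable) (by simp [HH_zero])
  rw [← h.tprod_eq, J]
  refine tprod_congr fun p => ?_
  have hp : (p:ℕ).Prime := p.2
  have hz : ∀ e ∉ range 2, HH ((p:ℕ)^e) / Nat.totient ((p:ℕ)^e) = 0 := by
    intro e he
    rw [HH, if_neg, zero_div]
    intro hsq
    rw [mem_range] at he
    have := (Nat.squarefree_pow_iff hp.one_lt.ne' (by omega : e ≠ 0)).1 hsq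
    omega
  rw [tsum_eq_sum hz, sum_range_succ, sum_range_one, pow_zero, pow_one, HH_one]
  rw [HH_phi_eq hp.squarefree, hp.primeFactors, prod_singleton]
  simp only [Nat.totient_one, Nat.cast_one, div_one]
  split_ifs with h2
  · rw [h2, hh_two]; simp
  · rw [hh, div_div]; congr 2; ring

end SW

end

section

open Complex Finset
namespace SW

lemma card_PAP_le {N d : ℕ} (hd : 0 < d) : (#(PAP N d) : ℝ) ≤ N / d := by
  have h1 : #(PAP N d) ≤ N / d := by
    rw [← Nat.Ioc_filter_dvd_card_eq_div]
    refine card_le_card_of_injOn (fun p => p - 1) ?_ ?_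
    · intro p hp
      simp only [PAP, PN, coe_filter, mem_filter, mem_Iic, Set.mem_ofPred_eq] at hp
      have := hp.1.2.two_le
      simp only [coe_filter, mem_Ioc, Set.mem_ofPred_eq]
      exact ⟨by omega, hp.2⟩
    · intro p hp r hr h
      simp only [PAP, PN, coe_filter, mem_filter, mem_Iic, Set.mem_ofPred_eq] at hp hr
      have := hp.1.2.two_le
      have := hr.1.2.two_le
      simp only at h
      omega
  calc (#(PAP N d) : ℝ) ≤ ((N/d : ℕ):ℝ) := by exact_mod_cast h1
    _ ≤ _ := Nat.cast_div_le

lemma PAP_empty {N d : ℕ} (hd : d ∉ range (N+1)) : PAP N d = ∅ := by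
  rw [mem_range] at hd
  ext p
  simp only [PAP, PN, mem_filter, mem_Iic, notMem_empty, iff_false, not_and]
  intro hp hdv
  have := hp.2.two_le
  have := Nat.le_of_dvd (by omega) hdv
  omega

lemma sum_RR (N : ℕ) : ∑ p ∈ PN N, RR (p-1) = ∑ d ∈ range (N+1), HH d * #(PAP N d) := by
  have : ∀ p ∈ PN N, RR (p-1) = ∑ d ∈ range (N+1), if d ∣ p-1 then HH d else 0 := by
    intro p hp
    simp only [PN, mem_filter, mem_Iic] at hp
    have := hp.2.two_le
    rw [RR_eq (by omega), ← sum_filter]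
    congr 1
    ext d
    simp only [Nat.mem_divisors, mem_filter, mem_range]
    constructor
    · rintro ⟨h, h0⟩
      exact ⟨by have := Nat.le_of_dvd (by omega) h; omega, h⟩
    · rintro ⟨_, h⟩
      exact ⟨h, by omega⟩
  rw [sum_congr rfl this, sum_comm]
  refine sum_congr rfl fun d _ => ?_
  rw [← sum_filter, sum_const, nsmul_eq_mul, mul_comm, PAP]

theorem sumRR_asymp (a : ℕ) : ∃ C : ℝ, 0 ≤ C ∧ ∀ N : ℕ, 3 ≤ N →
    |∑ p ∈ PN N, RR (p-1) - J * #(PN N)| ≤ C * (N / (Real.log N)^a) := by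
  obtain ⟨C1, hC1, hSW⟩ := siegel_walfisz (6*a) (ε := 1/2) (by norm_num) le_rfl
  have hsum : Summable fun d : ℕ => (d:ℝ)^(-(5/4):ℝ) := Real.summable_nat_rpow.2 (by norm_num)
  have hS0 : 0 ≤ ∑' d : ℕ, (d:ℝ)^(-(5/4):ℝ) := tsum_nonneg fun d => by positivity
  refine ⟨(C1 + 2) * ∑' d : ℕ, (d:ℝ)^(-(5/4):ℝ), by positivity, fun N hN => ?_⟩
  have hN' : (3:ℝ) ≤ N := by exact_mod_cast hN
  have hl : 1 < Real.log N := log_three.trans_le (Real.log_le_log (by norm_num) hN')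
  set l := Real.log N with hldef
  have hl0 : 0 < l := by linarith
  have hN0 : (0:ℝ) < N := by linarith
  have hfin : ∀ d ∉ range (N+1), HH d * (#(PAP N d) : ℝ) = 0 := fun d hd => by rw [PAP_empty hd]; simp
  have hs1 : Summable fun d : ℕ => HH d * (#(PAP N d) : ℝ) := summable_of_ne_finset_zero hfin
  have hs2 : Summable fun d : ℕ => HH d / Nat.totient d * (#(PN N) : ℝ) := HH_phi_summable.mul_right _
  have e1 : ∑ p ∈ PN N, RR (p-1) - J * #(PN N) = ∑' d : ℕ, (HH d * (#(PAP N d) : ℝ) - HH d / Nat.totient d * (#(PN N) : ℝ)) := by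
    rw [hs1.tsum_sub hs2, tsum_mul_right, ← J_eq, sum_RR, tsum_eq_sum hfin]
  have hPN : (#(PN N) : ℝ) ≤ N := by
    have : PAP N 1 = PN N := by simp [PAP]
    have h := card_PAP_le (N := N) (d := 1) one_pos
    rw [this] at h; simpa using h
  set D : ℝ := l^(4*a) with hD
  have hD0 : 0 < D := by positivity
  have hD54 : D^(5/4:ℝ) = l^(5*a) := by
    rw [hD, ← Real.rpow_natCast l (4*a), ← Real.rpow_mul hl0.le, ← Real.rpow_natCast]; congr 1; push_cast; ring
  have hD14 : D^(-(1/4):ℝ) = (l^a)⁻¹ := by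
    rw [hD, ← Real.rpow_natCast l (4*a), ← Real.rpow_mul hl0.le, ← Real.rpow_natCast, ← Real.rpow_neg hl0.le]; congr 1; push_cast; ring
  set X := (N:ℝ) / l^a with hX
  have hX0 : 0 < X := by positivity
  have hb : ∀ d : ℕ, ‖HH d * (#(PAP N d) : ℝ) - HH d / Nat.totient d * (#(PN N) : ℝ)‖ ≤ (C1+2) * X * (d:ℝ)^(-(5/4):ℝ) := by
    intro d
    rcases Nat.eq_zero_or_pos d with rfl | hd
    · rw [HH_zero]; simp
    have hd1 : (1:ℝ) ≤ d := by exact_mod_cast hd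
    have hd0 : (0:ℝ) < d := by linarith
    have hH0 := HH_nonneg d
    by_cases hc : (d:ℝ) ≤ D
    · have := hSW d hd N hN
      have e2 : HH d * (#(PAP N d) : ℝ) - HH d / Nat.totient d * (#(PN N) : ℝ) = HH d * (#(PAP N d) - #(PN N) / Nat.totient d) := by ring
      rw [e2, norm_mul, Real.norm_of_nonneg hH0, Real.norm_eq_abs]
      have h1 : HH d * (d:ℝ)^(1/2:ℝ) ≤ 1 := by
        calc _ ≤ (d:ℝ)⁻¹ * (d:ℝ)^(1:ℝ) := by
              gcongr
              · exact HH_le d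
              · norm_num
          _ = 1 := by rw [Real.rpow_one]; field_simp
      have h2 : 1 ≤ D^(5/4:ℝ) * (d:ℝ)^(-(5/4):ℝ) := by
        rw [Real.rpow_neg hd0.le, ← div_eq_mul_inv, one_le_div (by positivity)]
        gcongr
      calc _ ≤ HH d * (C1 * (d:ℝ)^(1/2:ℝ) * N / l^(6*a)) := by gcongr
        _ = C1 * (N / l^(6*a)) * (HH d * (d:ℝ)^(1/2:ℝ)) := by ring
        _ ≤ C1 * (N / l^(6*a)) * 1 := by gcongr
        _ ≤ C1 * (N / l^(6*a)) * (D^(5/4:ℝ) * (d:ℝ)^(-(5/4):ℝ)) := by gcongr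
        _ = C1 * X * (d:ℝ)^(-(5/4):ℝ) := by
          rw [hD54, hX, show l^(6*a) = l^(5*a) * l^a by rw [← pow_add]; congr 1; ring]; field_simp
        _ ≤ _ := by gcongr; linarith
    · push Not at hc
      have h1 : HH d * (#(PAP N d) : ℝ) ≤ N * (d:ℝ)^(-(3/2):ℝ) := by
        calc _ ≤ (d:ℝ)⁻¹ * (N / d) := by gcongr; exact HH_le d; exact card_PAP_le hd
          _ = N * (d:ℝ)^(-2:ℝ) := by rw [Real.rpow_neg hd0.le, Real.rpow_two]; field_simp
          _ ≤ _ := by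
            gcongr
            norm_num
      have h2 : HH d / Nat.totient d * (#(PN N) : ℝ) ≤ N * (d:ℝ)^(-(3/2):ℝ) := by
        rw [mul_comm]
        have := HH_phi_nonneg d
        gcongr
        exact HH_phi_le d
      have h3 : 0 ≤ HH d * (#(PAP N d) : ℝ) := by positivity
      have h4 : 0 ≤ HH d / Nat.totient d * (#(PN N) : ℝ) := mul_nonneg (HH_phi_nonneg d) (by positivity)
      have h5 : (d:ℝ)^(-(3/2):ℝ) ≤ (l^a)⁻¹ * (d:ℝ)^(-(5/4):ℝ) := by
        rw [← hD14, show (-(3/2):ℝ) = -(1/4) + -(5/4) by norm_num, Real.rpow_add hd0]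
        gcongr ?_ * _
        exact Real.rpow_le_rpow_of_nonpos hD0 hc.le (by norm_num)
      rw [Real.norm_eq_abs]
      calc _ ≤ 2 * (N * (d:ℝ)^(-(3/2):ℝ)) := by rw [abs_le]; constructor <;> linarith
        _ ≤ 2 * (N * ((l^a)⁻¹ * (d:ℝ)^(-(5/4):ℝ))) := by gcongr
        _ = 2 * X * (d:ℝ)^(-(5/4):ℝ) := by rw [hX]; ring
        _ ≤ _ := by gcongr; linarith
  rw [e1, ← Real.norm_eq_abs]
  refine (tsum_of_norm_bounded (hsum.hasSum.mul_left _) hb).trans (le_of_eq ?_)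
  ring

end SW

end

section

open Complex Finset
namespace SW

/-- local factor of the twin prime constant -/
noncomputable def cc (l : ℕ) : ℝ := if l = 2 then 1 else 1 - 1/((l:ℝ)-1)^2

/-- correction factor -/
noncomputable def ee (p : ℕ) : ℝ := 1 + 1/((p:ℝ)^2*((p:ℝ)-2))

lemma Kfactor_eq {p l : ℕ} (hp : p.Prime) (hp2 : p ≠ 2) (hl : l.Prime) :
    Kfactor p l = cc l * ((if l = 2 then 2/3 else 1) * (if l = p then ee p else 1) *
      (if l ∈ (p-1).primeFactors then 1 + hh l else 1)) := by
  have hp3 : 3 ≤ p := by have := hp.two_le; omega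
  have hdv : ((l:ℤ) ∣ (p:ℤ) - 1) ↔ l ∈ (p-1).primeFactors := by
    rw [Nat.mem_primeFactors_of_ne_zero (by omega)]
    rw [show (p:ℤ) - 1 = ((p-1:ℕ):ℤ) by push_cast [hp.one_lt.le]; rfl, Int.natCast_dvd_natCast]
    simp [hl]
  have hlp : l ∣ p ↔ l = p := Nat.prime_dvd_prime_iff_eq hl hp
  unfold Kfactor
  simp only [hdv, hlp]
  by_cases h1 : l = p
  · subst h1
    have hn : l ∉ (l-1).primeFactors := by
      intro h
      have := Nat.le_of_dvd (by omega) (Nat.dvd_of_mem_primeFactors h); omega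
    have h3 : (3:ℝ) ≤ l := by exact_mod_cast hp3
    have a1 : (l:ℝ) - 1 ≠ 0 := by linarith
    have a2 : (l:ℝ) - 2 ≠ 0 := by linarith
    have a3 : (l:ℝ) ≠ 0 := by linarith
    rw [if_pos rfl, if_neg hp2, if_pos rfl, if_neg hn, hp.factorization_self, cc, if_neg hp2, ee]
    field_simp
    ring
  · rw [if_neg h1, if_neg h1]
    by_cases h2 : l = 2
    · subst h2
      have hm : 2 ∈ (p-1).primeFactors := by
        rw [Nat.mem_primeFactors_of_ne_zero (by omega)]
        refine ⟨Nat.prime_two, ?_⟩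
        have := hp.eq_two_or_odd
        omega
      rw [if_pos hm, if_pos rfl, if_pos hm, hh_two, cc, if_pos rfl]
      norm_num
    · have h3 : 3 ≤ l := by have := hl.two_le; omega
      have h3' : (3:ℝ) ≤ l := by exact_mod_cast h3
      have a1 : (l:ℝ) - 1 ≠ 0 := by linarith
      have a2 : (l:ℝ) - 2 ≠ 0 := by linarith
      have a3 : (l:ℝ) ≠ 0 := by linarith
      have a4 : (l:ℝ) + 1 ≠ 0 := by linarith
      rw [if_neg h2, cc, if_neg h2]
      by_cases hm : l ∈ (p-1).primeFactors
      · rw [if_pos hm, if_pos hm, hh]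
        field_simp
        ring
      · rw [if_neg hm, if_neg hm]
        field_simp

lemma cc_mult : Multipliable fun l : Nat.Primes => cc (l:ℕ) := by
  have : Summable fun l : Nat.Primes => cc (l:ℕ) - 1 := by
    have h : Summable fun n : ℕ => 4 * (n:ℝ)^(-2:ℝ) := (Real.summable_nat_rpow.2 (by norm_num)).mul_left 4
    have h' := h.comp_injective (i := ((↑) : Nat.Primes → ℕ)) Subtype.val_injective
    refine Summable.of_norm_bounded h' fun l => ?_
    have h2 : (2:ℝ) ≤ (l:ℕ) := by exact_mod_cast l.2.two_le
    simp only [cc, Function.comp]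
    split_ifs
    · simp
    · rw [show 1 - 1/(((l:ℕ):ℝ)-1)^2 - 1 = -(1/(((l:ℕ):ℝ)-1)^2) by ring, norm_neg, Real.norm_of_nonneg (by positivity),
        Real.rpow_neg (by positivity), Real.rpow_two, ← div_eq_mul_inv, div_le_div_iff₀ (by nlinarith) (by positivity)]
      nlinarith
  have h := Real.multipliable_one_add_of_summable this
  simpa using h

lemma C2_eq : C₂ = ∏' l : Nat.Primes, cc (l:ℕ) := rfl

lemma RR_hasProd (n : ℕ) :
    HasProd (fun l : {l : ℕ // l.Prime} => if (l:ℕ) ∈ n.primeFactors then 1 + hh l else 1) (RR n) := by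
  have := hasProd_prod_of_ne_finset_one (L := SummationFilter.unconditional _)
      (f := fun l : {l : ℕ // l.Prime} => if (l:ℕ) ∈ n.primeFactors then 1 + hh l else 1)
      (s := n.primeFactors.subtype Nat.Prime) (by
        intro l hl
        rw [mem_subtype] at hl
        rw [if_neg hl])
  have e : ∏ b ∈ n.primeFactors.subtype Nat.Prime, (if (b:ℕ) ∈ n.primeFactors then 1 + hh b else 1) = RR n := by
    rw [prod_subtype_of_mem (fun l : ℕ => if l ∈ n.primeFactors then 1 + hh l else 1) (fun l hl => Nat.prime_of_mem_primeFactors hl)]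
    rw [RR]
    exact prod_congr rfl fun l hl => by rw [if_pos hl]
  rw [e] at this
  exact this

lemma K_hasProd {p : ℕ} (hp : p.Prime) (hp2 : p ≠ 2) :
    HasProd (fun l : Nat.Primes => Kfactor p l) (C₂ * (2/3 * ee p * RR (p-1))) := by
  classical
  have h0 : HasProd (fun l : Nat.Primes => cc (l:ℕ)) C₂ := cc_mult.hasProd
  have h1 : HasProd (fun l : Nat.Primes => if l = ⟨2, Nat.prime_two⟩ then (2/3:ℝ) else 1) (2/3) := hasProd_ite_eq _ _
  have h2 : HasProd (fun l : Nat.Primes => if l = ⟨p, hp⟩ then ee p else 1) (ee p) := hasProd_ite_eq _ _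
  have h3 : HasProd (fun l : Nat.Primes => if (l:ℕ) ∈ (p-1).primeFactors then 1 + hh l else 1) (RR (p-1)) :=
    RR_hasProd (p-1)
  have h := h0.mul ((h1.mul h2).mul h3)
  refine Eq.mp (congrArg (fun f => HasProd f _) (funext fun l => ?_)) h
  symm
  rw [Kfactor_eq hp hp2 l.2]
  have e1 : (l = (⟨2, Nat.prime_two⟩ : Nat.Primes)) ↔ (l:ℕ) = 2 := Subtype.ext_iff
  have e2 : (l = (⟨p, hp⟩ : Nat.Primes)) ↔ (l:ℕ) = p := Subtype.ext_iff
  simp only [e1, e2]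

lemma K_eq {p : ℕ} (hp : p.Prime) (hp2 : p ≠ 2) : K p = C₂ * (2/3 * ee p * RR (p-1)) :=
  (K_hasProd hp hp2).tprod_eq

lemma Kfactor_bd {p l : ℕ} (hl : l.Prime) : 0 ≤ Kfactor p l ∧ Kfactor p l ≤ 1 := by
  have h2 : (2:ℝ) ≤ l := by exact_mod_cast hl.two_le
  have h1 : (0:ℝ) < l - 1 := by linarith
  unfold Kfactor
  split_ifs with h h'
  · have hpw : (1:ℝ) ≤ (l:ℝ)^(p.factorization l) := one_le_pow₀ (by linarith)
    have : 1/((l:ℝ)^(p.factorization l) * ((l:ℝ)-1)) ≤ 1 := by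
      rw [div_le_one (by positivity)]; nlinarith
    have : 0 ≤ 1/((l:ℝ)^(p.factorization l) * ((l:ℝ)-1)) := by positivity
    constructor <;> linarith
  · have : (0 * (l:ℝ) + 1) / (((l:ℝ)-1)^2 * ((l:ℝ)+1)) ≤ 1 := by
      rw [div_le_one (by positivity)]; nlinarith
    have : 0 ≤ (0 * (l:ℝ) + 1) / (((l:ℝ)-1)^2 * ((l:ℝ)+1)) := by positivity
    constructor <;> linarith
  · have : (1 * (l:ℝ) + 1) / (((l:ℝ)-1)^2 * ((l:ℝ)+1)) ≤ 1 := by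
      rw [div_le_one (by positivity)]; nlinarith
    have : 0 ≤ (1 * (l:ℝ) + 1) / (((l:ℝ)-1)^2 * ((l:ℝ)+1)) := by positivity
    constructor <;> linarith

lemma K_bd {p : ℕ} (hp : p.Prime) (hp2 : p ≠ 2) : 0 ≤ K p ∧ K p ≤ 1 := by
  have h := K_hasProd hp hp2
  rw [← K_eq hp hp2] at h
  have h' : Filter.Tendsto (fun s : Finset Nat.Primes => ∏ l ∈ s, Kfactor p l) Filter.atTop (nhds (K p)) := by
    simpa [HasProd] using h
  exact ⟨ge_of_tendsto' h' fun s => prod_nonneg fun l _ => (Kfactor_bd l.2).1,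
    le_of_tendsto' h' fun s => prod_le_one (fun l _ => (Kfactor_bd l.2).1) fun l _ => (Kfactor_bd l.2).2⟩

lemma K_approx {p : ℕ} (hp : p.Prime) (hp2 : p ≠ 2) : |K p - 2/3 * C₂ * RR (p-1)| ≤ 2 / p := by
  have hp3 : (3:ℝ) ≤ p := by exact_mod_cast (by have := hp.two_le; omega : 3 ≤ p)
  have hb := K_bd hp hp2
  have he := K_eq hp hp2
  have e0 : 0 < (p:ℝ) - 2 := by linarith
  have e1 : 0 ≤ ee p - 1 := by rw [ee, add_sub_cancel_left]; positivity
  have e2 : ee p - 1 ≤ 1 / p := by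
    rw [ee, add_sub_cancel_left]
    apply one_div_le_one_div_of_le (by linarith); nlinarith
  set r := 2/3 * C₂ * RR (p-1) with hr
  have he' : K p = r * ee p := by rw [he, hr]; ring
  have hr0 : 0 ≤ r := by by_contra h; push Not at h; nlinarith
  have hr1 : r ≤ 1 := by nlinarith
  rw [he', show r * ee p - r = r * (ee p - 1) by ring, abs_of_nonneg (by positivity)]
  calc _ ≤ 1 * (1/(p:ℝ)) := by gcongr
    _ ≤ _ := by rw [one_mul]; gcongr; norm_num

lemma Kstar_approx {p : ℕ} (hp : p.Prime) (hp2 : p ≠ 2) : |Kstar p - K p| ≤ 2 / p := by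
  have hp3 : (3:ℝ) ≤ p := by exact_mod_cast (by have := hp.two_le; omega : 3 ≤ p)
  have hb := K_bd hp hp2
  rw [Kstar, Nat.totient_prime hp, Nat.cast_sub hp.one_lt.le, Nat.cast_one]
  have h1 : (0:ℝ) < p - 1 := by linarith
  have : K p * p / (p - 1) - K p = K p / (p-1) := by field_simp; ring
  rw [this, abs_of_nonneg (div_nonneg hb.1 h1.le), div_le_div_iff₀ h1 (by linarith)]
  nlinarith

end SW

end

section

open Complex Finset
namespace SW

lemma sum_two_div (N : ℕ) : ∑ p ∈ PN N, 2/(p:ℝ) ≤ 2 * (1 + Real.log N) := by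
  have h1 : ∑ p ∈ PN N, 2/(p:ℝ) ≤ ∑ p ∈ Icc 1 N, 2/(p:ℝ) := by
    refine sum_le_sum_of_subset_of_nonneg ?_ (fun i _ _ => by positivity)
    intro p hp
    simp only [PN, mem_filter, mem_Iic] at hp
    exact mem_Icc.2 ⟨hp.2.one_lt.le, hp.1⟩
  have h2 : ∑ p ∈ Icc 1 N, 2/(p:ℝ) = 2 * ((harmonic N : ℚ) : ℝ) := by
    rw [harmonic_eq_sum_Icc, mul_comm]
    push_cast
    rw [sum_mul]
    exact sum_congr rfl fun i _ => by ring
  rw [h2] at h1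
  have := harmonic_le_one_add_log N
  linarith

/-- A function of primes within `2/p` of another one has nearly the same sum. -/
lemma sum_near (f g : ℕ → ℝ) (h : ∀ p : ℕ, p.Prime → p ≠ 2 → |f p - g p| ≤ 2/p) (N : ℕ) :
    |∑ p ∈ PN N, f p - ∑ p ∈ PN N, g p| ≤ |f 2 - g 2| + 2 * (1 + Real.log N) := by
  rw [← sum_sub_distrib]
  refine (abs_sum_le_sum_abs _ _).trans ?_
  have h1 : ∑ p ∈ PN N, |f p - g p| ≤ ∑ p ∈ PN N, ((if p = 2 then |f 2 - g 2| else 0) + 2/(p:ℝ)) := by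
    refine sum_le_sum fun p hp => ?_
    simp only [PN, mem_filter, mem_Iic] at hp
    by_cases h2 : p = 2
    · subst h2
      rw [if_pos rfl]; have : (0:ℝ) ≤ 2/((2:ℕ):ℝ) := by positivity
      linarith
    · rw [if_neg h2, zero_add]; exact h p hp.2 h2
  refine h1.trans ?_
  rw [sum_add_distrib]
  refine add_le_add ?_ (sum_two_div N)
  rw [sum_ite_eq']
  split_ifs
  · exact le_rfl
  · positivity

lemma one_add_log_le (a : ℕ) (c : ℝ) (hc : 0 ≤ c) : ∃ C, 0 ≤ C ∧ ∀ N : ℕ, 3 ≤ N →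
    c + 2 * (1 + Real.log N) ≤ C * (N / (Real.log N)^a) := by
  obtain ⟨C, hC, h⟩ := logpow_le (a+1) (δ := 1) one_pos
  refine ⟨(c+4) * C, by positivity, fun N hN => ?_⟩
  have hN' : (3:ℝ) ≤ N := by exact_mod_cast hN
  have hl : 1 < Real.log N := log_three.trans_le (Real.log_le_log (by norm_num) hN')
  have h1 := h N (by linarith)
  rw [Real.rpow_one] at h1
  have h2 : Real.log N ≤ C * (N / (Real.log N)^a) := by
    rw [← mul_div_assoc, le_div_iff₀ (by positivity), ← pow_succ']
    exact h1
  calc c + 2 * (1 + Real.log N) ≤ (c+4) * Real.log N := by nlinarith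
    _ ≤ (c+4) * (C * (N / (Real.log N)^a)) := by gcongr
    _ = _ := by ring

lemma near_asymp (f g : ℕ → ℝ) (M : ℝ) (a : ℕ) (h : ∀ p : ℕ, p.Prime → p ≠ 2 → |f p - g p| ≤ 2/p)
    (hg : ∃ C, 0 ≤ C ∧ ∀ N : ℕ, 3 ≤ N → |∑ p ∈ PN N, g p - M * #(PN N)| ≤ C*(N/(Real.log N)^a)) :
    ∃ C, 0 ≤ C ∧ ∀ N : ℕ, 3 ≤ N → |∑ p ∈ PN N, f p - M * #(PN N)| ≤ C*(N/(Real.log N)^a) := by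
  obtain ⟨C, hC, h1⟩ := hg
  obtain ⟨C', hC', h2⟩ := one_add_log_le a |f 2 - g 2| (abs_nonneg _)
  refine ⟨C' + C, by positivity, fun N hN => ?_⟩
  have := (sum_near f g h N).trans (h2 N hN)
  have := abs_sub_le (∑ p ∈ PN N, f p) (∑ p ∈ PN N, g p) (M * #(PN N))
  have := h1 N hN
  linarith

lemma sumK_asymp (a : ℕ) : ∃ C, 0 ≤ C ∧ ∀ N : ℕ, 3 ≤ N →
    |∑ p ∈ PN N, K p - (2/3) * C₂ * J * #(PN N)| ≤ C*(N/(Real.log N)^a) := by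
  refine near_asymp K (fun p => 2/3 * C₂ * RR (p-1)) _ a (fun p hp hp2 => K_approx hp hp2) ?_
  obtain ⟨C, hC, h⟩ := sumRR_asymp a
  refine ⟨|2/3 * C₂| * C, by positivity, fun N hN => ?_⟩
  rw [← mul_sum, show 2/3 * C₂ * ∑ p ∈ PN N, RR (p-1) - 2/3*C₂*J*#(PN N) =
    2/3*C₂ * (∑ p ∈ PN N, RR (p-1) - J*#(PN N)) by ring, abs_mul, mul_assoc]
  gcongr
  exact h N hN

lemma sumKstar_asymp (a : ℕ) : ∃ C, 0 ≤ C ∧ ∀ N : ℕ, 3 ≤ N →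
    |∑ p ∈ PN N, Kstar p - (2/3) * C₂ * J * #(PN N)| ≤ C*(N/(Real.log N)^a) :=
  near_asymp Kstar K _ a (fun _ hp hp2 => Kstar_approx hp hp2) (sumK_asymp a)

lemma to_real (f : ℕ → ℝ) (M A : ℝ) (hA : 1 < A)
    (h : ∀ a : ℕ, ∃ C, 0 ≤ C ∧ ∀ N : ℕ, 3 ≤ N → |∑ p ∈ PN N, f p - M * #(PN N)| ≤ C*(N/(Real.log N)^a)) :
    ∃ C, 0 ≤ C ∧ ∀ x : ℝ, 2 ≤ x →
      |∑ p ∈ PN ⌊x⌋₊, f p - M * #(PN ⌊x⌋₊)| ≤ C * x / (Real.log x)^A := by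
  obtain ⟨a, ha⟩ := exists_nat_ge A
  obtain ⟨C, hC, h⟩ := h a
  set D := |∑ p ∈ PN 2, f p - M * #(PN 2)| with hD
  have hD0 : 0 ≤ D := abs_nonneg _
  refine ⟨C * 2^a + D * 2^A, by positivity, fun x hx => ?_⟩
  have hlx : 0 < Real.log x := Real.log_pos (by linarith)
  have hp : 0 < (Real.log x)^A := Real.rpow_pos_of_pos hlx A
  rw [mul_div_assoc, add_mul]
  rcases lt_or_ge x 3 with h3 | h3
  · have hf : ⌊x⌋₊ = 2 := by
      rw [Nat.floor_eq_iff (by linarith)]; norm_num; constructor <;> linarith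
    rw [hf, ← hD]
    have hl2 : Real.log x ≤ 2 := by
      have := Real.log_le_sub_one_of_pos (show 0 < x by linarith); linarith
    have h1 : (Real.log x)^A ≤ 2^A := Real.rpow_le_rpow hlx.le hl2 (by linarith)
    have h2 : 1 ≤ 2^A * (x / (Real.log x)^A) := by
      rw [← mul_div_assoc, le_div_iff₀ hp]
      have : (0:ℝ) < 2^A := by positivity
      nlinarith
    have h4 : 0 ≤ C * 2^a * (x / (Real.log x)^A) := by positivity
    have h5 : D ≤ D * (2^A * (x / (Real.log x)^A)) := le_mul_of_one_le_right hD0 h2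
    linarith
  · have hN : 3 ≤ ⌊x⌋₊ := Nat.le_floor (by exact_mod_cast h3)
    have hNx : (⌊x⌋₊:ℝ) ≤ x := Nat.floor_le (by linarith)
    have hxN : x < ⌊x⌋₊ + 1 := Nat.lt_floor_add_one x
    have h1 := h _ hN
    set N := ⌊x⌋₊
    have hN' : (3:ℝ) ≤ N := by exact_mod_cast hN
    have hlN : 1 < Real.log N := log_three.trans_le (Real.log_le_log (by norm_num) hN')
    have hl1 : 1 ≤ Real.log x := hlN.le.trans (Real.log_le_log (by linarith) hNx)
    have hl2 : Real.log x ≤ 2 * Real.log N := by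
      have : Real.log x ≤ Real.log ((N:ℝ)^2) := Real.log_le_log (by linarith) (by nlinarith)
      rwa [Real.log_pow] at this
    have h2 : (Real.log x)^A ≤ 2^a * (Real.log N)^a := by
      calc (Real.log x)^A ≤ (Real.log x)^(a:ℝ) := Real.rpow_le_rpow_of_exponent_le hl1 ha
        _ = (Real.log x)^a := Real.rpow_natCast _ _
        _ ≤ (2 * Real.log N)^a := by gcongr
        _ = _ := mul_pow _ _ _
    have h3' : (N:ℝ)/(Real.log N)^a ≤ 2^a * (x / (Real.log x)^A) := by
      rw [← mul_div_assoc, div_le_div_iff₀ (by positivity) hp]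
      calc (N:ℝ) * (Real.log x)^A ≤ x * (2^a * (Real.log N)^a) := by gcongr
        _ = _ := by ring
    have h4 : 0 ≤ D * 2^A * (x / (Real.log x)^A) := by positivity
    have h5 := mul_le_mul_of_nonneg_left h3' hC
    linarith

end SW

end

theorem stmt_10 (A : ℝ) (hA : 1 < A) :
    ∃ C : ℝ, ∀ x : ℝ, 2 ≤ x →
      |(∑ p ∈ (Finset.Iic ⌊x⌋₊).filter Nat.Prime, Kstar p)
          - (2/3) * C₂ * J * (Nat.primeCounting ⌊x⌋₊ : ℝ)|
        ≤ C * x / (Real.log x) ^ A ∧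
      |(∑ p ∈ (Finset.Iic ⌊x⌋₊).filter Nat.Prime, K p)
          - (2/3) * C₂ * J * (Nat.primeCounting ⌊x⌋₊ : ℝ)|
        ≤ C * x / (Real.log x) ^ A := by
  obtain ⟨C, hC, h⟩ := SW.to_real Kstar _ A hA SW.sumKstar_asymp
  obtain ⟨C', hC', h'⟩ := SW.to_real K _ A hA SW.sumK_asymp
  refine ⟨C + C', fun x hx => ?_⟩
  have hlx : 0 < Real.log x := Real.log_pos (by linarith)
  have hp : 0 < (Real.log x)^A := Real.rpow_pos_of_pos hlx A
  have h1 := h x hx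
  have h2 := h' x hx
  rw [SW.card_PN] at h1 h2
  refine ⟨h1.trans ?_, h2.trans ?_⟩
  · gcongr; linarith
  · gcongr; linarith
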